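/- Let L be a finite geometric lattice, and let (R'_{xy})_{x≤y∈L} be a family of polynomials in ℤ[t] satisfying: (i) R'_{xx}(t) = 1 for all x ∈ L; (ii) deg R'_{xy} < rk[x,y]/2 for all x < y; and (iii) for all x < z, t^{rk[x,z]}·R'_{xz}(1/t) = Σ_{x≤y≤z} R'_{xy}(t)·χ̄_{yz}(t) in ℤ[t], where χ̄_{yz}(t) = Σ_{y≤w≤z} μ(y,w)·t^{rk[y,w]} is the inverse kernel of χ. (These are the left Kazhdan–Lusztig–Stanley polynomials of the kernel χ̄.) Then for all x ≤ y, every coefficient of the polynomial (−1)^{rk[x,y]}·R'_{xy} is nonnegative. -/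

import Mathlib

set_option linter.unusedSectionVars false

namespace LeftKLS

/-- A real vector space with a symmetric form and an increasing filtration which is
self-orthogonal with respect to the form. -/
structure Flt (X : Type*) [AddCommGroup X] [Module ℝ X] where
  B : X →ₗ[ℝ] X →ₗ[ℝ] ℝ
  symm : ∀ u v, B u v = B v u
  F : ℤ → Submodule ℝ X
  mono : Monotone F
  n : ℤ
  perp : ∀ k v, v ∈ F (n - 1 - k) ↔ ∀ u ∈ F k, B u v = 0

/-- A filtered space with a self-adjoint automorphism shifting the filtration by one. -/
structure Pol (X : Type*) [AddCommGroup X] [Module ℝ X] extends Flt X where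
  T : X ≃ₗ[ℝ] X
  adj : ∀ u v, B (T u) v = B u (T v)
  shift : ∀ k u, u ∈ F k → T u ∈ F (k + 1)

/-- The alternating sign. -/
noncomputable def sg (k : ℤ) : ℝ := (-1) ^ k

lemma sg_add_one (k : ℤ) : sg (k + 1) = - sg k := by
  simp [sg, zpow_add₀]

lemma sg_sub_one (k : ℤ) : sg (k - 1) = - sg k := by
  have := sg_add_one (k - 1)
  rw [sub_add_cancel] at this
  linarith

lemma sg_mul_self (k : ℤ) : sg k * sg k = 1 := by
  rcases Int.even_or_odd k with h | h
  · simp [sg, h.neg_one_zpow]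
  · simp [sg, h.neg_one_zpow]

lemma sg_zero : sg 0 = 1 := by simp [sg]

section Sums

variable {M : Type*} [AddCommGroup M]

lemma sum_Icc_int (f : ℤ → M) {j : ℤ} (hj : 0 ≤ j) :
    ∑ i ∈ Finset.Icc 0 j, f i = ∑ i ∈ Finset.Icc 0 (j - 1), f i + f j := by
  have : Finset.Icc 0 j = insert j (Finset.Icc 0 (j - 1)) := by
    ext a; simp; omega
  rw [this, Finset.sum_insert (by simp), add_comm]

lemma sum_Icc_int_neg (f : ℤ → M) {j : ℤ} (hj : j < 0) :
    ∑ i ∈ Finset.Icc 0 j, f i = 0 := by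
  rw [Finset.Icc_eq_empty (by omega), Finset.sum_empty]

lemma sum_Icc_int_sub (f : ℤ → M) (hf : ∀ l < 0, f l = 0) {j : ℤ} (hj : 0 ≤ j) :
    ∑ i ∈ Finset.Icc 0 j, (f i - f (i - 1)) = f j := by
  induction j, hj using Int.leInduction with
  | base => simp [hf]
  | succ j hj ih => rw [sum_Icc_int _ (by omega), add_sub_cancel_right, ih]; abel

end Sums

section Forms

variable {X : Type*} [AddCommGroup X] [Module ℝ X]

/-- A functional which vanishes on the part of `S₀` orthogonal to `S` is represented on `S₀` by a
vector of `S`. -/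
lemma exists_represent [FiniteDimensional ℝ X] (b : X →ₗ[ℝ] X →ₗ[ℝ] ℝ) (S₀ S : Submodule ℝ X)
    (φ : X →ₗ[ℝ] ℝ) (h : ∀ f ∈ S₀, (∀ v ∈ S, b v f = 0) → φ f = 0) :
    ∃ v ∈ S, ∀ f ∈ S₀, b v f = φ f := by
  let Φ : S →ₗ[ℝ] Module.Dual ℝ S₀ := (b.domRestrict₁₂ S S₀)
  have key : φ.domRestrict S₀ ∈ LinearMap.range Φ := by
    rw [← Subspace.dualCoannihilator_dualAnnihilator_eq (W := LinearMap.range Φ),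
      Submodule.mem_dualAnnihilator]
    intro f hf
    rw [Submodule.mem_dualCoannihilator] at hf
    exact h f f.2 fun v hv => hf (Φ ⟨v, hv⟩) ⟨_, rfl⟩
  obtain ⟨v, hv⟩ := key
  exact ⟨v, v.2, fun f hf => (LinearMap.congr_fun hv ⟨f, hf⟩ :)⟩

end Forms

namespace Flt

variable {X : Type*} [AddCommGroup X] [Module ℝ X] (P : Flt X)

lemma B_zero {i j : ℤ} (h : i + j ≤ P.n - 1) {u v : X} (hu : u ∈ P.F i) (hv : v ∈ P.F j) :
    P.B u v = 0 :=
  (P.perp i v).1 (P.mono (by omega) hv) u hu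

end Flt

namespace Pol

variable {X : Type*} [AddCommGroup X] [Module ℝ X] (P : Pol X)

/-- The form twisted by the inverse of the automorphism. -/
noncomputable def q : X →ₗ[ℝ] X →ₗ[ℝ] ℝ := P.B.compl₂ (P.T.symm : X →ₗ[ℝ] X)

lemma q_apply (u v : X) : P.q u v = P.B u (P.T.symm v) := rfl

lemma q_T_right (u v : X) : P.q u (P.T v) = P.B u v := by simp [q_apply]

lemma q_symm (u v : X) : P.q u v = P.q v u := by
  obtain ⟨u, rfl⟩ := P.T.surjective u
  obtain ⟨v, rfl⟩ := P.T.surjective v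
  rw [q_T_right, q_T_right, P.adj, P.symm]

lemma q_T_left (u v : X) : P.q (P.T u) v = P.B u v := by rw [q_symm, q_T_right, P.symm]

lemma q_T_zero {i j : ℤ} (h : i + j ≤ P.n - 1) {u v : X} (hu : u ∈ P.F i) (hv : v ∈ P.F j) :
    P.q (P.T u) v = 0 := by
  rw [q_T_left]; exact P.B_zero h hu hv

/-- The Hodge–Riemann property in degree `k`. -/
def HRat (δ : ℝ) (k : ℤ) : Prop :=
  ∀ u ∈ P.F k, (∀ v ∈ P.F (k - 1), P.q u v = 0) →
    0 ≤ δ * sg k * P.q u u ∧ (P.q u u = 0 → ∃ g ∈ P.F (k - 1), u = P.T g)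

/-- The Hodge–Riemann property in all degrees up to the middle. -/
def HR (δ : ℝ) : Prop := ∀ k, 0 ≤ k → 2 * k ≤ P.n → P.HRat δ k

lemma exists_proj [FiniteDimensional ℝ X] {δ : ℝ} {l : ℤ}
    (hHR : P.HRat δ l) : ∃ p : X →ₗ[ℝ] X, ∀ x ∈ P.F (P.n - l), p x ∈ P.F l ∧
      ∀ v ∈ P.F l, P.q (x - p x) v = 0 := by
  have hv : ∀ x : P.F (P.n - l), ∃ v : P.F l, ∀ f ∈ P.F l, P.q v f = P.q x f := by
    intro x
    obtain ⟨v, hv, hv'⟩ := exists_represent P.q (P.F l) (P.F l) (P.q x) (by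
      intro f hf hf'
      obtain ⟨g, hg, rfl⟩ := (hHR f hf (fun v hv => by
        rw [P.q_symm]; exact hf' v (P.mono (by omega) hv))).2 (hf' f hf)
      rw [P.q_symm]
      exact P.q_T_zero (by omega) hg x.2)
    exact ⟨⟨v, hv⟩, hv'⟩
  choose s hs using hv
  let b := Module.Basis.ofVectorSpace ℝ (P.F (P.n - l))
  let s' : P.F (P.n - l) →ₗ[ℝ] P.F l := b.constr ℝ fun i => s (b i)
  have hs' : (P.q.domRestrict₁₂ (P.F l) (P.F l)) ∘ₗ s' =
      P.q.domRestrict₁₂ (P.F (P.n - l)) (P.F l) := by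
    refine b.ext fun i => LinearMap.ext fun f => ?_
    have : s' (b i) = s (b i) := b.constr_basis ℝ _ i
    rw [LinearMap.comp_apply, this]
    exact hs (b i) f f.2
  obtain ⟨p, hp⟩ := LinearMap.exists_extend ((P.F l).subtype ∘ₗ s')
  refine ⟨p, fun x hx => ?_⟩
  have hpx : p x = s' ⟨x, hx⟩ := LinearMap.congr_fun hp ⟨x, hx⟩
  refine ⟨hpx ▸ (s' _).2, fun v hv => ?_⟩
  have h3 := LinearMap.congr_fun (LinearMap.congr_fun hs' ⟨x, hx⟩) ⟨v, hv⟩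
  have h4 : P.q (p x) v = P.q x v := by rw [hpx]; exact h3
  simp [h4]

lemma exists_graded_proj [FiniteDimensional ℝ X] {δ : ℝ} (hneg : ∀ k < 0, P.F k = ⊥)
    (hHR : P.HR δ) {k : ℤ} (hk : 2 * k ≤ P.n) :
    ∃ p : ℤ → X →ₗ[ℝ] X, (∀ l < 0, p l = 0) ∧ (0 ≤ k → ∀ x, p k x = x) ∧
      (∀ l ≤ k, ∀ x ∈ P.F k, p l x ∈ P.F l) ∧
      (∀ l ≤ k, ∀ x ∈ P.F k, ∀ v ∈ P.F l, P.q (x - p l x) v = 0) := by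
  have : ∀ l : ℤ, ∃ p : X →ₗ[ℝ] X, (l < 0 → p = 0) ∧ (0 ≤ k → l = k → ∀ x, p x = x) ∧
      (l ≤ k → ∀ x ∈ P.F k, p x ∈ P.F l) ∧
      (l ≤ k → ∀ x ∈ P.F k, ∀ v ∈ P.F l, P.q (x - p x) v = 0) := by
    intro l
    by_cases h0 : l < 0
    · refine ⟨0, fun _ => rfl, fun _ _ => by omega, fun _ x _ => by simp, fun _ x _ v hv => ?_⟩
      rw [hneg l h0, Submodule.mem_bot] at hv
      simp [hv]
    by_cases hlk : l = k
    · subst hlk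
      exact ⟨LinearMap.id, fun h => absurd h h0, fun _ _ _ => rfl, fun _ x hx => hx, by simp⟩
    by_cases hl : l ≤ k
    · obtain ⟨p, hp⟩ := P.exists_proj (hHR l (by omega) (by omega))
      exact ⟨p, fun h => absurd h h0, fun _ h => absurd h hlk,
        fun _ x hx => (hp x (P.mono (by omega) hx)).1,
        fun _ x hx => (hp x (P.mono (by omega) hx)).2⟩
    · exact ⟨0, fun _ => rfl, fun _ h => absurd h hlk, fun h => absurd h hl,
        fun h => absurd h hl⟩
  choose p h1 h2 h3 h4 using this
  exact ⟨p, h1, fun h => h2 k h rfl, h3, h4⟩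

/-- `HodgeSeq P k x y` says that `y l` is the projection of `x ∈ F k` to `F l` with respect to the
twisted form. -/
structure HodgeSeq (k : ℤ) (x : X) (y : ℤ → X) : Prop where
  neg : ∀ l < 0, y l = 0
  last : y k = x
  mem : ∀ l ≤ k, y l ∈ P.F l
  orth : ∀ l ≤ k, ∀ v ∈ P.F l, P.q (x - y l) v = 0

namespace HodgeSeq

variable {P} {k : ℤ} {x : X} {y : ℤ → X} (h : P.HodgeSeq k x y)
include h

lemma q_eq {l : ℤ} (hl : l ≤ k) {v : X} (hv : v ∈ P.F l) : P.q (y l) v = P.q x v := by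
  have := h.orth l hl v hv
  rw [map_sub, LinearMap.sub_apply] at this
  linarith

lemma sub_mem {l : ℤ} (hl : l ≤ k) : y l - y (l - 1) ∈ P.F l :=
  Submodule.sub_mem _ (h.mem l hl) (P.mono (by omega) (h.mem (l - 1) (by omega)))

lemma sub_orth {l : ℤ} (hl : l ≤ k) {v : X} (hv : v ∈ P.F (l - 1)) :
    P.q (y l - y (l - 1)) v = 0 := by
  rw [map_sub, LinearMap.sub_apply, h.q_eq hl (P.mono (by omega) hv), h.q_eq (by omega) hv, sub_self]

lemma q_sub {l : ℤ} (hl : l ≤ k) : P.q (y l - y (l - 1)) x =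
    P.q (y l - y (l - 1)) (y l - y (l - 1)) := by
  rw [map_sub (P.q _), h.sub_orth hl (h.mem (l - 1) (by omega)), sub_zero,
    P.q_symm _ x, P.q_symm _ (y l), h.q_eq hl (h.sub_mem hl)]

lemma sum_eq (hk : 0 ≤ k) : ∑ i ∈ Finset.Icc 0 k, (y i - y (i - 1)) = x := by
  rw [sum_Icc_int_sub y h.neg hk, h.last]

lemma exists_of_sub (hk : 0 ≤ k)
    (hT : ∀ j, 0 ≤ j → j ≤ k → ∃ g ∈ P.F (j - 1), y j - y (j - 1) = P.T g) :
    ∃ g ∈ P.F (k - 1), x = P.T g := by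
  have : x ∈ (P.F (k - 1)).map (P.T : X →ₗ[ℝ] X) := by
    rw [← h.sum_eq hk]
    refine Submodule.sum_mem _ fun i hi => ?_
    rw [Finset.mem_Icc] at hi
    obtain ⟨g, hg, e⟩ := hT i hi.1 hi.2
    exact ⟨g, P.mono (by omega) hg, e.symm⟩
  obtain ⟨g, hg, e⟩ := this
  exact ⟨g, hg, e.symm⟩

end HodgeSeq

/-- Any `x ∈ F k` can be modified by an element of `S ≤ F k` such that the alternating sum of its
Hodge components is orthogonal to `S`. -/
lemma exists_hodgeSeq [FiniteDimensional ℝ X] {δ : ℝ} (hδ : δ * δ = 1)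
    (hneg : ∀ k < 0, P.F k = ⊥)
    (hHR : P.HR δ) {k : ℤ} (hk0 : 0 ≤ k) (hk : 2 * k ≤ P.n) {S : Submodule ℝ X} (hS : S ≤ P.F k)
    {x : X} (hx : x ∈ P.F k) :
    ∃ s ∈ S, ∃ y : ℤ → X, P.HodgeSeq k (x - s) y ∧
      ∀ v ∈ S, P.q (∑ i ∈ Finset.Icc 0 k, sg i • (y i - y (i - 1))) v = 0 := by
  obtain ⟨p, p1, p2, p3, p4⟩ := P.exists_graded_proj hneg hHR hk
  have hseq : ∀ x ∈ P.F k, P.HodgeSeq k x (fun l => p l x) := fun x hx =>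
    ⟨fun l hl => by simp [p1 l hl], p2 hk0 x, fun l hl => p3 l hl x hx, fun l hl => p4 l hl x hx⟩
  let J : X →ₗ[ℝ] X := ∑ i ∈ Finset.Icc 0 k, sg i • (p i - p (i - 1))
  have hJ : ∀ x, J x = ∑ i ∈ Finset.Icc 0 k, sg i • (p i x - p (i - 1) x) := fun x => by
    simp [J]
  have hJF : ∀ x ∈ P.F k, J x ∈ P.F k := by
    intro x hx
    rw [hJ]
    refine Submodule.sum_mem _ fun i hi => Submodule.smul_mem _ _ ?_
    rw [Finset.mem_Icc] at hi
    exact P.mono hi.2 ((hseq x hx).sub_mem hi.2)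
  have hJq : ∀ x ∈ P.F k, δ * P.q (J x) x =
      ∑ i ∈ Finset.Icc 0 k, δ * sg i * P.q (p i x - p (i - 1) x) (p i x - p (i - 1) x) := by
    intro x hx
    rw [hJ, map_sum, LinearMap.sum_apply, Finset.mul_sum]
    refine Finset.sum_congr rfl fun i hi => ?_
    rw [Finset.mem_Icc] at hi
    rw [map_smul, LinearMap.smul_apply, (hseq x hx).q_sub hi.2, smul_eq_mul, mul_assoc]
  obtain ⟨s, hs, hs'⟩ := exists_represent (P.q ∘ₗ J) S S ((P.q ∘ₗ J) x) (by
    intro f hf hf'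
    have hfk := hS hf
    have h0 : δ * P.q (J f) f = 0 := by
      have : P.q (J f) f = 0 := hf' f hf
      rw [this, mul_zero]
    rw [hJq f hfk, Finset.sum_eq_zero_iff_of_nonneg] at h0
    · obtain ⟨g, hg, e⟩ := (hseq f hfk).exists_of_sub hk0 (fun j hj0 hj => by
        refine (hHR j hj0 (by omega) _ ((hseq f hfk).sub_mem hj)
          (fun v hv => (hseq f hfk).sub_orth hj hv)).2 ?_
        have h1 := h0 j (Finset.mem_Icc.2 ⟨hj0, hj⟩)
        have h2 : δ * sg j ≠ 0 := by
          intro h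
          have := sg_mul_self j
          have h3 : (δ * sg j) * (δ * sg j) = (δ * δ) * (sg j * sg j) := by ring
          rw [h, hδ, this] at h3
          norm_num at h3
        exact (mul_eq_zero.1 h1).resolve_left h2)
      show P.q (J x) f = 0
      rw [e, P.q_symm]
      exact P.q_T_zero (by omega) hg (hJF x hx)
    · intro j hj
      rw [Finset.mem_Icc] at hj
      exact (hHR j hj.1 (by omega) _ ((hseq f hfk).sub_mem hj.2)
          (fun v hv => (hseq f hfk).sub_orth hj.2 hv)).1)
  refine ⟨s, hs, fun l => p l (x - s), hseq _ (Submodule.sub_mem _ hx (hS hs)), fun v hv => ?_⟩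
  rw [← hJ, map_sub, map_sub, LinearMap.sub_apply, sub_eq_zero]
  exact (hs' v hv).symm

end Pol

end LeftKLS

namespace LeftKLS

/-- A pair of adjoint maps between filtered spaces whose degrees differ by one. -/
structure Link {X₁ X₂ : Type*} [AddCommGroup X₁] [Module ℝ X₁] [AddCommGroup X₂] [Module ℝ X₂]
    (P₁ : Pol X₁) (P₂ : Pol X₂) (D : X₁ →ₗ[ℝ] X₂) (d : X₂ →ₗ[ℝ] X₁) : Prop where
  deg : P₁.n = P₂.n + 1
  D_mem : ∀ k, ∀ u ∈ P₁.F k, D u ∈ P₂.F k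
  d_mem : ∀ k, ∀ u ∈ P₂.F k, d u ∈ P₁.F (k + 1)
  adj : ∀ u v, P₁.B (d u) v = P₂.B u (D v)
  D_T : ∀ u, D (P₁.T u) = P₂.T (D u)
  d_T : ∀ u, d (P₂.T u) = P₁.T (d u)

namespace Pol

variable {X : Type*} [AddCommGroup X] [Module ℝ X] (P : Pol X)

/-- Translation of the filtration. -/
def twist (c : ℤ) : Pol X where
  B := P.B
  symm := P.symm
  F k := P.F (k + c)
  mono _ _ h := P.mono (by omega)
  n := P.n - 2 * c
  perp k v := by
    rw [← P.perp (k + c) v]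
    have : P.n - 2 * c - 1 - k + c = P.n - 1 - (k + c) := by ring
    rw [this]
  T := P.T
  adj := P.adj
  shift k u hu := by
    have := P.shift _ u hu
    have e : k + 1 + c = k + c + 1 := by ring
    rwa [e]

lemma HR.twist_one {δ : ℝ} (h : P.HR δ) : (P.twist 1).HR (-δ) := by
  intro k hk0 hk u hu hq
  have hk' : 2 * k ≤ P.n - 2 * 1 := hk
  have := h (k + 1) (by omega) (by omega) u hu (fun v hv => hq v (by
    have e : k - 1 + 1 = k + 1 - 1 := by ring
    show v ∈ P.F (k - 1 + 1)
    rwa [e]))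
  rw [sg_add_one] at this
  refine ⟨?_, fun h0 => ?_⟩
  · have h1 := this.1
    show 0 ≤ -δ * sg k * P.q u u
    linarith
  obtain ⟨g, hg, e⟩ := this.2 h0
  have e' : k - 1 + 1 = k + 1 - 1 := by ring
  refine ⟨g, ?_, e⟩
  show g ∈ P.F (k - 1 + 1)
  rwa [e']

lemma HR.twist_neg_one {δ : ℝ} (h : P.HR δ) (hneg : ∀ k < 0, P.F k = ⊥) :
    (P.twist (-1)).HR (-δ) := by
  intro k hk0 hk u hu hq
  have hk' : 2 * k ≤ P.n - 2 * (-1) := hk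
  rcases hk0.eq_or_lt with rfl | hk0
  · have : u ∈ P.F (0 + -1) := hu
    rw [hneg _ (by omega), Submodule.mem_bot] at this
    subst this
    exact ⟨by simp, fun _ => ⟨0, Submodule.zero_mem _, by simp⟩⟩
  · have := h (k - 1) (by omega) (by omega) u hu hq
    rw [sg_sub_one] at this
    refine ⟨?_, this.2⟩
    have h1 := this.1
    show 0 ≤ -δ * sg k * P.q u u
    linarith

end Pol

namespace Link

variable {X₁ X₂ X₃ : Type*} [AddCommGroup X₁] [Module ℝ X₁] [AddCommGroup X₂] [Module ℝ X₂]
  [AddCommGroup X₃] [Module ℝ X₃]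
  {P₁ : Pol X₁} {P₂ : Pol X₂} {P₃ : Pol X₃}
  {D : X₁ →ₗ[ℝ] X₂} {d : X₂ →ₗ[ℝ] X₁} {D' : X₂ →ₗ[ℝ] X₃} {d' : X₃ →ₗ[ℝ] X₂}

lemma D_Tsymm (h : Link P₁ P₂ D d) (u : X₁) : D (P₁.T.symm u) = P₂.T.symm (D u) := by
  rw [LinearEquiv.eq_symm_apply, ← h.D_T, LinearEquiv.apply_symm_apply]

lemma q_adj (h : Link P₁ P₂ D d) (u : X₂) (v : X₁) : P₁.q (d u) v = P₂.q u (D v) := by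
  rw [Pol.q_apply, Pol.q_apply, h.adj, h.D_Tsymm]

lemma q_adj' (h : Link P₁ P₂ D d) (u : X₂) (v : X₁) : P₁.q v (d u) = P₂.q (D v) u := by
  rw [P₁.q_symm, h.q_adj, P₂.q_symm]

lemma swap_left (h : Link P₂ P₃ D' d') : Link (P₃.twist (-1)) P₂ d' D' where
  deg := by have := h.deg; show P₃.n - 2 * (-1) = _; omega
  D_mem k u hu := by
    have := h.d_mem _ u hu
    rwa [show k + -1 + 1 = k by ring] at this
  d_mem k u hu := by
    have := h.D_mem _ u hu
    show D' u ∈ P₃.F (k + 1 + -1)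
    rwa [show k + 1 + -1 = k by ring]
  adj u v := by
    show P₃.B (D' u) v = _
    rw [P₂.symm, h.adj, P₃.symm]
  D_T := h.d_T
  d_T := h.D_T

lemma swap_right (h : Link P₁ P₂ D d) : Link P₂ (P₁.twist 1) d D where
  deg := by have := h.deg; show _ = P₁.n - 2 * 1 + 1; omega
  D_mem k u hu := h.d_mem _ u hu
  d_mem k u hu := h.D_mem _ u hu
  adj u v := by
    show _ = P₁.B u (d v)
    rw [P₁.symm, h.adj, P₂.symm]
  D_T := h.d_T
  d_T := h.D_T

/-- Half-degree exactness modulo the image of the automorphism. -/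
lemma exists_of_closed_mod [FiniteDimensional ℝ X₂] (h : Link P₁ P₂ D d) (h' : Link P₂ P₃ D' d')
    {δ δ' : ℝ} (hδ : δ * δ = 1) (hδ' : δ' * δ' = 1) (hneg : ∀ k < 0, P₂.F k = ⊥)
    (HR₁ : P₁.HR δ) (HR₂ : P₂.HR δ') (HR₃ : P₃.HR δ)
    (hDD : ∀ u, D' (D u) = 0) (hrel : ∀ u, D (d u) + d' (D' u) = P₂.T u) {k : ℤ} (hk : 2 * k ≤ P₂.n)
    {x : X₂} (hx : x ∈ P₂.F k) {g : X₃} (hg : g ∈ P₃.F (k - 1)) (hxg : D' x = P₃.T g) :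
    ∃ y ∈ P₁.F k, ∃ v ∈ P₂.F (k - 1), x = D y + P₂.T v := by
  by_cases hk0 : k < 0
  · rw [hneg k hk0, Submodule.mem_bot] at hx
    exact ⟨0, Submodule.zero_mem _, 0, Submodule.zero_mem _, by simp [hx]⟩
  push Not at hk0
  have hn₁ := h.deg
  have hn₃ := h'.deg
  obtain ⟨s, ⟨z, hz, rfl⟩, y, hy, hJ⟩ := P₂.exists_hodgeSeq hδ' hneg HR₂ hk0 hk
    (S := (P₁.F k).map D) (by rintro _ ⟨z, hz, rfl⟩; exact h.D_mem k z hz) hx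
  suffices ∃ g ∈ P₂.F (k - 1), x - D z = P₂.T g by
    obtain ⟨g, hg, e⟩ := this
    exact ⟨z, hz, g, hg, by rw [← e]; abel⟩
  have hDx : D' (x - D z) = P₃.T g := by rw [map_sub, hxg, hDD, sub_zero]
  let e : ℤ → X₃ := fun j => D' (y j)
  let a : ℤ → X₂ := fun j => y j - y (j - 1)
  let Y : ℤ → X₁ := fun j => d (∑ i ∈ Finset.Icc 0 j, sg i • a i)
  have he : ∀ j, D' (a j) = e j - e (j - 1) := fun j => map_sub _ _ _
  have hY : ∀ j, 0 ≤ j → d (a j) = sg j • (Y j - Y (j - 1)) := by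
    intro j hj
    simp only [Y]
    rw [sum_Icc_int _ hj, map_add, add_sub_cancel_left, map_smul, smul_smul, sg_mul_self, one_smul]
  have e_mem : ∀ j ≤ k, e j ∈ P₃.F j := fun j hj => h'.D_mem j _ (hy.mem j hj)
  have e_orth : ∀ j ≤ k, ∀ v ∈ P₃.F (j - 1), P₃.q (e j) v = 0 := by
    intro j hj v hv
    have hv' := h'.d_mem _ v hv
    rw [sub_add_cancel] at hv'
    rw [← h'.q_adj', hy.q_eq hj hv', h'.q_adj', hDx]
    exact P₃.q_T_zero (by omega) hg hv
  have Y_mem : ∀ j ≤ k, Y j ∈ P₁.F (j + 1) := by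
    intro j hj
    refine h.d_mem j _ (Submodule.sum_mem _ fun i hi => Submodule.smul_mem _ _ ?_)
    rw [Finset.mem_Icc] at hi
    exact P₂.mono hi.2 (hy.sub_mem (by omega))
  have Y_orth : ∀ j ≤ k, ∀ v ∈ P₁.F j, P₁.q (Y j) v = 0 := by
    intro j hj v hv
    simp only [Y]
    rw [h.q_adj]
    have hDv := h.D_mem _ v hv
    rw [← hJ (D v) (Submodule.mem_map_of_mem (P₁.mono hj hv)), map_sum, map_sum,
      LinearMap.sum_apply, LinearMap.sum_apply]
    refine Finset.sum_subset (Finset.Icc_subset_Icc_right hj) fun i hi hi' => ?_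
    rw [Finset.mem_Icc] at hi hi'
    rw [map_smul, LinearMap.smul_apply, hy.sub_orth hi.2 (P₂.mono (by omega) hDv), smul_zero]
  have Y_neg : ∀ j < 0, Y j = 0 := fun j hj => by simp only [Y]; rw [sum_Icc_int_neg _ hj, map_zero]
  have e_neg : ∀ j < 0, e j = 0 := fun j hj => by simp only [e]; rw [hy.neg _ hj, map_zero]
  have hqq : ∀ j i, P₂.B (a j) (a i) = P₁.q (d (a j)) (d (a i)) + P₃.q (D' (a j)) (D' (a i)) := by
    intro j i
    rw [← P₂.q_T_left, ← hrel, map_add, LinearMap.add_apply, ← h.q_adj', ← h'.q_adj]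
  have hsq : ∀ j, 0 ≤ j → j < k → P₁.q (Y j) (Y j) = P₃.q (e j) (e j) := by
    intro j hj0 hj
    have h1 := hqq j (j + 1)
    rw [P₂.B_zero (i := j) (j := j + 1) (by omega) (hy.sub_mem (by omega)) (hy.sub_mem (by omega)),
      he, he, hY j hj0, hY (j + 1) (by omega), add_sub_cancel_right, sg_add_one] at h1
    have hYj := Y_mem j (by omega)
    have hYj' := P₁.mono (show j - 1 + 1 ≤ j by omega) (Y_mem (j - 1) (by omega))
    have hej := e_mem j (by omega)
    have hej' := P₃.mono (show j - 1 ≤ j by omega) (e_mem (j - 1) (by omega))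
    have z1 := Y_orth (j + 1) (by omega) _ hYj
    have z2 := Y_orth (j + 1) (by omega) _ (P₁.mono (by omega) hYj')
    have z3 := Y_orth j (by omega) _ hYj'
    have z4 := e_orth (j + 1) (by omega) (e j) (by simpa using hej)
    have z5 := e_orth (j + 1) (by omega) (e (j - 1)) (by simpa using hej')
    have z6 := e_orth j (by omega) _ (e_mem (j - 1) (by omega))
    rw [P₁.q_symm] at z1 z2 z3
    rw [P₃.q_symm] at z4 z5 z6
    simp only [map_sub, map_smul, LinearMap.smul_apply, LinearMap.sub_apply, smul_eq_mul, z1, z2,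
      z3, z4, z5, z6] at h1
    have h2 := sg_mul_self j
    linear_combination (-1 : ℝ) * h1 - P₁.q (Y j) (Y j) * h2
  have hlow : ∀ j < k, (∃ g ∈ P₁.F j, Y j = P₁.T g) ∧ ∃ g ∈ P₃.F (j - 1), e j = P₃.T g := by
    intro j hj
    by_cases hj0 : j < 0
    · rw [Y_neg j hj0, e_neg j hj0]
      exact ⟨⟨0, Submodule.zero_mem _, by simp⟩, ⟨0, Submodule.zero_mem _, by simp⟩⟩
    push Not at hj0
    have r1 := HR₁ (j + 1) (by omega) (by omega) (Y j) (Y_mem j hj.le) (fun v hv =>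
      Y_orth j hj.le v (by simpa using hv))
    have r3 := HR₃ j hj0 (by omega) (e j) (e_mem j hj.le) (e_orth j hj.le)
    have hs := hsq j hj0 hj
    have hz : P₃.q (e j) (e j) = 0 := by
      have h1 := r1.1
      have h3 := r3.1
      rw [hs, sg_add_one] at h1
      have h4 : δ * sg j * P₃.q (e j) (e j) = 0 := by linarith
      have h5 : (δ * sg j) * (δ * sg j) = 1 := by
        linear_combination (sg j * sg j) * hδ + sg_mul_self j
      exact (mul_eq_zero.1 h4).resolve_left (fun h => by rw [h] at h5; norm_num at h5)
    refine ⟨?_, r3.2 hz⟩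
    obtain ⟨g, hg, e⟩ := r1.2 (hs.trans hz)
    exact ⟨g, by simpa using hg, e⟩
  have hall : ∀ j ≤ k, (∃ g ∈ P₁.F j, Y j = P₁.T g) ∧ ∃ g ∈ P₃.F (j - 1), e j = P₃.T g := by
    intro j hj
    rcases hj.lt_or_eq with hj | rfl
    · exact hlow j hj
    have hek : e j = P₃.T g := by simp only [e]; rw [hy.last, hDx]
    refine ⟨?_, g, hg, hek⟩
    rcases hk.eq_or_lt with hn | hn
    · refine ⟨P₁.T.symm (Y j), ?_, by simp⟩
      suffices P₁.T.symm (Y j) ∈ P₁.F (P₁.n - 1 - j) from P₁.mono (by omega) this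
      rw [P₁.perp]
      intro u hu
      rw [← P₁.q_apply, P₁.q_symm]
      exact Y_orth j le_rfl u hu
    · obtain ⟨g1, hg1, e1⟩ := (hlow (j - 1) (by omega)).1
      obtain ⟨g3, hg3, e3⟩ := (hlow (j - 1) (by omega)).2
      have h1 := hqq j j
      have ha : a j ∈ P₂.F j := hy.sub_mem le_rfl
      have w1 : P₁.q (Y j) (P₁.T g1) = 0 := e1 ▸ Y_orth j le_rfl _ (by
        have := Y_mem (j - 1) (by omega)
        rwa [sub_add_cancel] at this)
      have w1' : P₁.q (P₁.T g1) (Y j) = 0 := by rw [P₁.q_symm, w1]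
      have w2 : P₁.B g1 (P₁.T g1) = 0 := P₁.B_zero (i := j - 1) (j := j) (by omega) hg1 (by
        have := P₁.shift _ _ hg1
        rwa [sub_add_cancel] at this)
      have w3 : P₃.B g (P₃.T g) = 0 := P₃.B_zero (i := j - 1) (j := j) (by omega) hg (by
        have := P₃.shift _ _ hg
        rwa [sub_add_cancel] at this)
      have w4 : P₃.B g3 (P₃.T g3) = 0 := P₃.B_zero (i := j - 2) (j := j) (by omega)
        (by convert hg3 using 2; ring) (by
        have := P₃.shift _ _ hg3
        exact P₃.mono (by omega) this)
      have w5 : P₃.B g (P₃.T g3) = 0 := P₃.B_zero (i := j - 1) (j := j - 1) (by omega) hg (by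
        have := P₃.shift _ _ hg3
        rwa [sub_add_cancel] at this)
      have w6 : P₃.B g3 (P₃.T g) = 0 := by rw [← P₃.adj, P₃.symm, w5]
      rw [P₂.B_zero (i := j) (j := j) (by omega) ha ha, he, hY j hk0, hek, e1, e3] at h1
      simp only [map_sub, map_smul, LinearMap.smul_apply, LinearMap.sub_apply, smul_eq_mul,
        P₃.q_T_left, w1, w1', w2, w3, w4, w5, w6, P₁.q_T_left] at h1
      have hz : P₁.q (Y j) (Y j) = 0 := by
        linear_combination (-1 : ℝ) * h1 - P₁.q (Y j) (Y j) * sg_mul_self j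
      have := (HR₁ (j + 1) (by omega) (by omega) (Y j) (Y_mem j hj) (fun v hv =>
        Y_orth j hj v (by simpa using hv))).2 hz
      simpa using this
  refine hy.exists_of_sub hk0 fun j hj0 hj => ?_
  obtain ⟨⟨g1, hg1, e1⟩, ⟨g3, hg3, e3⟩⟩ := hall j hj
  obtain ⟨⟨g1', hg1', e1'⟩, ⟨g3', hg3', e3'⟩⟩ := hall (j - 1) (by omega)
  refine (HR₂ j hj0 (by omega) _ (hy.sub_mem hj) (fun v hv => hy.sub_orth hj hv)).2 ?_
  show P₂.q (a j) (a j) = 0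
  have hd : d (a j) = P₁.T (sg j • (g1 - g1')) := by rw [hY j hj0, e1, e1']; simp
  have hD : D' (a j) = P₃.T (g3 - g3') := by rw [he, e3, e3']; simp
  have hga : sg j • (g1 - g1') ∈ P₁.F j :=
    Submodule.smul_mem _ _ (Submodule.sub_mem _ hg1 (P₁.mono (by omega) hg1'))
  have hgb : g3 - g3' ∈ P₃.F (j - 1) := Submodule.sub_mem _ hg3 (P₃.mono (by omega) hg3')
  have haj : a j = D (sg j • (g1 - g1')) + d' (g3 - g3') := by
    apply P₂.T.injective
    rw [← hrel, hd, hD, h.D_T, h'.d_T, map_add]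
  calc P₂.q (a j) (a j) = P₂.q (D (sg j • (g1 - g1')) + d' (g3 - g3')) (a j) := by rw [← haj]
    _ = P₁.B (sg j • (g1 - g1')) (sg j • (g1 - g1')) + P₃.B (g3 - g3') (g3 - g3') := by
      rw [map_add, LinearMap.add_apply, ← h.q_adj', h'.q_adj, hd, hD, P₁.q_T_right, P₃.q_T_right]
    _ = 0 := by
      rw [P₁.B_zero (i := j) (j := j) (by omega) hga hga,
        P₃.B_zero (i := j - 1) (j := j - 1) (by omega) hgb hgb, add_zero]

end Link

end LeftKLS

namespace LeftKLS

section Forms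

variable {X : Type*} [AddCommGroup X] [Module ℝ X]

lemma sq_le_mul_of_nonneg_on (b : X →ₗ[ℝ] X →ₗ[ℝ] ℝ) (hb : ∀ u v, b u v = b v u)
    (S : Submodule ℝ X) (h : ∀ u ∈ S, 0 ≤ b u u) {u v : X} (hu : u ∈ S) (hv : v ∈ S) :
    b u v * b u v ≤ b u u * b v v := by
  have := discrim_le_zero (a := b v v) (b := 2 * b u v) (c := b u u) (fun s => by
    have := h (u + s • v) (Submodule.add_mem _ hu (Submodule.smul_mem _ s hv))
    simp only [map_add, map_smul, LinearMap.add_apply, LinearMap.smul_apply, smul_eq_mul,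
      hb v u] at this
    linarith)
  rw [discrim] at this
  linarith

lemma mem_of_orth [FiniteDimensional ℝ X] (b : X →ₗ[ℝ] X →ₗ[ℝ] ℝ) (hb : ∀ u v, b u v = b v u)
    (hnd : ∀ u, (∀ v, b u v = 0) → u = 0) (S : Submodule ℝ X) {x : X}
    (h : ∀ v, (∀ s ∈ S, b s v = 0) → b x v = 0) : x ∈ S := by
  by_contra hx
  obtain ⟨φ, hφ, hφS⟩ := Submodule.exists_le_ker_of_notMem hx
  obtain ⟨v, -, hv⟩ := exists_represent b ⊤ ⊤ φ (fun f _ hf => by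
    rw [hnd f (fun v => by rw [hb]; exact hf v trivial), map_zero])
  refine hφ ?_
  rw [← hv x trivial, hb]
  refine h v fun s hs => ?_
  rw [hb, hv s trivial]
  exact hφS hs

end Forms

lemma Flt.nondeg {X : Type*} [AddCommGroup X] [Module ℝ X] (P : Flt X)
    (hneg : ∀ k < 0, P.F k = ⊥) (u : X) (h : ∀ v, P.B u v = 0) : u = 0 := by
  have : u ∈ P.F (P.n - 1 - P.n) := (P.perp _ _).2 fun v _ => by rw [P.symm, h]
  rwa [hneg _ (by omega), Submodule.mem_bot] at this

variable {X₁ X₂ X₃ : Type*} [AddCommGroup X₁] [Module ℝ X₁] [AddCommGroup X₂] [Module ℝ X₂]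
  [AddCommGroup X₃] [Module ℝ X₃]

/-- Three consecutive terms of a complex satisfying Hodge–Riemann relations. -/
structure Seq3 (P₁ : Pol X₁) (P₂ : Pol X₂) (P₃ : Pol X₃)
    (D : X₁ →ₗ[ℝ] X₂) (d : X₂ →ₗ[ℝ] X₁) (D' : X₂ →ₗ[ℝ] X₃) (d' : X₃ →ₗ[ℝ] X₂) (δ t : ℝ) :
    Prop where
  link : Link P₁ P₂ D d
  link' : Link P₂ P₃ D' d'
  DD : ∀ u, D' (D u) = 0
  dd : ∀ u, d (d' u) = 0
  neg₁ : ∀ k < 0, P₁.F k = ⊥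
  neg₂ : ∀ k < 0, P₂.F k = ⊥
  neg₃ : ∀ k < 0, P₃.F k = ⊥
  sq : δ * δ = 1
  HR₁ : P₁.HR δ
  HR₂ : P₂.HR (-δ)
  HR₃ : P₃.HR δ
  rel : ∀ u, D (d u) + d' (D' u) = P₂.T u - t • u

namespace Seq3

variable {P₁ : Pol X₁} {P₂ : Pol X₂} {P₃ : Pol X₃}
  {D : X₁ →ₗ[ℝ] X₂} {d : X₂ →ₗ[ℝ] X₁} {D' : X₂ →ₗ[ℝ] X₃} {d' : X₃ →ₗ[ℝ] X₂} {δ t : ℝ}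

lemma exists_of_closed_mod [FiniteDimensional ℝ X₂] (h : Seq3 P₁ P₂ P₃ D d D' d' δ 0) {K : ℤ}
    {x : X₂} (hx : x ∈ P₂.F K) (hDx : D' x = 0) :
    ∃ y ∈ P₁.F K, ∃ v ∈ P₂.F (K - 1), x = D y + P₂.T v := by
  have hrel : ∀ u, D (d u) + d' (D' u) = P₂.T u := fun u => by simpa using h.rel u
  rcases le_or_gt (2 * K) P₂.n with hK | hK
  · exact h.link.exists_of_closed_mod h.link' h.sq (by rw [neg_mul_neg]; exact h.sq) h.neg₂ h.HR₁
      h.HR₂ h.HR₃ h.DD hrel hK hx (Submodule.zero_mem _) (by simpa using hDx)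
  have hn₁ := h.link.deg
  have hn₃ := h.link'.deg
  have hmem : x ∈ (P₁.F K).map D ⊔ (P₂.F (K - 1)).map (P₂.T : X₂ →ₗ[ℝ] X₂) := by
    refine mem_of_orth P₂.B P₂.symm (P₂.nondeg h.neg₂) _ fun v hv => ?_
    have hdv : d v ∈ P₁.F (P₁.n - 1 - K) := (P₁.perp _ _).2 fun u hu => by
      rw [P₁.symm, h.link.adj, P₂.symm]
      exact hv _ (Submodule.mem_sup_left (Submodule.mem_map_of_mem hu))
    have hTv : P₂.T v ∈ P₂.F (P₂.n - 1 - (K - 1)) := (P₂.perp _ _).2 fun u hu => by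
      rw [← P₂.adj]
      exact hv _ (Submodule.mem_sup_right (Submodule.mem_map_of_mem hu))
    obtain ⟨y, hy, w, hw, e⟩ := h.link'.swap_left.exists_of_closed_mod h.link.swap_right
      (δ := -δ) (δ' := -δ) (by rw [neg_mul_neg]; exact h.sq) (by rw [neg_mul_neg]; exact h.sq)
      h.neg₂ (h.HR₃.twist_neg_one P₃ h.neg₃) h.HR₂ (h.HR₁.twist_one P₁) h.dd
      (fun u => by rw [add_comm, hrel]) (k := P₂.n - K) (by omega)
      (by convert hTv using 2; ring)
      (g := d v) (by
        show d v ∈ P₁.F (P₂.n - K - 1 + 1)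
        convert hdv using 2; omega) (h.link.d_T v)
    have hy' : y ∈ P₃.F (P₂.n - K + -1) := hy
    calc P₂.B x v = P₂.q x (P₂.T v) := (P₂.q_T_right _ _).symm
      _ = P₂.q x (d' y) + P₂.q x (P₂.T w) := by rw [e, map_add]
      _ = 0 := by
        rw [h.link'.q_adj', hDx, map_zero, LinearMap.zero_apply, P₂.q_T_right, zero_add]
        exact P₂.B_zero (by omega) hx hw
  obtain ⟨_, ⟨y, hy, rfl⟩, _, ⟨v, hv, rfl⟩, e⟩ := Submodule.mem_sup.1 hmem
  exact ⟨y, hy, v, hv, e.symm⟩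

/-- Exactness in every filtration degree. -/
lemma exact [FiniteDimensional ℝ X₂] (h : Seq3 P₁ P₂ P₃ D d D' d' δ 0) {K : ℤ} {x : X₂}
    (hx : x ∈ P₂.F K) (hDx : D' x = 0) : ∃ y ∈ P₁.F K, x = D y := by
  rcases lt_or_ge K 0 with hK | hK
  · rw [h.neg₂ K hK, Submodule.mem_bot] at hx
    exact ⟨0, Submodule.zero_mem _, by simp [hx]⟩
  suffices ∀ K : ℤ, -1 ≤ K → ∀ x ∈ P₂.F K, D' x = 0 → ∃ y ∈ P₁.F K, x = D y from
    this K (by omega) x hx hDx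
  clear hx hDx x hK K
  intro K hK
  induction K, hK using Int.leInduction with
  | base =>
    intro x hx _
    rw [h.neg₂ _ (by omega), Submodule.mem_bot] at hx
    exact ⟨0, Submodule.zero_mem _, by simp [hx]⟩
  | succ K hK ih =>
    intro x hx hDx
    obtain ⟨y, hy, v, hv, rfl⟩ := h.exists_of_closed_mod hx hDx
    rw [add_sub_cancel_right] at hv
    have hDv : D' v = 0 := by
      apply P₃.T.injective
      rw [← h.link'.D_T, map_zero, ← hDx, map_add, h.DD, zero_add]
    obtain ⟨z, hz, rfl⟩ := ih v hv hDv
    exact ⟨y + P₁.T z, Submodule.add_mem _ hy (P₁.shift _ _ hz), by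
      rw [map_add, h.link.D_T]⟩

/-- The composite of the two maps through the kernel of `D`. -/
def A (P₁ : Pol X₁) (D : X₁ →ₗ[ℝ] X₂) (d : X₂ →ₗ[ℝ] X₁) (t : ℝ) : X₁ →ₗ[ℝ] X₁ :=
  (P₁.T : X₁ →ₗ[ℝ] X₁) - t • LinearMap.id - d ∘ₗ D

lemma A_apply (v : X₁) : A P₁ D d t v = P₁.T v - t • v - d (D v) := rfl

variable (h : Seq3 P₁ P₂ P₃ D d D' d' δ t)
include h

lemma D_A (v : X₁) : D (A P₁ D d t v) = 0 := by
  have := h.rel (D v)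
  rw [h.DD, map_zero, add_zero] at this
  rw [A_apply, map_sub, map_sub, this, h.link.D_T, map_smul, sub_self]

lemma A_mem {k : ℤ} {v : X₁} (hv : v ∈ P₁.F (k - 1)) : A P₁ D d t v ∈ P₁.F k := by
  have h1 := P₁.shift _ _ hv
  have h2 := h.link.d_mem _ _ (h.link.D_mem _ _ hv)
  rw [sub_add_cancel] at h1 h2
  exact Submodule.sub_mem _ (Submodule.sub_mem _ h1
    (Submodule.smul_mem _ _ (P₁.mono (by omega) hv))) h2

lemma q_A (v u : X₁) : P₁.q (A P₁ D d t v) u = P₁.B v u - t * P₁.q v u - P₂.q (D v) (D u) := by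
  rw [A_apply, map_sub, map_sub, LinearMap.sub_apply, LinearMap.sub_apply, P₁.q_T_left, h.link.q_adj,
    map_smul, LinearMap.smul_apply, smul_eq_mul]

lemma q_A_right (v u : X₁) :
    P₁.q u (A P₁ D d t v) = P₁.B u v - t * P₁.q u v - P₂.q (D u) (D v) := by
  rw [P₁.q_symm, h.q_A, P₁.symm, P₁.q_symm, P₂.q_symm]

lemma sgn_ne (k : ℤ) : δ * sg k ≠ 0 := by
  intro h0
  have h5 : (δ * sg k) * (δ * sg k) = 1 := by
    linear_combination (sg k * sg k) * h.sq + sg_mul_self k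
  rw [h0] at h5
  norm_num at h5

omit h in
/-- Hodge–Riemann relations on the kernel of `D` at `t = 0`. -/
lemma closed_HR_zero [FiniteDimensional ℝ X₁] [FiniteDimensional ℝ X₂]
    (h : Seq3 P₁ P₂ P₃ D d D' d' δ 0) {k : ℤ}
    (hk : 2 * k ≤ P₁.n) {x : X₁} (hx : x ∈ P₁.F k) (hDx : D x = 0)
    (hq : ∀ v ∈ P₁.F (k - 1), D v = 0 → P₁.q x v = 0) :
    0 ≤ δ * sg k * P₁.q x x ∧
      (P₁.q x x = 0 → ∃ v ∈ P₁.F (k - 1), x = P₁.T v - d (D v)) := by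
  by_cases hk0 : k < 0
  · rw [h.neg₁ k hk0, Submodule.mem_bot] at hx
    subst hx
    exact ⟨by simp, fun _ => ⟨0, Submodule.zero_mem _, by simp⟩⟩
  push Not at hk0
  have hn₁ := h.link.deg
  obtain ⟨s, ⟨v, hv, rfl⟩, y, hy, hJ⟩ := P₁.exists_hodgeSeq h.sq h.neg₁ h.HR₁ hk0 hk
    (S := (P₁.F (k - 1)).map (A P₁ D d 0)) (by rintro _ ⟨z, hz, rfl⟩; exact h.A_mem hz) hx
  have hv : v ∈ P₁.F (k - 1) := hv
  set x' := x - A P₁ D d 0 v with hx'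
  have hx'F : x' ∈ P₁.F k := Submodule.sub_mem _ hx (h.A_mem hv)
  have hDx' : D x' = 0 := by rw [hx', map_sub, hDx, h.D_A, sub_zero]
  have hAcl : ∀ u ∈ P₁.F k, D u = 0 → P₁.q (A P₁ D d 0 v) u = 0 := by
    intro u hu hDu
    rw [h.q_A, P₁.B_zero (by omega) hv hu, hDu, map_zero]
    simp
  let e : ℤ → X₂ := fun j => D (y j)
  have e_mem : ∀ j ≤ k, e j ∈ P₂.F j := fun j hj => h.link.D_mem j _ (hy.mem j hj)
  have e_orth : ∀ j ≤ k, ∀ v ∈ P₂.F (j - 1), P₂.q (e j) v = 0 := by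
    intro j hj v hv
    have hv' := h.link.d_mem _ v hv
    rw [sub_add_cancel] at hv'
    rw [← h.link.q_adj', hy.q_eq hj hv', h.link.q_adj', hDx', map_zero, LinearMap.zero_apply]
  have e_sq : ∀ l, 0 ≤ l → l < k → P₂.q (e l) (e l) = 0 := by
    intro l hl0 hl
    have h1 := hJ (A P₁ D d 0 (y l))
      (Submodule.mem_map_of_mem (P₁.mono (by omega) (hy.mem l hl.le)))
    have hD : D (∑ i ∈ Finset.Icc 0 k, sg i • (y i - y (i - 1))) =
        ∑ i ∈ Finset.Icc 0 k, sg i • (e i - e (i - 1)) := by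
      simp [map_sum, e]
    rw [h.q_A_right, P₁.B_zero (i := k) (j := l) (by omega) (Submodule.sum_mem _ fun i hi =>
      Submodule.smul_mem _ _ (P₁.mono (Finset.mem_Icc.1 hi).2 (hy.sub_mem (Finset.mem_Icc.1 hi).2)))
      (hy.mem l hl.le), zero_mul, sub_zero, zero_sub, neg_eq_zero, hD, map_sum,
      LinearMap.sum_apply, ← Finset.sum_subset (s₁ := {l, l + 1}), Finset.sum_pair (by omega)] at h1
    · simp only [map_smul, map_sub, LinearMap.smul_apply, LinearMap.sub_apply, smul_eq_mul,
        add_sub_cancel_right, sg_add_one] at h1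
      have z1 := e_orth (l + 1) (by omega) (e l) (by simpa using e_mem l hl.le)
      have z2 := e_orth l hl.le _ (e_mem (l - 1) (by omega))
      rw [P₂.q_symm] at z2
      change sg l * (P₂.q (e l) (e l) - P₂.q (e (l - 1)) (e l)) +
        -sg l * (P₂.q (e (l + 1)) (e l) - P₂.q (e l) (e l)) = 0 at h1
      rw [z1, z2] at h1
      linear_combination (1 / 2 * sg l) * h1 - P₂.q (e l) (e l) * sg_mul_self l
    · intro i hi
      rw [Finset.mem_insert, Finset.mem_singleton] at hi
      rw [Finset.mem_Icc]; omega
    · intro i hi hi'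
      rw [Finset.mem_insert, Finset.mem_singleton] at hi'
      rw [Finset.mem_Icc] at hi
      rw [map_smul, LinearMap.smul_apply, map_sub P₂.q, LinearMap.sub_apply]
      push Not at hi'
      rcases lt_or_gt_of_ne hi'.1 with hil | hil
      · have z1 := e_orth l hl.le (e i) (P₂.mono (by omega) (e_mem i hi.2))
        have z2 := e_orth l hl.le (e (i - 1)) (P₂.mono (by omega) (e_mem (i - 1) (by omega)))
        rw [P₂.q_symm] at z1 z2
        rw [z1, z2]; simp
      · have z1 := e_orth i hi.2 (e l) (P₂.mono (by omega) (e_mem l hl.le))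
        have z2 := e_orth (i - 1) (by omega) (e l) (P₂.mono (by omega) (e_mem l hl.le))
        rw [z1, z2]; simp
  have hxy : ∀ l < k, P₁.q (y l) x' = 0 := by
    intro l hl
    by_cases hl0 : l < 0
    · rw [hy.neg l hl0]; simp
    push Not at hl0
    obtain ⟨g, hg, eg⟩ := (h.HR₂ l hl0 (by omega) (e l) (e_mem l hl.le) (e_orth l hl.le)).2
      (e_sq l hl0 hl)
    have hDg : D' g = 0 := by
      apply P₃.T.injective
      rw [← h.link'.D_T, ← eg, h.DD, map_zero]
    obtain ⟨g', hg', rfl⟩ := h.exact hg hDg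
    have hTg' : P₁.T g' ∈ P₁.F l := by
      have := P₁.shift _ _ hg'
      rwa [sub_add_cancel] at this
    have hy'F : y l - P₁.T g' ∈ P₁.F l := Submodule.sub_mem _ (hy.mem l hl.le) hTg'
    have hy'D : D (y l - P₁.T g') = 0 := by
      rw [map_sub, h.link.D_T, ← eg, sub_self]
    have h1 : P₁.q x' (y l - P₁.T g') = 0 := by
      rw [hx', map_sub P₁.q, LinearMap.sub_apply, hq _ (P₁.mono (by omega) hy'F) hy'D,
        hAcl _ (P₁.mono (by omega) hy'F) hy'D, sub_zero]
    rw [map_sub, P₁.q_T_right, P₁.B_zero (i := k) (j := l - 1) (by omega) hx'F hg', sub_zero] at h1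
    rw [P₁.q_symm, h1]
  have hlow : ∀ j, 0 ≤ j → j < k → ∃ g ∈ P₁.F (j - 1), y j - y (j - 1) = P₁.T g := by
    intro j hj0 hj
    refine (h.HR₁ j hj0 (by omega) _ (hy.sub_mem hj.le) (fun v hv => hy.sub_orth hj.le hv)).2 ?_
    rw [← hy.q_sub hj.le, map_sub P₁.q, LinearMap.sub_apply, hxy j hj, hxy (j - 1) (by omega), sub_zero]
  have hqk : P₁.q x x = P₁.q (y k - y (k - 1)) (y k - y (k - 1)) := by
    rw [← hy.q_sub le_rfl, map_sub P₁.q, LinearMap.sub_apply, hxy (k - 1) (by omega), hy.last, sub_zero]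
    have hxx : x = x' + A P₁ D d 0 v := by rw [hx']; abel
    have z1 := hAcl _ hx'F hDx'
    have z2 := hAcl _ (h.A_mem hv) (h.D_A v)
    nth_rewrite 1 2 [hxx]
    rw [map_add, map_add, LinearMap.add_apply, LinearMap.add_apply, z1, z2,
      P₁.q_symm x' (A P₁ D d 0 v), z1]
    ring
  have hk' := h.HR₁ k hk0 hk _ (hy.sub_mem le_rfl) (fun v hv => hy.sub_orth le_rfl hv)
  rw [hqk]
  refine ⟨hk'.1, fun h0 => ?_⟩
  obtain ⟨g, hg, eg⟩ := hy.exists_of_sub hk0 fun j hj0 hj => by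
    rcases hj.lt_or_eq with hj | rfl
    · exact hlow j hj0 hj
    · exact hk'.2 h0
  have hDg : D g = 0 := by
    apply P₂.T.injective
    rw [← h.link.D_T, ← eg, hDx', map_zero]
  refine ⟨v + g, Submodule.add_mem _ hv hg, ?_⟩
  have : x = A P₁ D d 0 v + P₁.T g := by rw [← eg, hx']; abel
  rw [this, A_apply, map_add, map_add, hDg]
  simp; abel

end Seq3

end LeftKLS

namespace LeftKLS

namespace Seq3

variable {X₁ X₂ X₃ : Type*} [AddCommGroup X₁] [Module ℝ X₁] [AddCommGroup X₂] [Module ℝ X₂]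
  [AddCommGroup X₃] [Module ℝ X₃] {P₁ : Pol X₁} {P₂ : Pol X₂} {P₃ : Pol X₃}
  {D : X₁ →ₗ[ℝ] X₂} {d : X₂ →ₗ[ℝ] X₁} {D' : X₂ →ₗ[ℝ] X₃} {d' : X₃ →ₗ[ℝ] X₂} {δ t : ℝ}

/-- Closed vectors of `F k` orthogonal to the closed vectors of `F (k - 1)` satisfy the
Hodge–Riemann relations. -/
lemma closed_HR_pos [FiniteDimensional ℝ X₁] [FiniteDimensional ℝ X₂]
    (h : Seq3 P₁ P₂ P₃ D d D' d' δ t) (ht : 0 < t)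
    (hex : ∀ K, ∀ x ∈ P₂.F K, D' x = 0 → ∃ y ∈ P₁.F K, x = D y) {k : ℤ}
    (hk : 2 * k ≤ P₁.n) {x : X₁} (hx : x ∈ P₁.F k) (hDx : D x = 0)
    (hq : ∀ v ∈ P₁.F (k - 1), D v = 0 → P₁.q x v = 0) :
    0 ≤ δ * sg k * P₁.q x x ∧ (P₁.q x x = 0 → ∃ g ∈ P₁.F (k - 1), x = P₁.T g) := by
  rcases lt_trichotomy k 0 with hk0 | rfl | hk0
  · rw [h.neg₁ k hk0, Submodule.mem_bot] at hx
    subst hx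
    exact ⟨by simp, fun _ => ⟨0, Submodule.zero_mem _, by simp⟩⟩
  · refine h.HR₁ 0 le_rfl hk x hx fun v hv => ?_
    rw [h.neg₁ _ (by omega), Submodule.mem_bot] at hv
    simp [hv]
  have hn₁ := h.link.deg
  obtain ⟨s, hs, y, hy, -⟩ := P₁.exists_hodgeSeq h.sq h.neg₁ h.HR₁ hk0.le hk (S := ⊥) bot_le hx
  rw [Submodule.mem_bot] at hs
  rw [hs, sub_zero] at hy
  clear hs s
  have hxy : ∀ l ≤ k - 2, P₁.q (y l) x = 0 := by
    intro l hl
    have hyl := hy.mem l (by omega)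
    have h1 := hq _ (P₁.mono (show l + 1 ≤ k - 1 by omega)
      (h.A_mem (v := y l) (by rwa [add_sub_cancel_right]))) (h.D_A _)
    rw [h.q_A_right, P₁.B_zero (by omega) hx hyl, hDx, map_zero, LinearMap.zero_apply, zero_sub,
      sub_zero, neg_eq_zero, P₁.q_symm] at h1
    exact (mul_eq_zero.1 h1).resolve_left ht.ne'
  have hyT : ∀ v ∈ P₁.F (k - 2), P₁.q (y (k - 2)) v = 0 := by
    intro v hv
    by_cases hk2 : k - 2 < 0
    · rw [hy.neg _ hk2]; simp
    push Not at hk2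
    have hy' : P₁.HodgeSeq (k - 2) (y (k - 2)) y :=
      ⟨hy.neg, rfl, fun l hl => hy.mem l (by omega), fun l hl v hv => by
        rw [map_sub, LinearMap.sub_apply, hy.q_eq (by omega) (P₁.mono hl hv),
          hy.q_eq (by omega) hv, sub_self]⟩
    obtain ⟨g, hg, e⟩ := hy'.exists_of_sub hk2 fun j hj0 hj => by
      refine (h.HR₁ j hj0 (by omega) _ (hy.sub_mem (by omega))
        (fun v hv => hy.sub_orth (by omega) hv)).2 ?_
      rw [← hy.q_sub (by omega), map_sub P₁.q, LinearMap.sub_apply, hxy j hj,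
        hxy (j - 1) (by omega), sub_zero]
    rw [e]
    exact P₁.q_T_zero (by omega) hg hv
  set w := y (k - 1) with hw
  have hwF : w ∈ P₁.F (k - 1) := hy.mem _ (by omega)
  have hwP : ∀ v ∈ P₁.F (k - 1 - 1), P₁.q w v = 0 := by
    intro v hv
    have e : k - 1 - 1 = k - 2 := by ring
    have h1 := hy.sub_orth (l := k - 1) (by omega) hv
    rw [map_sub, LinearMap.sub_apply, e, hyT v (by rwa [← e]), sub_zero] at h1
    exact h1
  set b := x - w with hb
  have hbF : b ∈ P₁.F k := Submodule.sub_mem _ hx (P₁.mono (by omega) hwF)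
  have hbP : ∀ v ∈ P₁.F (k - 1), P₁.q b v = 0 := hy.orth (k - 1) (by omega)
  have hDw : D w = - D b := by rw [hb, map_sub, hDx, zero_sub, neg_neg]
  have d_mem : ∀ g ∈ P₂.F (k - 1 - 1), d g ∈ P₁.F (k - 1) := fun g hg => by
    simpa using h.link.d_mem _ _ hg
  have d_mem' : ∀ g ∈ P₂.F (k - 1), d g ∈ P₁.F k := fun g hg => by
    simpa using h.link.d_mem _ _ hg
  have hDwP : ∀ v ∈ P₂.F (k - 1 - 1), P₂.q (D w) v = 0 := by
    intro v hv
    rw [hDw, map_neg, LinearMap.neg_apply, ← h.link.q_adj', hbP _ (d_mem v hv), neg_zero]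
  let G : Submodule ℝ X₂ :=
    { carrier := {g | g ∈ P₂.F (k - 1) ∧ D' g = 0 ∧ ∀ v ∈ P₂.F (k - 1 - 1), P₂.q g v = 0}
      add_mem' := fun {a b} ha hb => ⟨Submodule.add_mem _ ha.1 hb.1, by
        rw [map_add, ha.2.1, hb.2.1, add_zero], fun v hv => by
        rw [map_add, LinearMap.add_apply, ha.2.2 v hv, hb.2.2 v hv, add_zero]⟩
      zero_mem' := ⟨Submodule.zero_mem _, map_zero _, fun v _ => by simp⟩
      smul_mem' := fun c a ha => ⟨Submodule.smul_mem _ _ ha.1, by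
        rw [map_smul, ha.2.1, smul_zero], fun v hv => by
        rw [map_smul, LinearMap.smul_apply, ha.2.2 v hv, smul_zero]⟩ }
  have hHR₂ : ∀ g ∈ G, 0 ≤ -δ * sg (k - 1) * P₂.q g g ∧
      (P₂.q g g = 0 → ∃ v ∈ P₂.F (k - 1 - 1), g = P₂.T v) := fun g hg =>
    h.HR₂ (k - 1) (by omega) (by omega) g hg.1 hg.2.2
  obtain ⟨p, hp⟩ := P₁.exists_proj (h.HR₁ (k - 1) (by omega) (by omega))
  have hdF : ∀ g ∈ G, d g ∈ P₁.F (P₁.n - (k - 1)) := fun g hg =>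
    P₁.mono (by omega) (d_mem' g hg.1)
  have hpF : ∀ g ∈ G, p (d g) ∈ P₁.F (k - 1) := fun g hg => (hp _ (hdF g hg)).1
  have hpq : ∀ g ∈ G, ∀ v ∈ P₁.F (k - 1), P₁.q (p (d g)) v = P₁.q (d g) v := by
    intro g hg v hv
    have := (hp _ (hdF g hg)).2 v hv
    rw [map_sub, LinearMap.sub_apply] at this
    linarith
  have hpP : ∀ g ∈ G, ∀ v ∈ P₁.F (k - 1 - 1), P₁.q (p (d g)) v = 0 := by
    intro g hg v hv
    rw [hpq g hg v (P₁.mono (by omega) hv), h.link.q_adj, hg.2.2 _ (h.link.D_mem _ _ hv)]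
  have hHR₁ : ∀ g ∈ P₁.F (k - 1), (∀ v ∈ P₁.F (k - 1 - 1), P₁.q g v = 0) →
      0 ≤ δ * sg (k - 1) * P₁.q g g ∧
      (P₁.q g g = 0 → ∃ v ∈ P₁.F (k - 1 - 1), g = P₁.T v) :=
    h.HR₁ (k - 1) (by omega) (by omega)
  obtain ⟨f, hf, hfw⟩ := exists_represent (P₁.q.compl₁₂ (p ∘ₗ d) (p ∘ₗ d)) G G
    (P₁.q w ∘ₗ (p ∘ₗ d)) (by
      intro f hf h0
      obtain ⟨v, hv, e⟩ := (hHR₁ _ (hpF f hf) (hpP f hf)).2 (h0 f hf)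
      show P₁.q w (p (d f)) = 0
      rw [e, P₁.q_T_right]
      exact P₁.B_zero (by omega) hwF hv)
  have hfw : ∀ g ∈ G, P₁.q (p (d f)) (p (d g)) = P₁.q w (p (d g)) := hfw
  have hDdf : D (d f) = P₂.T f - t • f := by
    rw [← h.rel f, hf.2.1, map_zero, add_zero]
  have hDpG : D (p (d f)) ∈ G := by
    refine ⟨h.link.D_mem _ _ (hpF f hf), h.DD _, fun v hv => ?_⟩
    rw [← h.link.q_adj', hpq f hf _ (d_mem v hv), h.link.q_adj', hDdf, map_sub,
      LinearMap.sub_apply, map_smul, LinearMap.smul_apply, hf.2.2 v hv, smul_zero, sub_zero]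
    exact P₂.q_T_zero (by omega) hf.1 hv
  have hDwG : D w ∈ G := ⟨h.link.D_mem _ _ hwF, h.DD _, hDwP⟩
  set a := w - p (d f) with ha
  have haF : a ∈ P₁.F (k - 1) := Submodule.sub_mem _ hwF (hpF f hf)
  have hDaG : D a ∈ G := by
    rw [ha, map_sub]; exact Submodule.sub_mem _ hDwG hDpG
  have hDa : P₂.q (D a) (D a) = 0 := by
    rw [← h.link.q_adj', P₁.q_symm, ← hpq _ hDaG _ haF, P₁.q_symm]
    nth_rewrite 1 [ha]
    rw [map_sub P₁.q, LinearMap.sub_apply, hfw _ hDaG, sub_self]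
  obtain ⟨g₁, hg₁, eg₁⟩ := (hHR₂ _ hDaG).2 hDa
  have hDg₁ : D' g₁ = 0 := by
    apply P₃.T.injective
    rw [← h.link'.D_T, ← eg₁, h.DD, map_zero]
  obtain ⟨g₂, hg₂, rfl⟩ := hex _ g₁ hg₁ hDg₁
  have hTg₂ : P₁.T g₂ ∈ P₁.F (k - 1) := by simpa using P₁.shift _ _ hg₂
  have hxa : P₁.q x a = 0 := by
    have h1 := hq (a - P₁.T g₂) (Submodule.sub_mem _ haF hTg₂) (by
      rw [map_sub, eg₁, h.link.D_T, sub_self])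
    rw [map_sub, P₁.q_T_right, P₁.B_zero (by omega) hx hg₂, sub_zero] at h1
    exact h1
  have hwa : P₁.q w a = 0 := by
    have h1 := hbP a haF
    rw [hb, map_sub P₁.q, LinearMap.sub_apply, hxa] at h1
    linarith
  have hwp : P₁.q w (p (d f)) = P₁.q w w := by
    rw [ha, map_sub] at hwa
    linarith
  have hpp : P₁.q (p (d f)) (p (d f)) = P₁.q w w := by rw [hfw f hf, hwp]
  set r := d f - p (d f) with hr
  have hrF : r ∈ P₁.F k := Submodule.sub_mem _ (d_mem' f hf.1) (P₁.mono (by omega) (hpF f hf))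
  have hrP : ∀ v ∈ P₁.F (k - 1), P₁.q r v = 0 := (hp _ (hdF f hf)).2
  have hwd : P₁.q w (d f) = P₁.q w w := by
    rw [P₁.q_symm, ← hpq f hf w hwF, P₁.q_symm, hwp]
  have hbr : P₁.q b r = - P₁.q w w := by
    rw [hr, map_sub, hbP _ (hpF f hf), hb, map_sub P₁.q, LinearMap.sub_apply, hwd, h.link.q_adj', hDx]
    simp
  have hrr : P₁.q r r = - t * P₂.q f f - P₁.q w w := by
    have h1 : P₁.q (d f) (d f) = - t * P₂.q f f := by
      rw [h.link.q_adj, hDdf, map_sub, P₂.q_T_right, P₂.B_zero (by omega) hf.1 hf.1, map_smul,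
        smul_eq_mul]
      ring
    have h2 : P₁.q r r = P₁.q (d f) r := by
      have := hrP _ (hpF f hf)
      rw [P₁.q_symm] at this
      nth_rewrite 1 [hr]
      rw [map_sub P₁.q, LinearMap.sub_apply, this, sub_zero]
    rw [h2, hr, map_sub, h1, ← hpq f hf _ (hpF f hf), hpp]
  let S : Submodule ℝ X₁ :=
    { carrier := {g | g ∈ P₁.F k ∧ ∀ v ∈ P₁.F (k - 1), P₁.q g v = 0}
      add_mem' := fun {a b} ha hb => ⟨Submodule.add_mem _ ha.1 hb.1, fun v hv => by
        rw [map_add, LinearMap.add_apply, ha.2 v hv, hb.2 v hv, add_zero]⟩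
      zero_mem' := ⟨Submodule.zero_mem _, fun v _ => by simp⟩
      smul_mem' := fun c a ha => ⟨Submodule.smul_mem _ _ ha.1, fun v hv => by
        rw [map_smul, LinearMap.smul_apply, ha.2 v hv, smul_zero]⟩ }
  have hCS := sq_le_mul_of_nonneg_on ((δ * sg k) • P₁.q) (fun u v => by
    simp [P₁.q_symm u v]) S (fun u hu => by
      simpa using (h.HR₁ k hk0.le hk u hu.1 hu.2).1) (u := b) (v := r) ⟨hbF, hbP⟩ ⟨hrF, hrP⟩
  simp only [LinearMap.smul_apply, smul_eq_mul, hbr, hrr] at hCS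
  have hα := hHR₁ w hwF hwP
  have hβ := h.HR₁ k hk0.le hk b hbF hbP
  have hφ := hHR₂ f hf
  have hxx : P₁.q x x = P₁.q w w + P₁.q b b := by
    have e : x = w + b := by rw [hb]; abel
    have h1 := hbP w hwF
    have h2 : P₁.q w b = 0 := by rw [P₁.q_symm, h1]
    rw [e, map_add, map_add, LinearMap.add_apply, LinearMap.add_apply, h1, h2]
    ring
  rw [sg_sub_one] at hα hφ
  obtain ⟨hα1, hα2⟩ := hα
  obtain ⟨hβ1, hβ2⟩ := hβ
  obtain ⟨hφ1, hφ2⟩ := hφ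
  have hσ := h.sgn_ne k
  generalize hσ' : δ * sg k = σ at *
  have e1 : δ * -sg k = -σ := by rw [← hσ']; ring
  have e2 : -δ * -sg k = σ := by rw [← hσ']; ring
  rw [e1] at hα1
  rw [e2] at hφ1
  have hle : -σ * P₁.q w w ≤ σ * P₁.q b b := by
    rcases hα1.eq_or_lt with h0 | h0
    · rw [← h0]; exact hβ1
    · have h3 : (σ * P₁.q b b) * (σ * (-t * P₂.q f f - P₁.q w w)) ≤
          (σ * P₁.q b b) * (-σ * P₁.q w w) := by
        refine mul_le_mul_of_nonneg_left ?_ hβ1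
        nlinarith
      refine le_of_mul_le_mul_right ?_ h0
      linarith
  rw [hxx]
  refine ⟨by linarith, fun h0 => ?_⟩
  have hαβ : σ * P₁.q b b = -σ * P₁.q w w := by linear_combination σ * h0
  have hw0 : P₁.q w w = 0 := by
    by_contra hne
    have hpos : 0 < -σ * P₁.q w w := lt_of_le_of_ne hα1 (Ne.symm (mul_ne_zero (neg_ne_zero.2 hσ) hne))
    have h4 : σ * P₂.q f f ≤ 0 := by
      rw [hαβ] at hCS
      have h5 : -σ * P₁.q w w ≤ σ * (-t * P₂.q f f - P₁.q w w) :=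
        le_of_mul_le_mul_left (by linarith) hpos
      by_contra hc
      push Not at hc
      nlinarith
    obtain ⟨v, hv, e⟩ := hφ2 ((mul_eq_zero.1 (le_antisymm h4 hφ1)).resolve_left hσ)
    apply hne
    rw [← hwd, h.link.q_adj', e, P₂.q_T_right]
    exact P₂.B_zero (by omega) hDwG.1 hv
  obtain ⟨g, hg, eg⟩ := hα2 hw0
  obtain ⟨g', hg', eg'⟩ := hβ2 (by linarith)
  refine ⟨g + g', Submodule.add_mem _ (P₁.mono (by omega) hg) hg', ?_⟩
  rw [map_add, ← eg, ← eg', hb]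
  abel

end Seq3

end LeftKLS

namespace LeftKLS

section Pencil

variable {V : Type*} [AddCommGroup V] [Module ℝ V] [FiniteDimensional ℝ V]

/-- A symmetric form is nonnegative if none of its eigenvectors with respect to a positive definite
form has negative eigenvalue. -/
lemma nonneg_of_no_neg_eigenvector (b₁ b₀ : V →ₗ[ℝ] V →ₗ[ℝ] ℝ) (h₁ : ∀ u v, b₁ u v = b₁ v u)
    (h₀ : ∀ u v, b₀ u v = b₀ v u) (hpos : ∀ u, 0 ≤ b₁ u u) (hdef : ∀ u, b₁ u u = 0 → u = 0)
    (hev : ∀ l < 0, ∀ u, (∀ v, b₀ u v = l * b₁ u v) → u = 0) (u : V) : 0 ≤ b₀ u u := by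
  let core : InnerProductSpace.Core ℝ V :=
    { inner := fun u v => b₁ u v
      conj_inner_symm := fun u v => h₁ v u
      re_inner_nonneg := hpos
      add_left := fun u v w => by simp
      smul_left := fun u v r => by simp
      definite := hdef }
  let : NormedAddCommGroup V := core.toNormedAddCommGroup
  let : InnerProductSpace ℝ V := InnerProductSpace.ofCore core.toCore
  have hin : ∀ u v : V, inner ℝ u v = b₁ u v := fun _ _ => rfl
  have hinj : Function.Injective b₁ := by
    rw [injective_iff_map_eq_zero]
    intro u hu
    exact hdef u (by rw [hu]; rfl)
  let e : V ≃ₗ[ℝ] (V →ₗ[ℝ] ℝ) := LinearMap.linearEquivOfInjective b₁ hinj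
    (Subspace.dual_finrank_eq).symm
  let T : V →ₗ[ℝ] V := (e.symm : (V →ₗ[ℝ] ℝ) →ₗ[ℝ] V) ∘ₗ b₀
  have hT : ∀ u v, b₁ (T u) v = b₀ u v := by
    intro u v
    have : e (T u) = b₀ u := e.apply_symm_apply _
    exact LinearMap.congr_fun this v
  have hsym : T.IsSymmetric := fun u v => by
    rw [hin, hin, hT, h₁, hT, h₀]
  let E := hsym.eigenvectorBasis rfl
  have hev' : ∀ i, 0 ≤ hsym.eigenvalues rfl i := by
    intro i
    by_contra hc
    push Not at hc
    have h1 : T (E i) = (hsym.eigenvalues rfl i) • E i := hsym.apply_eigenvectorBasis rfl i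
    have := hev _ hc (E i) (fun v => by
      rw [← hT, h1, map_smul, LinearMap.smul_apply, smul_eq_mul])
    exact E.orthonormal.ne_zero i this
  have h2 : b₀ u u = ∑ i, hsym.eigenvalues rfl i * (inner ℝ u (E i) * inner ℝ (E i) u) := by
    rw [← hT, ← hin, ← E.sum_inner_mul_inner]
    refine Finset.sum_congr rfl fun i _ => ?_
    have h1 : T (E i) = (hsym.eigenvalues rfl i) • E i := hsym.apply_eigenvectorBasis rfl i
    rw [hsym, h1, real_inner_smul_right]
    ring
  rw [h2]
  refine Finset.sum_nonneg fun i _ => mul_nonneg (hev' i) ?_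
  rw [real_inner_comm]
  exact mul_self_nonneg _

lemma nonneg_of_pencil (b₁ b₀ : V →ₗ[ℝ] V →ₗ[ℝ] ℝ) (h₁ : ∀ u v, b₁ u v = b₁ v u)
    (h₀ : ∀ u v, b₀ u v = b₀ v u) (N : Submodule ℝ V) (hN₁ : ∀ u ∈ N, ∀ v, b₁ u v = 0)
    (hN₀ : ∀ u ∈ N, ∀ v, b₀ u v = 0) (hpos : ∀ u, 0 ≤ b₁ u u) (hdef : ∀ u, b₁ u u = 0 → u ∈ N)
    (hrad : ∀ t > 0, ∀ u, (∀ v, b₁ u v + t * b₀ u v = 0) → u ∈ N) (u : V) : 0 ≤ b₀ u u := by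
  obtain ⟨M, hM⟩ := N.exists_isCompl
  have split : ∀ v, ∃ n ∈ N, ∃ m ∈ M, n + m = v := fun v =>
    Submodule.mem_sup.1 (hM.sup_eq_top ▸ Submodule.mem_top)
  have hdisj : ∀ m : M, (m : V) ∈ N → m = 0 := fun m hm => by
    have := Submodule.disjoint_def.1 hM.disjoint _ hm m.2
    exact Subtype.ext this
  have key := nonneg_of_no_neg_eigenvector (b₁.domRestrict₁₂ M M) (b₀.domRestrict₁₂ M M)
    (fun u v => h₁ u v) (fun u v => h₀ u v) (fun u => hpos u)
    (fun u hu => hdisj u (hdef u hu)) (fun l hl u hu => hdisj u (hrad (-l⁻¹) (by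
      have := inv_lt_zero.2 hl
      linarith) u (fun v => by
        obtain ⟨n, hn, m, hm, rfl⟩ := split v
        have h3 : b₀ u m = l * b₁ u m := hu ⟨m, hm⟩
        rw [map_add, map_add, h₁ _ n, h₀ _ n, hN₁ n hn, hN₀ n hn, h3]
        linear_combination (- b₁ u m) * mul_inv_cancel₀ hl.ne)))
  obtain ⟨n, hn, m, hm, rfl⟩ := split u
  have : 0 ≤ b₀ m m := key ⟨m, hm⟩
  rw [map_add, map_add, LinearMap.add_apply, LinearMap.add_apply, hN₀ n hn, hN₀ n hn, h₀ m n,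
    hN₀ n hn]
  linarith

end Pencil

end LeftKLS

namespace LeftKLS

/-- A filtered space with a self-adjoint operator shifting the filtration by one. -/
structure Op (X : Type*) [AddCommGroup X] [Module ℝ X] extends Flt X where
  C : X →ₗ[ℝ] X
  adj : ∀ u v, B (C u) v = B u (C v)
  shift : ∀ k u, u ∈ F k → C u ∈ F (k + 1)
  neg : ∀ k < 0, F k = ⊥

namespace Op

variable {X : Type*} [AddCommGroup X] [Module ℝ X] (P : Op X)

/-- The Hodge–Riemann property for the operator `C + t`. -/
def HR (δ t : ℝ) : Prop :=
  (∀ u, P.C u + t • u = 0 → u = 0) ∧ ∀ k, 0 ≤ k → 2 * k ≤ P.n → ∀ u ∈ P.F (P.n - k),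
    P.C u + t • u ∈ P.F k → 0 ≤ δ * sg k * P.B u (P.C u + t • u) ∧
      (P.B u (P.C u + t • u) = 0 → u ∈ P.F (k - 1))

/-- The filtered space with automorphism `C + t`. -/
noncomputable def pol [FiniteDimensional ℝ X] (t : ℝ) (h : ∀ u, P.C u + t • u = 0 → u = 0) :
    Pol X where
  toFlt := P.toFlt
  T := LinearEquiv.ofInjectiveEndo (P.C + t • LinearMap.id) (by
    rw [injective_iff_map_eq_zero]; exact h)
  adj u v := by
    show P.B (P.C u + t • u) v = P.B u (P.C v + t • v)
    rw [map_add, map_add, LinearMap.add_apply, P.adj, map_smul, map_smul, LinearMap.smul_apply]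
  shift k u hu := Submodule.add_mem _ (P.shift k u hu)
    (Submodule.smul_mem _ _ (P.mono (by omega) hu))

lemma pol_T [FiniteDimensional ℝ X] {t : ℝ} (h : ∀ u, P.C u + t • u = 0 → u = 0) (u : X) :
    (P.pol t h).T u = P.C u + t • u := rfl

lemma HR.pol [FiniteDimensional ℝ X] {δ t : ℝ} (h : P.HR δ t) : (P.pol t h.1).HR δ := by
  intro k hk0 hk u hu hq
  obtain ⟨φ, rfl⟩ := (P.pol t h.1).T.surjective u
  have h1 : φ ∈ P.F (P.n - k) := by
    have e : P.n - k = P.n - 1 - (k - 1) := by ring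
    rw [e, P.perp]
    intro v hv
    rw [P.symm]
    have := hq v hv
    rwa [Pol.q_T_left] at this
  have h2 := h.2 k hk0 hk φ h1 hu
  rw [Pol.q_T_left]
  exact ⟨h2.1, fun h0 => ⟨φ, h2.2 h0, rfl⟩⟩

end Op

section

variable {X₁ X₂ X₃ X₄ : Type*} [AddCommGroup X₁] [Module ℝ X₁] [AddCommGroup X₂] [Module ℝ X₂]
  [AddCommGroup X₃] [Module ℝ X₃] [AddCommGroup X₄] [Module ℝ X₄]

/-- A pair of adjoint maps commuting with the operators. -/
structure OLink (P₁ : Op X₁) (P₂ : Op X₂) (D : X₁ →ₗ[ℝ] X₂) (d : X₂ →ₗ[ℝ] X₁) : Prop where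
  deg : P₁.n = P₂.n + 1
  D_mem : ∀ k, ∀ u ∈ P₁.F k, D u ∈ P₂.F k
  d_mem : ∀ k, ∀ u ∈ P₂.F k, d u ∈ P₁.F (k + 1)
  adj : ∀ u v, P₁.B (d u) v = P₂.B u (D v)
  D_C : ∀ u, D (P₁.C u) = P₂.C (D u)
  d_C : ∀ u, d (P₂.C u) = P₁.C (d u)

lemma OLink.link [FiniteDimensional ℝ X₁] [FiniteDimensional ℝ X₂] {P₁ : Op X₁} {P₂ : Op X₂}
    {D : X₁ →ₗ[ℝ] X₂} {d : X₂ →ₗ[ℝ] X₁} (h : OLink P₁ P₂ D d) {t : ℝ}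
    (h₁ : ∀ u, P₁.C u + t • u = 0 → u = 0) (h₂ : ∀ u, P₂.C u + t • u = 0 → u = 0) :
    Link (P₁.pol t h₁) (P₂.pol t h₂) D d where
  deg := h.deg
  D_mem := h.D_mem
  d_mem := h.d_mem
  adj := h.adj
  D_T u := by rw [Op.pol_T, Op.pol_T, map_add, map_smul, h.D_C]
  d_T u := by rw [Op.pol_T, Op.pol_T, map_add, map_smul, h.d_C]

/-- Four consecutive terms of a complex satisfying Hodge–Riemann relations. -/
structure Seq4 (P₁ : Op X₁) (P₂ : Op X₂) (P₃ : Op X₃) (P₄ : Op X₄)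
    (D : X₁ →ₗ[ℝ] X₂) (d : X₂ →ₗ[ℝ] X₁) (D' : X₂ →ₗ[ℝ] X₃) (d' : X₃ →ₗ[ℝ] X₂)
    (D'' : X₃ →ₗ[ℝ] X₄) (d'' : X₄ →ₗ[ℝ] X₃) (δ : ℝ) : Prop where
  link : OLink P₁ P₂ D d
  link' : OLink P₂ P₃ D' d'
  link'' : OLink P₃ P₄ D'' d''
  DD : ∀ u, D' (D u) = 0
  DD' : ∀ u, D'' (D' u) = 0
  sq : δ * δ = 1
  HR₁ : ∀ t, 0 ≤ t → P₁.HR δ t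
  HR₂ : ∀ t, 0 ≤ t → P₂.HR (-δ) t
  HR₃ : ∀ t, 0 ≤ t → P₃.HR δ t
  HR₄ : ∀ t, 0 ≤ t → P₄.HR (-δ) t
  rel : ∀ u, D (d u) + d' (D' u) = P₂.C u
  rel' : ∀ u, D' (d' u) + d'' (D'' u) = P₃.C u

lemma OLink.dd {P₁ : Op X₁} {P₂ : Op X₂} {P₃ : Op X₃} {D : X₁ →ₗ[ℝ] X₂} {d : X₂ →ₗ[ℝ] X₁}
    {D' : X₂ →ₗ[ℝ] X₃} {d' : X₃ →ₗ[ℝ] X₂} (h : OLink P₁ P₂ D d) (h' : OLink P₂ P₃ D' d')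
    (hDD : ∀ u, D' (D u) = 0) (u : X₃) : d (d' u) = 0 :=
  P₁.nondeg P₁.neg _ fun v => by rw [h.adj, h'.adj, hDD, map_zero]

namespace Seq4

variable {P₁ : Op X₁} {P₂ : Op X₂} {P₃ : Op X₃} {P₄ : Op X₄}
  {D : X₁ →ₗ[ℝ] X₂} {d : X₂ →ₗ[ℝ] X₁} {D' : X₂ →ₗ[ℝ] X₃} {d' : X₃ →ₗ[ℝ] X₂}
  {D'' : X₃ →ₗ[ℝ] X₄} {d'' : X₄ →ₗ[ℝ] X₃} {δ : ℝ}
  [FiniteDimensional ℝ X₁] [FiniteDimensional ℝ X₂] [FiniteDimensional ℝ X₃]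
  [FiniteDimensional ℝ X₄]
  (h : Seq4 P₁ P₂ P₃ P₄ D d D' d' D'' d'' δ)

include h

lemma seq {t : ℝ} (ht : 0 ≤ t) : Seq3 (P₁.pol t (h.HR₁ t ht).1) (P₂.pol t (h.HR₂ t ht).1)
    (P₃.pol t (h.HR₃ t ht).1) D d D' d' δ t where
  link := h.link.link _ _
  link' := h.link'.link _ _
  DD := h.DD
  dd := h.link.dd h.link' h.DD
  neg₁ := P₁.neg
  neg₂ := P₂.neg
  neg₃ := P₃.neg
  sq := h.sq
  HR₁ := (h.HR₁ t ht).pol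
  HR₂ := (h.HR₂ t ht).pol
  HR₃ := (h.HR₃ t ht).pol
  rel u := by rw [Op.pol_T, h.rel, add_sub_cancel_right]

lemma seq' {t : ℝ} (ht : 0 ≤ t) : Seq3 (P₂.pol t (h.HR₂ t ht).1) (P₃.pol t (h.HR₃ t ht).1)
    (P₄.pol t (h.HR₄ t ht).1) D' d' D'' d'' (-δ) t where
  link := h.link'.link _ _
  link' := h.link''.link _ _
  DD := h.DD'
  dd := h.link'.dd h.link'' h.DD'
  neg₁ := P₂.neg
  neg₂ := P₃.neg
  neg₃ := P₄.neg
  sq := by rw [neg_mul_neg]; exact h.sq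
  HR₁ := (h.HR₂ t ht).pol
  HR₂ := by rw [neg_neg]; exact (h.HR₃ t ht).pol
  HR₃ := (h.HR₄ t ht).pol
  rel u := by rw [Op.pol_T, h.rel', add_sub_cancel_right]

lemma exact {K : ℤ} {x : X₂} (hx : x ∈ P₂.F K) (hDx : D' x = 0) : ∃ y ∈ P₁.F K, x = D y :=
  (h.seq le_rfl).exact hx hDx

/-- The form on the first term twisted by the inverse of `C`. -/
noncomputable def q : X₁ →ₗ[ℝ] X₁ →ₗ[ℝ] ℝ := (P₁.pol 0 (h.HR₁ 0 le_rfl).1).q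

lemma q_symm (u v : X₁) : h.q u v = h.q v u := Pol.q_symm _ _ _

lemma q_C_left (u v : X₁) : h.q (P₁.C u) v = P₁.B u v := by
  have := (P₁.pol 0 (h.HR₁ 0 le_rfl).1).q_T_left u v
  rwa [Op.pol_T, zero_smul, add_zero] at this

omit h in
/-- The operator `C - d D`. -/
def A (P₁ : Op X₁) (D : X₁ →ₗ[ℝ] X₂) (d : X₂ →ₗ[ℝ] X₁) : X₁ →ₗ[ℝ] X₁ := P₁.C - d ∘ₗ D

omit h [FiniteDimensional ℝ X₁] [FiniteDimensional ℝ X₂] in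
lemma A_apply (v : X₁) : A P₁ D d v = P₁.C v - d (D v) := rfl

lemma D_A (v : X₁) : D (A P₁ D d v) = 0 := by
  have := h.rel (D v)
  rw [h.DD, map_zero, add_zero] at this
  rw [A_apply, map_sub, this, h.link.D_C, sub_self]

lemma A_mem {k : ℤ} {v : X₁} (hv : v ∈ P₁.F (k - 1)) : A P₁ D d v ∈ P₁.F k := by
  have h1 := P₁.shift _ _ hv
  have h2 := h.link.d_mem _ _ (h.link.D_mem _ _ hv)
  rw [sub_add_cancel] at h1 h2
  exact Submodule.sub_mem _ h1 h2

lemma q_A (v : X₁) {u : X₁} (hu : D u = 0) : h.q (A P₁ D d v) u = P₁.B v u := by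
  have := (h.seq le_rfl).link.q_adj (D v) u
  rw [hu, map_zero] at this
  rw [A_apply, map_sub, LinearMap.sub_apply, h.q_C_left]
  exact sub_eq_self.2 this

lemma q_A_right (v : X₁) {u : X₁} (hu : D u = 0) : h.q u (A P₁ D d v) = P₁.B v u := by
  rw [h.q_symm, h.q_A v hu]

lemma exists_A {k : ℤ} (hk : 2 * k ≤ P₁.n) {x : X₁} (hx : x ∈ P₁.F k) (hDx : D x = 0)
    (hq : ∀ v ∈ P₁.F k, D v = 0 → h.q x v = 0) : ∃ v ∈ P₁.F (k - 1), x = A P₁ D d v := by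
  obtain ⟨v, hv, e⟩ := ((h.seq le_rfl).closed_HR_zero hk hx hDx (fun v hv hDv =>
    hq v (P₁.mono (by omega) hv) hDv)).2 (hq x hx hDx)
  refine ⟨v, hv, e.trans ?_⟩
  rw [Op.pol_T, zero_smul, add_zero]; rfl

lemma mem_of_q_A {k : ℤ} {u : X₁} (hu : D u = 0)
    (hq : ∀ v ∈ P₁.F (k - 1), h.q (A P₁ D d v) u = 0) : u ∈ P₁.F (P₁.n - k) := by
  have e : P₁.n - k = P₁.n - 1 - (k - 1) := by ring
  rw [e, P₁.perp]
  intro v hv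
  rw [← h.q_A v hu, hq v hv]

lemma q_nondeg {u : X₁} (hu : D u = 0) (hq : ∀ v, D v = 0 → h.q u v = 0) : u = 0 := by
  have := h.mem_of_q_A (k := P₁.n + 1) hu (fun v _ => by rw [h.q_symm]; exact hq _ (h.D_A v))
  rwa [P₁.neg _ (by omega), Submodule.mem_bot] at this

/-- A closed vector orthogonal to the closed vectors of `F (n - k)` lies in `A (F (k - 1))`. -/
lemma exists_A_of_orth {k : ℤ} {x : X₁} (hx : D x = 0)
    (hq : ∀ v ∈ P₁.F (P₁.n - k), D v = 0 → h.q x v = 0) : ∃ v ∈ P₁.F (k - 1), x = A P₁ D d v := by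
  have := mem_of_orth (h.q.domRestrict₁₂ (LinearMap.ker D) (LinearMap.ker D))
    (fun u v => h.q_symm u v) (fun u hu => Subtype.ext (h.q_nondeg u.2 (fun v hv => hu ⟨v, hv⟩)))
    (((P₁.F (k - 1)).map (A P₁ D d)).comap (LinearMap.ker D).subtype) (x := ⟨x, hx⟩) (by
      intro v hv
      refine hq v (h.mem_of_q_A v.2 fun w hw => ?_) v.2
      exact hv ⟨A P₁ D d w, h.D_A w⟩ ⟨w, hw, rfl⟩)
  obtain ⟨v, hv, e⟩ := this
  exact ⟨v, hv, e.symm⟩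

end Seq4

end

end LeftKLS

namespace LeftKLS

namespace Seq4

variable {X₁ X₂ X₃ X₄ : Type*} [AddCommGroup X₁] [Module ℝ X₁] [AddCommGroup X₂] [Module ℝ X₂]
  [AddCommGroup X₃] [Module ℝ X₃] [AddCommGroup X₄] [Module ℝ X₄]
  {P₁ : Op X₁} {P₂ : Op X₂} {P₃ : Op X₃} {P₄ : Op X₄}
  {D : X₁ →ₗ[ℝ] X₂} {d : X₂ →ₗ[ℝ] X₁} {D' : X₂ →ₗ[ℝ] X₃} {d' : X₃ →ₗ[ℝ] X₂}
  {D'' : X₃ →ₗ[ℝ] X₄} {d'' : X₄ →ₗ[ℝ] X₃} {δ : ℝ}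
  [FiniteDimensional ℝ X₁] [FiniteDimensional ℝ X₂] [FiniteDimensional ℝ X₃]
  [FiniteDimensional ℝ X₄]

/-- A complement of the radical of the twisted form on the closed vectors of the middle step of
the filtration. -/
structure Compl (P₁ : Op X₁) (D : X₁ →ₗ[ℝ] X₂) (d : X₂ →ₗ[ℝ] X₁) (m : ℤ) (M : Submodule ℝ X₁) :
    Prop where
  mem : ∀ v ∈ M, v ∈ P₁.F m
  closed : ∀ v ∈ M, D v = 0
  disj : ∀ w ∈ P₁.F (m - 1), A P₁ D d w ∈ M → A P₁ D d w = 0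
  span : ∀ z ∈ P₁.F m, D z = 0 → ∃ v ∈ M, ∃ w ∈ P₁.F (m - 1), z = v + A P₁ D d w
  nonneg : 0 ≤ m
  le : 2 * m ≤ P₁.n
  ge : P₁.n ≤ 2 * m + 1

variable (h : Seq4 P₁ P₂ P₃ P₄ D d D' d' D'' d'' δ)

include h in
lemma exists_compl (hn : 0 ≤ P₁.n) : ∃ m M, Compl P₁ D d m M := by
  let m : ℤ := P₁.n / 2
  let R : Submodule ℝ X₁ := (P₁.F (m - 1)).map (A P₁ D d)
  let Z : Submodule ℝ X₁ := P₁.F m ⊓ LinearMap.ker D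
  have hRZ : R ≤ Z := by
    rintro _ ⟨v, hv, rfl⟩
    exact ⟨h.A_mem hv, h.D_A v⟩
  obtain ⟨M, hd, hs⟩ := exists_isCompl (⟨R, hRZ⟩ : Set.Iic Z)
  obtain ⟨M, hMZ⟩ := M
  refine ⟨m, M, fun v hv => (hMZ hv).1, fun v hv => (hMZ hv).2, fun w hw hM => ?_,
    fun z hz hDz => ?_, by omega, by omega, by omega⟩
  · have h1 := hd (x := ⟨R ⊓ M, inf_le_left.trans hRZ⟩) (inf_le_left (a := R) (b := M))
      (inf_le_right (a := R) (b := M))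
    have h2 : R ⊓ M ≤ ⊥ := h1
    exact (Submodule.mem_bot ℝ).1 (h2 ⟨⟨w, hw, rfl⟩, hM⟩)
  · have h1 := hs (x := ⟨R ⊔ M, sup_le hRZ hMZ⟩) (le_sup_left (a := R) (b := M))
      (le_sup_right (a := R) (b := M))
    have h2 : Z ≤ R ⊔ M := h1
    obtain ⟨_, ⟨w, hw, rfl⟩, v, hv, e⟩ := Submodule.mem_sup.1 (h2 ⟨hz, hDz⟩)
    exact ⟨v, hv, w, hw, by rw [← e, add_comm]⟩

variable {m : ℤ} {M : Submodule ℝ X₁}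

/-- The form of the extension. -/
noncomputable def extB (M : Submodule ℝ X₁) :
    (LinearMap.ker D × M) →ₗ[ℝ] (LinearMap.ker D × M) →ₗ[ℝ] ℝ :=
  LinearMap.mk₂ ℝ (fun x y => h.q x.1 y.1 - h.q x.2 y.2) (fun x y z => by simp; ring)
    (fun c x y => by simp; ring) (fun x y z => by simp; ring) (fun c x y => by simp; ring)

lemma extB_apply (x y : LinearMap.ker D × M) :
    h.extB M x y = h.q x.1 y.1 - h.q x.2 y.2 := rfl

/-- The filtration of the extension. -/
def extF (m : ℤ) (M : Submodule ℝ X₁) (k : ℤ) : Submodule ℝ (LinearMap.ker D × M) where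
  carrier := {x | (x.1 : X₁) ∈ P₁.F k ∧
    ∀ f ∈ P₁.F (min m (P₁.n - k)), D f = 0 → h.q x.1 f = h.q x.2 f}
  add_mem' {x y} hx hy := ⟨Submodule.add_mem _ hx.1 hy.1, fun f hf hDf => by
    have h1 := hx.2 f hf hDf
    have h2 := hy.2 f hf hDf
    simp only [Prod.fst_add, Prod.snd_add, Submodule.coe_add, map_add, LinearMap.add_apply, h1, h2]⟩
  zero_mem' := ⟨Submodule.zero_mem _, fun f hf hDf => by simp⟩
  smul_mem' c x hx := ⟨Submodule.smul_mem _ _ hx.1, fun f hf hDf => by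
    have h1 := hx.2 f hf hDf
    simp only [Prod.smul_fst, Prod.smul_snd, Submodule.coe_smul, map_smul, LinearMap.smul_apply, h1]⟩

/-- The map from the extension to the first term. -/
def extD (D : X₁ →ₗ[ℝ] X₂) (M : Submodule ℝ X₁) : (LinearMap.ker D × M) →ₗ[ℝ] X₁ :=
  (LinearMap.ker D).subtype ∘ₗ LinearMap.fst ℝ _ _

/-- The map from the first term to the extension. -/
noncomputable def extd (M : Submodule ℝ X₁) : X₁ →ₗ[ℝ] (LinearMap.ker D × M) :=
  LinearMap.inl ℝ _ _ ∘ₗ (A P₁ D d).codRestrict (LinearMap.ker D) h.D_A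

lemma extd_fst (v : X₁) : ((h.extd M v).1 : X₁) = A P₁ D d v := rfl

lemma extd_snd (v : X₁) : (h.extd M v).2 = 0 := rfl

lemma extB_extd (v : X₁) (y : LinearMap.ker D × M) :
    h.extB M (h.extd M v) y = P₁.B v y.1 := by
  rw [extB_apply, extd_fst, extd_snd, h.q_A v y.1.2]
  simp

lemma extd_mem {k : ℤ} {v : X₁} (hv : v ∈ P₁.F (k - 1)) : h.extd M v ∈ h.extF m M k := by
  refine ⟨h.A_mem hv, fun f hf hDf => ?_⟩
  rw [extd_fst, extd_snd, h.q_A v hDf, Submodule.coe_zero, map_zero, LinearMap.zero_apply]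
  exact P₁.B_zero (i := k - 1) (j := P₁.n - k) (by omega) hv (P₁.mono (min_le_right _ _) hf)

namespace Compl

variable (hM : Compl P₁ D d m M)
include hM

lemma eq_zero {v : X₁} (hv : v ∈ M) (hq : ∀ f ∈ P₁.F m, D f = 0 → h.q v f = 0) : v = 0 := by
  obtain ⟨w, hw, rfl⟩ := h.exists_A hM.le (hM.mem v hv) (hM.closed v hv) hq
  exact hM.disj w hw hv

/-- Every functional `h.q u` on closed vectors of `F (min m (n - k))` is represented in `M`. -/
lemma exists_mem {k : ℤ} {u : X₁} (hu : u ∈ P₁.F k) (hDu : D u = 0) :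
    ∃ v : M, (⟨u, hDu⟩, v) ∈ h.extF m M k := by
  obtain ⟨z, ⟨hz, hDz⟩, hzq⟩ := exists_represent h.q (P₁.F (min m (P₁.n - k)) ⊓ LinearMap.ker D)
    (P₁.F m ⊓ LinearMap.ker D) (h.q u) (by
      rintro f ⟨hf, hDf⟩ hf0
      have hm := hM.le
      obtain ⟨w, hw, rfl⟩ := h.exists_A (k := min m (P₁.n - k)) (by omega) hf hDf
        (fun v hv hDv => by
          rw [h.q_symm]
          exact hf0 v ⟨P₁.mono (min_le_left _ _) hv, hDv⟩)
      rw [h.q_A_right _ hDu]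
      exact P₁.B_zero (by omega) hw hu)
  obtain ⟨v, hv, w, hw, rfl⟩ := hM.span z hz hDz
  refine ⟨⟨v, hv⟩, hu, fun f hf hDf => ?_⟩
  rw [← hzq f ⟨hf, hDf⟩, map_add, LinearMap.add_apply, h.q_A w hDf, P₁.B_zero _ hw
    (P₁.mono (min_le_left _ _) hf), add_zero]
  have := hM.le
  omega

lemma extF_inj {k : ℤ} (hk : 2 * k ≤ P₁.n + 1) {x : LinearMap.ker D × M} (hx : x ∈ h.extF m M k)
    (hx0 : x.1 = 0) : x = 0 := by
  have hmle := hM.le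
  have := hM.ge
  refine Prod.ext hx0 (Subtype.ext (hM.eq_zero h x.2.2 fun f hf hDf => ?_))
  rw [← hx.2 f (by rwa [min_eq_left (by omega)]) hDf, hx0]
  simp

lemma extF_neg {k : ℤ} (hk : k < 0) : h.extF m M k = ⊥ := by
  rw [Submodule.eq_bot_iff]
  intro x hx
  have h1 := hx.1
  have h2 := hM.nonneg
  have h3 := hM.le
  rw [P₁.neg k hk, Submodule.mem_bot] at h1
  exact hM.extF_inj h (by omega) hx (Subtype.ext h1)

lemma extF_orth {k l : ℤ} (hkl : k + l ≤ P₁.n) {x y : LinearMap.ker D × M}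
    (hx : x ∈ h.extF m M k) (hy : y ∈ h.extF m M l) : h.extB M x y = 0 := by
  wlog hkm : k ≤ l generalizing k l x y
  · have := this (by omega) hy hx (by omega)
    rwa [extB_apply, h.q_symm, h.q_symm y.2] at this
  have h1 := hM.le
  have h2 := hM.ge
  rw [extB_apply]
  have e1 : h.q y.1 x.1 = h.q y.2 x.1 :=
    hy.2 _ (P₁.mono (by omega) hx.1) x.1.2
  have e2 : h.q x.1 y.2 = h.q x.2 y.2 :=
    hx.2 _ (P₁.mono (by omega) (hM.mem _ y.2.2)) (hM.closed _ y.2.2)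
  rw [h.q_symm, e1, h.q_symm, e2, sub_self]

lemma extB_symm (x y : LinearMap.ker D × M) : h.extB M x y = h.extB M y x := by
  rw [extB_apply, extB_apply, h.q_symm, h.q_symm x.2]

lemma extB_nondeg (x : LinearMap.ker D × M) (hx : ∀ y, h.extB M x y = 0) : x = 0 := by
  refine Prod.ext (Subtype.ext (h.q_nondeg x.1.2 fun v hv => ?_))
    (Subtype.ext (hM.eq_zero h x.2.2 fun f hf hDf => ?_))
  · have := hx (⟨v, hv⟩, 0)
    simpa [extB_apply] using this
  · obtain ⟨v, hv, w, hw, rfl⟩ := hM.span f hf hDf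
    have h1 := hx (0, ⟨v, hv⟩)
    have h2 := hM.le
    rw [map_add, h.q_A_right w (hM.closed _ x.2.2), P₁.B_zero (by omega) hw (hM.mem _ x.2.2)]
    simpa [extB_apply] using h1

lemma extF_perp_of_le {k : ℤ} (hk : k ≤ m) {x : LinearMap.ker D × M}
    (hx : ∀ y ∈ h.extF m M k, h.extB M y x = 0) : x ∈ h.extF m M (P₁.n - k) := by
  have h1 := hM.le
  refine ⟨?_, fun f hf hDf => ?_⟩
  · refine h.mem_of_q_A x.1.2 fun v hv => ?_
    rw [h.q_A v x.1.2, ← h.extB_extd (M := M) v x]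
    exact hx _ (h.extd_mem hv)
  · rw [min_eq_right (by omega), sub_sub_cancel] at hf
    obtain ⟨v, hv⟩ := hM.exists_mem h hf hDf
    have h2 := hx _ hv
    have h3 := hv.2 x.2 (P₁.mono (by omega) (hM.mem _ x.2.2)) (hM.closed _ x.2.2)
    rw [extB_apply] at h2
    change h.q f x.1 - h.q v x.2 = 0 at h2
    change h.q f x.2 = h.q v x.2 at h3
    rw [h.q_symm, h.q_symm x.2]
    linarith

lemma extF_perp (k : ℤ) (x : LinearMap.ker D × M) :
    x ∈ h.extF m M (P₁.n - k) ↔ ∀ y ∈ h.extF m M k, h.extB M y x = 0 := by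
  refine ⟨fun hx y hy => hM.extF_orth h (by omega) hy hx, fun hx => ?_⟩
  rcases le_or_gt k m with hk | hk
  · exact hM.extF_perp_of_le h hk hx
  have := hM.ge
  refine mem_of_orth (h.extB M) (hM.extB_symm h) (hM.extB_nondeg h) _ fun v hv => ?_
  rw [hM.extB_symm h]
  refine hx v ?_
  have h2 := hM.extF_perp_of_le h (k := P₁.n - k) (by omega) hv
  rwa [sub_sub_cancel] at h2

/-- The extension as a filtered space with operator. -/
noncomputable def ext : Op (LinearMap.ker D × M) where
  B := h.extB M
  symm := hM.extB_symm h
  F := h.extF m M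
  mono k l hkl x hx := ⟨P₁.mono hkl hx.1, fun f hf hDf => hx.2 f (P₁.mono (by omega) hf) hDf⟩
  n := P₁.n + 1
  perp k x := by rw [← hM.extF_perp h]; congr! 2; ring
  C := h.extd M ∘ₗ extD D M
  adj u v := by
    rw [LinearMap.comp_apply, LinearMap.comp_apply, h.extB_extd, hM.extB_symm h, h.extB_extd]
    exact P₁.symm _ _
  shift k u hu := h.extd_mem (by rw [add_sub_cancel_right]; exact hu.1)
  neg k hk := hM.extF_neg h hk

end Compl

end Seq4

end LeftKLS

namespace LeftKLS

namespace Seq4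

variable {X₁ X₂ X₃ X₄ : Type*} [AddCommGroup X₁] [Module ℝ X₁] [AddCommGroup X₂] [Module ℝ X₂]
  [AddCommGroup X₃] [Module ℝ X₃] [AddCommGroup X₄] [Module ℝ X₄]
  {P₁ : Op X₁} {P₂ : Op X₂} {P₃ : Op X₃} {P₄ : Op X₄}
  {D : X₁ →ₗ[ℝ] X₂} {d : X₂ →ₗ[ℝ] X₁} {D' : X₂ →ₗ[ℝ] X₃} {d' : X₃ →ₗ[ℝ] X₂}
  {D'' : X₃ →ₗ[ℝ] X₄} {d'' : X₄ →ₗ[ℝ] X₃} {δ : ℝ}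
  [FiniteDimensional ℝ X₁] [FiniteDimensional ℝ X₂] [FiniteDimensional ℝ X₃]
  [FiniteDimensional ℝ X₄]
  {m : ℤ} {M : Submodule ℝ X₁} (h : Seq4 P₁ P₂ P₃ P₄ D d D' d' D'' d'' δ)

lemma D_extD (x : LinearMap.ker D × M) : D (extD D M x) = 0 := x.1.2

include h in
lemma extD_extd (v : X₁) : extD D M (h.extd M v) + d (D v) = P₁.C v := by
  show A P₁ D d v + d (D v) = P₁.C v
  rw [A_apply, sub_add_cancel]

include h in
lemma A_C (v : X₁) : A P₁ D d (P₁.C v) = P₁.C (A P₁ D d v) := by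
  rw [A_apply, A_apply, map_sub, h.link.D_C, h.link.d_C]

lemma A_of_closed {v : X₁} (hv : D v = 0) : A P₁ D d v = P₁.C v := by
  rw [A_apply, hv, map_zero, sub_zero]

include h in
lemma A_d (v : X₂) : A P₁ D d (d v) = 0 := by
  have h1 := h.rel v
  rw [A_apply, ← h.link.d_C, ← h1, map_add, h.link.dd h.link' h.DD, add_zero, sub_self]

namespace Compl

variable (hM : Compl P₁ D d m M)

lemma link : OLink (hM.ext h) P₁ (extD D M) (h.extd M) where
  deg := rfl
  D_mem k x hx := hx.1
  d_mem k v hv := h.extd_mem (by rwa [add_sub_cancel_right])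
  adj v x := h.extB_extd v x
  D_C x := A_of_closed x.1.2
  d_C v := by
    refine Prod.ext (Subtype.ext ?_) rfl
    show A P₁ D d (P₁.C v) = A P₁ D d (A P₁ D d v)
    rw [A_C h, A_of_closed (h.D_A v)]

lemma exists_extD {k : ℤ} {u : X₁} (hu : u ∈ P₁.F k) (hDu : D u = 0) :
    ∃ x ∈ (hM.ext h).F k, extD D M x = u := by
  obtain ⟨v, hv⟩ := hM.exists_mem h hu hDu
  exact ⟨_, hv, rfl⟩

lemma extD_inj {k : ℤ} (hk : 2 * k ≤ P₁.n + 1) {x : LinearMap.ker D × M}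
    (hx : x ∈ (hM.ext h).F k) (hx0 : extD D M x = 0) : x = 0 :=
  hM.extF_inj h hk hx (Subtype.ext hx0)

lemma ext_inj {t : ℝ} (ht : 0 < t) (x : LinearMap.ker D × M)
    (hx : (hM.ext h).C x + t • x = 0) : x = 0 := by
  refine Prod.ext (Subtype.ext ((h.HR₁ t ht.le).1 _ ?_)) ?_
  · have := congrArg (extD D M) hx
    rw [map_add, (hM.link h).D_C, map_smul, map_zero] at this
    exact this
  · have := congrArg Prod.snd hx
    change (0 : M) + t • x.2 = 0 at this
    rw [zero_add] at this
    exact (smul_eq_zero.1 this).resolve_left ht.ne'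

lemma ext_HR_low {t : ℝ} (ht : 0 < t) {k : ℤ} (hk : 2 * k ≤ P₁.n) {x : LinearMap.ker D × M}
    (hx : x ∈ (hM.ext h).F (P₁.n + 1 - k)) (hTx : (hM.ext h).C x + t • x ∈ (hM.ext h).F k) :
    0 ≤ -δ * sg k * (hM.ext h).B x ((hM.ext h).C x + t • x) ∧
      ((hM.ext h).B x ((hM.ext h).C x + t • x) = 0 → x ∈ (hM.ext h).F (k - 1)) := by
  have link := hM.link h
  have adj : ∀ x y, (hM.ext h).B ((hM.ext h).C x) y = P₁.B x.1 y.1 := fun x y => h.extB_extd _ _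
  have adjT : ∀ y, (hM.ext h).B ((hM.ext h).C x + t • x) y =
      P₁.B x.1 y.1 + t * (hM.ext h).B x y := fun y => by
    rw [map_add (hM.ext h).B, LinearMap.add_apply, adj, map_smul (hM.ext h).B,
      LinearMap.smul_apply, smul_eq_mul]
  have hu : P₁.C x.1 + t • (x.1 : X₁) ∈ P₁.F k := by
    have := link.D_mem k _ hTx
    rwa [map_add, link.D_C, map_smul] at this
  have hDu : D (P₁.C x.1 + t • (x.1 : X₁)) = 0 := by
    rw [map_add, map_smul, h.link.D_C, x.1.2]
    simp
  have hTx1 : (((hM.ext h).C x + t • x).1 : X₁) = P₁.C x.1 + t • (x.1 : X₁) := by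
    have e : extD D M ((hM.ext h).C x + t • x) = P₁.C x.1 + t • (x.1 : X₁) := by
      rw [map_add, link.D_C, map_smul]
      rfl
    exact e
  have h0 := (hM.ext h).B_zero (i := k) (j := k) (show k + k ≤ P₁.n + 1 - 1 by omega) hTx hTx
  rw [adjT, hTx1] at h0
  have hq : ∀ v ∈ P₁.F (k - 1), D v = 0 → (P₁.pol t (h.HR₁ t ht.le).1).q
      ((P₁.pol t (h.HR₁ t ht.le).1).T x.1) v = 0 := by
    intro v hv hDv
    obtain ⟨y, hy, rfl⟩ := hM.exists_extD h hv hDv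
    have e1 := (hM.ext h).B_zero (i := k) (j := k - 1)
      (show k + (k - 1) ≤ P₁.n + 1 - 1 by omega) hTx hy
    have e2 := (hM.ext h).B_zero (i := P₁.n + 1 - k) (j := k - 1)
      (show P₁.n + 1 - k + (k - 1) ≤ P₁.n + 1 - 1 by omega) hx hy
    rw [adjT, e2, mul_zero, add_zero] at e1
    rw [Pol.q_T_left]
    exact e1
  have key := (h.seq ht.le).closed_HR_pos ht (fun K x hx hDx => h.exact hx hDx) hk hu hDu hq
  have e : (P₁.pol t (h.HR₁ t ht.le).1).q ((P₁.pol t (h.HR₁ t ht.le).1).T x.1)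
      ((P₁.pol t (h.HR₁ t ht.le).1).T x.1) = - t * (hM.ext h).B x ((hM.ext h).C x + t • x) := by
    rw [Pol.q_T_left]
    exact eq_neg_of_add_eq_zero_left h0 |>.trans (by ring)
  change 0 ≤ δ * sg k * (P₁.pol t (h.HR₁ t ht.le).1).q ((P₁.pol t (h.HR₁ t ht.le).1).T x.1)
      ((P₁.pol t (h.HR₁ t ht.le).1).T x.1) ∧ ((P₁.pol t (h.HR₁ t ht.le).1).q
      ((P₁.pol t (h.HR₁ t ht.le).1).T x.1) ((P₁.pol t (h.HR₁ t ht.le).1).T x.1) = 0 →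
      ∃ g ∈ P₁.F (k - 1), (P₁.pol t (h.HR₁ t ht.le).1).T x.1 = _) at key
  rw [e] at key
  refine ⟨?_, fun hz => ?_⟩
  · have h1 := key.1
    refine le_of_mul_le_mul_left ?_ ht
    linarith
  · obtain ⟨g, hg, eg⟩ := key.2 (by rw [hz, mul_zero])
    have hxg := (P₁.pol t (h.HR₁ t ht.le).1).T.injective eg
    rw [← hxg] at hg
    obtain ⟨y, hy, ey⟩ := hM.exists_extD h hg x.1.2
    have hTy : (hM.ext h).C y + t • y ∈ (hM.ext h).F k := by
      refine Submodule.add_mem _ ?_ (Submodule.smul_mem _ _ ((hM.ext h).mono (by omega) hy))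
      simpa using (hM.ext h).shift _ _ hy
    have h2 : x - y = 0 := by
      refine hM.ext_inj h ht _ (hM.extD_inj h (k := k) (by omega) ?_ ?_)
      · have := Submodule.sub_mem _ hTx hTy
        convert this using 1
        rw [map_sub, smul_sub]; abel
      · have e3 : extD D M (x - y) = 0 := by rw [map_sub, ey]; exact sub_self _
        rw [map_add, link.D_C, map_smul, e3, map_zero, smul_zero, add_zero]
    rw [sub_eq_zero.1 h2]
    exact hy

end Compl

end Seq4

end LeftKLS

namespace LeftKLS

namespace Seq4

variable {X₁ X₂ X₃ X₄ : Type*} [AddCommGroup X₁] [Module ℝ X₁] [AddCommGroup X₂] [Module ℝ X₂]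
  [AddCommGroup X₃] [Module ℝ X₃] [AddCommGroup X₄] [Module ℝ X₄]
  {P₁ : Op X₁} {P₂ : Op X₂} {P₃ : Op X₃} {P₄ : Op X₄}
  {D : X₁ →ₗ[ℝ] X₂} {d : X₂ →ₗ[ℝ] X₁} {D' : X₂ →ₗ[ℝ] X₃} {d' : X₃ →ₗ[ℝ] X₂}
  {D'' : X₃ →ₗ[ℝ] X₄} {d'' : X₄ →ₗ[ℝ] X₃} {δ : ℝ}
  [FiniteDimensional ℝ X₁] [FiniteDimensional ℝ X₂] [FiniteDimensional ℝ X₃]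
  [FiniteDimensional ℝ X₄]

variable {m : ℤ} {M : Submodule ℝ X₁} (h : Seq4 P₁ P₂ P₃ P₄ D d D' d' D'' d'' δ)

namespace Compl

variable (hM : Compl P₁ D d m M)

lemma ext_B_C (x y : LinearMap.ker D × M) :
    (hM.ext h).B ((hM.ext h).C x) y = P₁.B x.1 y.1 := h.extB_extd _ _

lemma ext_C_nonneg {k : ℤ} (hk : 2 * k = P₁.n + 1) {x : LinearMap.ker D × M}
    (hx : x ∈ (hM.ext h).F k) (hCx : (hM.ext h).C x ∈ (hM.ext h).F k) :
    0 ≤ -δ * sg k * (hM.ext h).B ((hM.ext h).C x) x ∧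
      ((hM.ext h).B ((hM.ext h).C x) x = 0 → x ∈ (hM.ext h).F (k - 1)) := by
  have hm : m = k - 1 := by
    have h1 := hM.le
    have h2 := hM.ge
    omega
  have hn₂ := h.link.deg
  have hu : (x.1 : X₁) ∈ P₁.F k := hx.1
  have hCu : A P₁ D d x.1 = P₁.C x.1 := A_of_closed x.1.2
  obtain ⟨v, hv, e⟩ := h.exists_A_of_orth (k := k) (x := P₁.C x.1)
    (by rw [h.link.D_C, x.1.2, map_zero]) (fun f hf hDf => by
      have h1 := hCx.2 f (P₁.mono (by omega) hf) hDf
      have h2 : h.q (A P₁ D d x.1) f = h.q ((0 : M) : X₁) f := h1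
      rwa [Submodule.coe_zero, map_zero, LinearMap.zero_apply, hCu] at h2)
  have e1 : P₁.C (x.1 - v) = - d (D v) := by
    rw [map_sub, e, A_apply]; abel
  let q₂ := (P₂.pol 0 (h.HR₂ 0 le_rfl).1).q
  have adj₂ : ∀ a b, h.q (d a) b = q₂ a (D b) := (h.seq le_rfl).link.q_adj
  have e2 : ∀ y, P₁.B (x.1 - v) y = - q₂ (D v) (D y) := fun y => by
    rw [← h.q_C_left, e1, map_neg, LinearMap.neg_apply, adj₂]
  have e3 : (hM.ext h).B ((hM.ext h).C x) x = - q₂ (D v) (D v) := by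
    have h1 : P₁.B v v = 0 := P₁.B_zero (i := k - 1) (j := k - 1) (by omega) hv hv
    rw [ext_B_C, ← h.q_C_left, e, h.q_A v x.1.2, P₁.symm, ← e2, map_sub, LinearMap.sub_apply, h1,
      sub_zero]
  have key := (h.seq' le_rfl).closed_HR_zero (k := k - 1) (show 2 * (k - 1) ≤ P₂.n by omega)
    (x := D v) (h.link.D_mem _ _ hv) (h.DD v) (fun w hw hDw => by
      obtain ⟨y, hy, rfl⟩ := h.exact hw hDw
      have h1 : P₁.B (x.1 - v) y = 0 := P₁.B_zero (i := k) (j := k - 1 - 1) (by omega)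
        (Submodule.sub_mem _ hu (P₁.mono (by omega) hv)) hy
      rw [e2] at h1
      exact neg_eq_zero.1 h1)
  rw [e3]
  refine ⟨?_, fun hz => ?_⟩
  · have h1 := key.1
    rw [sg_sub_one] at h1
    change 0 ≤ -δ * -sg k * q₂ (D v) (D v) at h1
    linarith
  · obtain ⟨w, hw, ew⟩ := key.2 (neg_eq_zero.1 hz)
    have ew' : D v = P₂.C w - d' (D' w) := by
      rw [ew, Op.pol_T, zero_smul, add_zero]
    rw [← h.rel, add_sub_cancel_right] at ew'
    have hDv : D (v - d w) = 0 := by rw [map_sub, ew', sub_self]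
    have hv' : v - d w ∈ P₁.F (k - 1) := by
      refine Submodule.sub_mem _ hv ?_
      have := h.link.d_mem _ _ hw
      rwa [sub_add_cancel] at this
    have e4 : P₁.C (x.1 - (v - d w)) = 0 := by
      rw [map_sub, ← A_of_closed hDv, e, map_sub, A_d h, sub_zero, sub_self]
    have e5 := (h.HR₁ 0 le_rfl).1 _ (by rw [e4, zero_smul, add_zero])
    obtain ⟨y, hy, ey⟩ := hM.exists_extD h hv' hDv
    have h2 : x - y = 0 := by
      refine hM.extD_inj h (k := k) (by omega)
        (Submodule.sub_mem _ hx ((hM.ext h).mono (by omega) hy)) ?_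
      rw [map_sub, ey]
      exact e5
    rw [sub_eq_zero.1 h2]
    exact hy

lemma ext_HRat_low {t : ℝ} (ht : 0 < t) {k : ℤ} (hk : 2 * k ≤ P₁.n) :
    ((hM.ext h).pol t (hM.ext_inj h ht)).HRat (-δ) k := by
  intro u hu hq
  obtain ⟨φ, rfl⟩ := ((hM.ext h).pol t (hM.ext_inj h ht)).T.surjective u
  have h1 : φ ∈ (hM.ext h).F (P₁.n + 1 - k) := by
    have e : P₁.n + 1 - k = (hM.ext h).n - 1 - (k - 1) := by
      show _ = P₁.n + 1 - 1 - (k - 1)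
      ring
    rw [e, (hM.ext h).perp]
    intro v hv
    rw [(hM.ext h).symm]
    have := hq v hv
    rwa [Pol.q_T_left] at this
  have h2 := hM.ext_HR_low h ht hk h1 hu
  rw [Pol.q_T_left]
  exact ⟨h2.1, fun h0 => ⟨φ, h2.2 h0, rfl⟩⟩

lemma ext_middle_nonneg {k : ℤ} (hk : 2 * k = P₁.n + 1) {x : LinearMap.ker D × M}
    (hx : x ∈ (hM.ext h).F k) (hCx : (hM.ext h).C x ∈ (hM.ext h).F k) :
    0 ≤ -δ * sg k * (hM.ext h).B x x := by
  set W := hM.ext h with hW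
  have hn : W.n = 2 * k := hk.symm
  let S : Submodule ℝ (LinearMap.ker D × M) := W.F k ⊓ (W.F k).comap W.C
  have key := nonneg_of_pencil (V := S)
    ((-δ * sg k) • (W.B ∘ₗ W.C).domRestrict₁₂ S S) ((-δ * sg k) • W.B.domRestrict₁₂ S S)
    (fun u v => by
      show -δ * sg k * W.B (W.C u) v = -δ * sg k * W.B (W.C v) u
      rw [W.symm (W.C v), ← W.adj])
    (fun u v => by
      show -δ * sg k * W.B u v = -δ * sg k * W.B v u
      rw [W.symm])
    ((W.F (k - 1)).comap S.subtype)
    (fun u hu v => by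
      show -δ * sg k * W.B (W.C u) v = 0
      rw [W.adj, W.B_zero (i := k - 1) (j := k) (u := u.1) (by omega) hu v.2.2, mul_zero])
    (fun u hu v => by
      show -δ * sg k * W.B u v = 0
      rw [W.B_zero (i := k - 1) (j := k) (u := u.1) (by omega) hu v.2.1, mul_zero])
    (fun u => (hM.ext_C_nonneg h hk u.2.1 u.2.2).1)
    (fun u hu => by
      refine (hM.ext_C_nonneg h hk u.2.1 u.2.2).2 ?_
      refine (mul_eq_zero.1 hu).resolve_left fun h1 => ?_
      have h2 : (-δ * sg k) * (-δ * sg k) = (δ * δ) * (sg k * sg k) := by ring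
      rw [h1, h.sq, sg_mul_self] at h2
      norm_num at h2)
    (fun t ht u hu => by
      obtain ⟨p, hp⟩ := (W.pol t (hM.ext_inj h ht)).exists_proj (l := k - 1)
        (hM.ext_HRat_low h ht (by omega))
      have hrad : ∀ v ∈ W.F k, W.C v ∈ W.F k → W.B (W.C v + t • v) u = 0 := by
        intro v hv hCv
        have h1 : -δ * sg k * W.B (W.C u) v + t * (-δ * sg k * W.B u v) = 0 := hu ⟨v, hv, hCv⟩
        have h2 : (-δ * sg k) * (-δ * sg k) = (δ * δ) * (sg k * sg k) := by ring
        rw [h.sq, sg_mul_self, mul_one] at h2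
        rw [W.symm, map_add, map_smul, ← W.adj, smul_eq_mul]
        linear_combination (-δ * sg k) * h1 - (W.B (W.C u) v + t * W.B u v) * h2
      have e : k - 1 = W.n - 1 - k := by omega
      show (u : LinearMap.ker D × M) ∈ W.F (k - 1)
      rw [e, W.perp]
      intro f hf
      obtain ⟨hp1, hp2⟩ := hp f (W.mono (show k ≤ W.n - (k - 1) by omega) hf)
      obtain ⟨φ, hφ⟩ := (W.pol t (hM.ext_inj h ht)).T.surjective (f - p f)
      rw [← hφ] at hp2
      have hfp : W.C φ + t • φ = f - p f := hφ
      have hφk : φ ∈ W.F k := by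
        have e : k = W.n - 1 - (k - 1) := by omega
        rw [e, W.perp]
        intro v hv
        rw [W.symm]
        have := hp2 v hv
        rwa [Pol.q_T_left] at this
      have hp1' : p f ∈ W.F k := W.mono (show k - 1 ≤ k by omega) hp1
      have hCφ : W.C φ ∈ W.F k := by
        have : W.C φ = f - p f - t • φ := by rw [← hfp, add_sub_cancel_right]
        rw [this]
        exact Submodule.sub_mem _ (Submodule.sub_mem _ hf hp1') (Submodule.smul_mem _ _ hφk)
      have h3 := hrad φ hφk hCφ
      rw [hfp, map_sub W.B, LinearMap.sub_apply, W.B_zero (i := k - 1) (j := k) (by omega) hp1 u.2.1,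
        sub_zero] at h3
      exact h3)
    ⟨x, hx, hCx⟩
  exact key

lemma ext_HR {t : ℝ} (ht : 0 < t) : (hM.ext h).HR (-δ) t := by
  refine ⟨hM.ext_inj h ht, fun k hk0 hk x hx hTx => ?_⟩
  rcases le_or_gt (2 * k) P₁.n with hk1 | hk1
  · exact hM.ext_HR_low h ht hk1 hx hTx
  have hn : (hM.ext h).n = P₁.n + 1 := rfl
  have hk2 : 2 * k = P₁.n + 1 := by omega
  have e : (hM.ext h).n - k = k := by omega
  rw [e] at hx
  have hCx : (hM.ext h).C x ∈ (hM.ext h).F k :=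
    (Submodule.add_mem_iff_left _ (Submodule.smul_mem _ t hx)).1 hTx
  have h0 := hM.ext_middle_nonneg h hk2 hx hCx
  obtain ⟨h1, h2⟩ := hM.ext_C_nonneg h hk2 hx hCx
  have h3 : (hM.ext h).B x ((hM.ext h).C x + t • x) =
      (hM.ext h).B ((hM.ext h).C x) x + t * (hM.ext h).B x x := by
    rw [map_add, map_smul, smul_eq_mul, (hM.ext h).adj]
  have h4 := mul_nonneg ht.le h0
  rw [h3]
  refine ⟨by linarith, fun hz => h2 ?_⟩
  have h5 : -δ * sg k * (hM.ext h).B ((hM.ext h).C x) x = 0 := by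
    refine le_antisymm ?_ h1
    have : -δ * sg k * (hM.ext h).B ((hM.ext h).C x) x =
      -(t * (-δ * sg k * (hM.ext h).B x x)) := by linear_combination (-δ * sg k) * hz
    linarith
  have h6 : (-δ * sg k) * (-δ * sg k) = 1 := by
    linear_combination (δ * δ) * sg_mul_self k + h.sq
  linear_combination (-δ * sg k) * h5 - (hM.ext h).B ((hM.ext h).C x) x * h6

end Compl

end Seq4

end LeftKLS

namespace LeftKLS

namespace Op

variable {X Y : Type*} [AddCommGroup X] [Module ℝ X] [AddCommGroup Y] [Module ℝ Y]

/-- Transport of structure along a linear equivalence. -/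
noncomputable def map (P : Op X) (e : X ≃ₗ[ℝ] Y) : Op Y where
  B := P.B.compl₁₂ (e.symm : Y →ₗ[ℝ] X) (e.symm : Y →ₗ[ℝ] X)
  symm u v := P.symm _ _
  F k := (P.F k).comap (e.symm : Y →ₗ[ℝ] X)
  mono k l hkl x hx := P.mono hkl hx
  n := P.n
  perp k v := by
    refine (P.perp k (e.symm v)).trans ⟨fun h u hu => h _ hu, fun h u hu => ?_⟩
    have := h (e u) (by simpa using hu)
    simpa using this
  C := (e : X →ₗ[ℝ] Y) ∘ₗ P.C ∘ₗ (e.symm : Y →ₗ[ℝ] X)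
  adj u v := by simpa using P.adj _ _
  shift k u hu := by simpa using P.shift k _ hu
  neg k hk := by
    rw [P.neg k hk, Submodule.comap_bot]
    exact LinearEquiv.ker _

lemma HR.map {P : Op X} {δ t : ℝ} (h : P.HR δ t) (e : X ≃ₗ[ℝ] Y) : (P.map e).HR δ t := by
  have key : ∀ u, e.symm ((P.map e).C u + t • u) = P.C (e.symm u) + t • e.symm u := fun u => by
    simp [Op.map]
  refine ⟨fun u hu => ?_, fun k hk0 hk u hu hTu => ?_⟩
  · have := h.1 (e.symm u) (by rw [← key, hu, map_zero])
    simpa using this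
  · have h1 := h.2 k hk0 hk (e.symm u) hu (by rw [← key]; exact hTu)
    rw [← key] at h1
    exact h1

/-- A product of filtered spaces with the same top degree, with shifted operators. -/
noncomputable def pi {ι : Type*} [Fintype ι] {X : ι → Type*} [∀ i, AddCommGroup (X i)]
    [∀ i, Module ℝ (X i)] (P : ∀ i, Op (X i)) (c : ι → ℝ) (n : ℤ) (hn : ∀ i, (P i).n = n) :
    Op (∀ i, X i) where
  B := ∑ i, (P i).B.compl₁₂ (LinearMap.proj i) (LinearMap.proj i)
  symm u v := by
    simp only [LinearMap.sum_apply, LinearMap.compl₁₂_apply]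
    exact Finset.sum_congr rfl fun i _ => (P i).symm _ _
  F k := Submodule.pi Set.univ fun i => (P i).F k
  mono k l hkl x hx i hi := (P i).mono hkl (hx i hi)
  n := n
  perp k v := by
    classical
    simp only [Submodule.mem_pi, Set.mem_univ, true_imp_iff, LinearMap.sum_apply,
      LinearMap.compl₁₂_apply, LinearMap.proj_apply]
    constructor
    · intro h u hu
      exact Finset.sum_eq_zero fun i _ => (P i).B_zero (by rw [hn]; omega) (hu i) (h i)
    · intro h i
      rw [← hn i, (P i).perp]
      intro u hu
      have := h (Pi.single i u) (fun j => by
        by_cases hj : j = i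
        · subst hj; simpa using hu
        · rw [Pi.single_eq_of_ne hj]; exact Submodule.zero_mem _)
      rw [Finset.sum_eq_single i (fun j _ hj => by rw [Pi.single_eq_of_ne hj]; simp)
        (fun h => absurd (Finset.mem_univ i) h)] at this
      simpa using this
  C := LinearMap.pi fun i => ((P i).C + c i • LinearMap.id) ∘ₗ LinearMap.proj i
  adj u v := by
    simp only [LinearMap.sum_apply, LinearMap.compl₁₂_apply, LinearMap.proj_apply,
      LinearMap.pi_apply, LinearMap.comp_apply, LinearMap.add_apply, map_add,
      LinearMap.smul_apply, map_smul, (P _).adj, LinearMap.id_apply]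
  shift k u hu i hi := Submodule.add_mem _ ((P i).shift k _ (hu i hi))
    (Submodule.smul_mem _ _ ((P i).mono (by omega) (hu i hi)))
  neg k hk := by
    simp only [(P _).neg k hk]
    exact Submodule.pi_univ_bot

section pi

variable {ι : Type*} [Fintype ι] {X : ι → Type*} [∀ i, AddCommGroup (X i)]
    [∀ i, Module ℝ (X i)] {P : ∀ i, Op (X i)} {c : ι → ℝ} {n : ℤ} {hn : ∀ i, (P i).n = n}

lemma pi_B (u v : ∀ i, X i) : (pi P c n hn).B u v = ∑ i, (P i).B (u i) (v i) := by
  simp [pi]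

lemma pi_C (u : ∀ i, X i) (i : ι) : (pi P c n hn).C u i = (P i).C (u i) + c i • u i := rfl

lemma mem_pi {k : ℤ} {u : ∀ i, X i} : u ∈ (pi P c n hn).F k ↔ ∀ i, u i ∈ (P i).F k := by
  simp [pi]

lemma pi_HR {δ t : ℝ} (hδ : δ ≠ 0) (h : ∀ i, (P i).HR δ (t + c i)) : (pi P c n hn).HR δ t := by
  have key : ∀ u i, ((pi P c n hn).C u + t • u) i = (P i).C (u i) + (t + c i) • u i := by
    intro u i
    rw [Pi.add_apply, pi_C, Pi.smul_apply, add_smul]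
    abel
  refine ⟨fun u hu => funext fun i => (h i).1 _ ?_, fun k hk0 hk u hu hTu => ?_⟩
  · rw [← key, hu]; rfl
  · rw [mem_pi] at hTu hu
    have h1 : ∀ i, _ := fun i => (h i).2 k hk0 ((hn i).symm ▸ hk) (u i)
      (by rw [hn i]; exact hu i) (by rw [← key]; exact hTu i)
    have e : δ * sg k * (pi P c n hn).B u ((pi P c n hn).C u + t • u) =
        ∑ i, δ * sg k * (P i).B (u i) ((P i).C (u i) + (t + c i) • u i) := by
      rw [pi_B, Finset.mul_sum]
      exact Finset.sum_congr rfl fun i _ => by rw [key]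
    refine ⟨by rw [e]; exact Finset.sum_nonneg fun i _ => (h1 i).1, fun h0 => ?_⟩
    rw [h0, mul_zero, eq_comm, Finset.sum_eq_zero_iff_of_nonneg fun i _ => (h1 i).1] at e
    rw [mem_pi]
    intro i
    refine (h1 i).2 ((mul_eq_zero.1 (e i (Finset.mem_univ i))).resolve_left ?_)
    exact mul_ne_zero hδ fun hs => by simpa [hs] using sg_mul_self k

end pi

end Op

namespace Seq4

variable {X₁ X₂ X₃ X₄ : Type*} [AddCommGroup X₁] [Module ℝ X₁] [AddCommGroup X₂] [Module ℝ X₂]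
  [AddCommGroup X₃] [Module ℝ X₃] [AddCommGroup X₄] [Module ℝ X₄]
  {P₁ : Op X₁} {P₂ : Op X₂} {P₃ : Op X₃} {P₄ : Op X₄}
  {D : X₁ →ₗ[ℝ] X₂} {d : X₂ →ₗ[ℝ] X₁} {D' : X₂ →ₗ[ℝ] X₃} {d' : X₃ →ₗ[ℝ] X₂}
  {D'' : X₃ →ₗ[ℝ] X₄} {d'' : X₄ →ₗ[ℝ] X₃} {δ : ℝ}
  [FiniteDimensional ℝ X₁] [FiniteDimensional ℝ X₂] [FiniteDimensional ℝ X₃]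
  [FiniteDimensional ℝ X₄]

/-- A sequence of four terms extends to the left by one term. -/
theorem exists_ext (h : Seq4 P₁ P₂ P₃ P₄ D d D' d' D'' d'' δ) (hn : 0 ≤ P₁.n) :
    ∃ (N : ℕ) (P : Op (Fin N → ℝ)) (D₀ : (Fin N → ℝ) →ₗ[ℝ] X₁) (d₀ : X₁ →ₗ[ℝ] (Fin N → ℝ)),
      OLink P P₁ D₀ d₀ ∧ (∀ v, D₀ (d₀ v) + d (D v) = P₁.C v) ∧ (∀ x, D (D₀ x) = 0) ∧
      (∀ x, P.C x = d₀ (D₀ x)) ∧ (∀ t, 0 < t → P.HR (-δ) t) ∧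
      (∀ k, ∀ u ∈ P₁.F k, D u = 0 → ∃ x ∈ P.F k, D₀ x = u) ∧
      (∀ k, 2 * k ≤ P.n → ∀ x ∈ P.F k, D₀ x = 0 → x = 0) := by
  obtain ⟨m, M, hM⟩ := h.exists_compl hn
  let e := (Module.finBasis ℝ (LinearMap.ker D × M)).equivFun
  have link := hM.link h
  refine ⟨_, (hM.ext h).map e, extD D M ∘ₗ (e.symm : _ →ₗ[ℝ] _), (e : _ →ₗ[ℝ] _) ∘ₗ h.extd M,
    ⟨link.deg, fun k u hu => link.D_mem _ _ hu, fun k u hu => ?_, fun u v => ?_, fun u => ?_,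
      fun u => ?_⟩, fun v => ?_, fun x => D_extD _, fun x => rfl, fun t ht => (hM.ext_HR h ht).map e,
    fun k u hu hDu => ?_, fun k hk x hx hx0 => ?_⟩
  · have := link.d_mem _ _ hu
    simpa [Op.map] using this
  · have := link.adj u (e.symm v)
    simpa [Op.map] using this
  · have := link.D_C (e.symm u)
    simpa [Op.map] using this
  · have := link.d_C u
    simp only [Op.map, LinearMap.comp_apply, LinearEquiv.coe_coe, LinearEquiv.symm_apply_apply,
      this]
  · have := extD_extd (M := M) h v
    simpa using this
  · obtain ⟨x, hx, e'⟩ := hM.exists_extD h hu hDu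
    exact ⟨e x, by simpa [Op.map] using hx, by simpa using e'⟩
  · have := hM.extD_inj h (k := k) hk (x := e.symm x) hx hx0
    simpa using this

end Seq4

end LeftKLS

namespace LeftKLS

/-- A bounded-below finite poset with rank function `rk` and weights `c` having the local structure
of a geometric lattice. -/
structure Geo {Q : Type*} [PartialOrder Q] [OrderBot Q] (rk : Q → ℤ) (c : Q → ℝ) : Prop where
  rk_bot : rk ⊥ = 0
  rk_covBy : ∀ v w : Q, v ⋖ w → rk w = rk v + 1
  c_lt : ∀ v w : Q, v < w → c v < c w
  c_sum : ∀ w z : Q, w ≤ z → ∀ s : Finset Q, (∀ u, u ∈ s ↔ w ⋖ u ∧ u ≤ z) →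
    ∑ u ∈ s, (c u - c w) = c z - c w
  diamond : ∀ v w w' z : Q, v ⋖ w → v ⋖ w' → w ≠ w' → w ≤ z → w' ≤ z →
    ∃ u, u ≤ z ∧ w ⋖ u ∧ w' ⋖ u
  unique : ∀ w w' u t : Q, w ≠ w' → w ⋖ u → w' ⋖ u → w ⋖ t → w' ⋖ t → u = t

/-- A filtered space with operator together with maps to and from other spaces. -/
structure Datum (Q : Type*) where
  n : ℕ
  P : Op (Fin n → ℝ)
  up : Q → (m : ℕ) → (Fin m → ℝ) →ₗ[ℝ] (Fin n → ℝ)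
  dn : Q → (m : ℕ) → (Fin n → ℝ) →ₗ[ℝ] (Fin m → ℝ)

section

variable {Q : Type*} [PartialOrder Q] [OrderBot Q] [Fintype Q]

open Classical in
/-- The map between the spaces attached to `v` and `w`, which is zero unless `w` covers `v`. -/
noncomputable def Datum.U (a b : Datum Q) (v w : Q) : (Fin a.n → ℝ) →ₗ[ℝ] (Fin b.n → ℝ) :=
  if v ⋖ w then b.up v a.n else 0

open Classical in
/-- The map between the spaces attached to `w` and `v`, which is zero unless `w` covers `v`. -/
noncomputable def Datum.D (a b : Datum Q) (v w : Q) : (Fin b.n → ℝ) →ₗ[ℝ] (Fin a.n → ℝ) :=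
  if v ⋖ w then b.dn v a.n else 0

/-- The elements of rank `i` below `z`. -/
abbrev Lev (rk : Q → ℤ) (z : Q) (i : ℤ) : Type _ := {w : Q // w ≤ z ∧ rk w + i = rk z}

open Classical in
/-- The inductive properties of the datum attached to `z`. -/
structure Inv (rk : Q → ℤ) (c : Q → ℝ) (z : Q) (f : ∀ w, w < z → Datum Q) (a : Datum Q) :
    Prop where
  deg : a.P.n = rk z
  dim_bot : z = ⊥ → a.n = 1
  D_mem : ∀ w (h : w < z), ∀ k, ∀ u ∈ a.P.F k, (f w h).D a w z u ∈ (f w h).P.F k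
  U_mem : ∀ w (h : w < z), ∀ k, ∀ u ∈ (f w h).P.F k, (f w h).U a w z u ∈ a.P.F (k + 1)
  adj : ∀ w (h : w < z), ∀ u v, a.P.B ((f w h).U a w z u) v = (f w h).P.B u ((f w h).D a w z v)
  D_C : ∀ w (h : w < z), ∀ u, (f w h).D a w z (a.P.C u) =
    (f w h).P.C ((f w h).D a w z u) + (c z - c w) • (f w h).D a w z u
  U_C : ∀ w (h : w < z), ∀ u, (f w h).U a w z ((f w h).P.C u + (c z - c w) • u) =
    a.P.C ((f w h).U a w z u)
  D_U_self : ∀ w (h : w < z), w ⋖ z → ∀ u,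
    (f w h).D a w z ((f w h).U a w z u) = (c z - c w) • u
  D_U : ∀ w (h : w < z) w' (h' : w' < z), w ⋖ z → w' ⋖ z → w ≠ w' → ∀ u,
    (f w' h').D a w' z ((f w h).U a w z u) + ∑ y : {y : Q // y < z},
      (f y y.2).U (f w' h') y w' ((f y y.2).D (f w h) y w u) = 0
  DD : ∀ v (h : v < z) u, ∑ w : {w : Q // w < z},
      (f v h).D (f w w.2) v w ((f w w.2).D a w z u) = 0
  C_eq : ∀ u, a.P.C u = ∑ w : {w : Q // w < z}, (f w w.2).U a w z ((f w w.2).D a w z u)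
  HR : ∀ t, 0 < t → a.P.HR (sg (rk z)) t
  ex : ∀ k, ∀ u : (∀ w : {w : Q // w < z}, Fin (f w w.2).n → ℝ), (∀ w : {w : Q // w < z}, u w ∈ (f w w.2).P.F k) →
    (∀ w : {w : Q // w < z}, ¬ w.1 ⋖ z → u w = 0) →
    (∀ v (h : v < z), ∑ w : {w : Q // w < z}, (f v h).D (f w w.2) v w (u w) = 0) →
    ∃ x ∈ a.P.F k, ∀ w : {w : Q // w < z}, (f w w.2).D a w z x = u w
  inj : z ≠ ⊥ → ∀ k, 2 * k ≤ rk z → ∀ x ∈ a.P.F k,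
    (∀ w (h : w < z), (f w h).D a w z x = 0) → x = 0

lemma sum_subtype_congr {α M : Type*} [AddCommMonoid M] [Fintype α] {p q : α → Prop}
    [Fintype {a // p a}] [Fintype {a // q a}]
    (g : α → M) (h : ∀ a, g a ≠ 0 → (p a ↔ q a)) : ∑ a : {a // p a}, g a = ∑ a : {a // q a}, g a := by
  classical
  rw [← Finset.sum_subtype (Finset.univ.filter p) (by simp) g,
    ← Finset.sum_subtype (Finset.univ.filter q) (by simp) g, Finset.sum_filter, Finset.sum_filter]
  refine Finset.sum_congr rfl fun a _ => ?_
  by_cases ha : g a = 0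
  · simp [ha]
  · simp [h a ha]

omit [OrderBot Q] in
lemma exists_rec {α : Type*} [Nonempty α] (R : ∀ z : Q, (∀ w, w < z → α) → α → Prop)
    (step : ∀ (f : Q → α) z, (∀ w < z, R w (fun v _ => f v) (f w)) → ∃ a, R z (fun w _ => f w) a) :
    ∃ f : Q → α, ∀ z, R z (fun w _ => f w) (f z) := by
  classical
  have wf : WellFounded (fun a b : Q => a < b) := wellFounded_lt
  let G : ∀ z : Q, (∀ w, w < z → α) → α := fun z F =>
    if h : ∃ a, R z F a then h.choose else Classical.arbitrary α
  let f : Q → α := wf.fix G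
  have hf : ∀ z, f z = G z (fun w _ => f w) := fun z => wf.fix_eq G z
  refine ⟨f, fun z => ?_⟩
  induction z using wf.induction with
  | _ z ih =>
    have h := step f z ih
    have e : f z = h.choose := by
      rw [hf]
      exact dif_pos h
    rw [e]
    exact h.choose_spec

namespace Geo

variable {rk : Q → ℤ} {c : Q → ℝ} (hG : Geo rk c)
include hG

lemma rk_lt {v w : Q} (h : v < w) : rk v < rk w := by
  induction w using WellFoundedLT.induction with
  | _ w ih =>
    obtain ⟨u, hu, huw⟩ := exists_le_covBy_of_lt h
    have := hG.rk_covBy u w huw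
    rcases hu.eq_or_lt with rfl | hu
    · omega
    · have := ih u huw.lt hu
      omega

lemma rk_mono {v w : Q} (h : v ≤ w) : rk v ≤ rk w := by
  rcases h.eq_or_lt with rfl | h
  · rfl
  · exact (hG.rk_lt h).le

lemma covBy_of_rk {v w : Q} (h : v ≤ w) (hr : rk v + 1 = rk w) : v ⋖ w := by
  refine ⟨h.lt_of_ne (by rintro rfl; omega), fun u h1 h2 => ?_⟩
  have := hG.rk_lt h1
  have := hG.rk_lt h2
  omega

end Geo

end

end LeftKLS

namespace LeftKLS

open Classical in
/-- The datum attached to the bottom element. -/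
noncomputable def baseOp : Op (Fin 1 → ℝ) where
  B := (LinearMap.mul ℝ ℝ).compl₁₂ (LinearMap.proj 0) (LinearMap.proj 0)
  symm u v := mul_comm _ _
  F k := if 0 ≤ k then ⊤ else ⊥
  mono k l hkl := by
    by_cases hk : 0 ≤ k
    · simp [hk.trans hkl]
    · simp [hk]
  n := 0
  perp k v := by
    by_cases hk : 0 ≤ k
    · have h1 : ¬ 0 ≤ 0 - 1 - k := by omega
      simp only [hk, h1, if_true, if_false, Submodule.mem_bot, Submodule.mem_top, true_imp_iff]
      refine ⟨fun hv u => by simp [hv], fun h => ?_⟩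
      have := h 1
      ext i
      rw [Subsingleton.elim i 0]
      simpa using this
    · have h1 : 0 ≤ 0 - 1 - k := by omega
      simp only [hk, h1, if_true, if_false, Submodule.mem_bot, Submodule.mem_top, true_iff]
      rintro u rfl
      simp
  C := 0
  adj u v := by simp
  shift k u hu := Submodule.zero_mem _
  neg k hk := by simp [hk]

lemma baseOp_HR {t : ℝ} (ht : 0 < t) : baseOp.HR 1 t := by
  have hC : ∀ u, baseOp.C u = 0 := fun u => rfl
  refine ⟨fun u hu => ?_, fun k hk0 hk u hu hTu => ?_⟩
  · rw [hC, zero_add] at hu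
    exact (smul_eq_zero.1 hu).resolve_left ht.ne'
  · have hk1 : k = 0 := by
      have : 2 * k ≤ 0 := hk
      omega
    subst hk1
    have e : baseOp.B u (baseOp.C u + t • u) = t * (u 0 * u 0) := by
      rw [hC, zero_add, map_smul]; rfl
    rw [e, sg_zero, mul_one, one_mul]
    refine ⟨mul_nonneg ht.le (mul_self_nonneg _), fun h => ?_⟩
    have h1 : u 0 = 0 := mul_self_eq_zero.1 ((mul_eq_zero.1 h).resolve_left ht.ne')
    have h2 : u = 0 := by
      ext i
      rw [Subsingleton.elim i 0, h1]; rfl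
    rw [h2]
    exact Submodule.zero_mem _

variable {Q : Type*} [PartialOrder Q] [OrderBot Q] [Fintype Q] {rk : Q → ℤ} {c : Q → ℝ}

lemma exists_inv_bot (hG : Geo rk c) (f : ∀ w, w < (⊥ : Q) → Datum Q) :
    ∃ a, Inv rk c ⊥ f a := by
  have hE : IsEmpty {w : Q // w < ⊥} := ⟨fun w => not_lt_bot w.2⟩
  refine ⟨⟨1, baseOp, fun _ _ => 0, fun _ _ => 0⟩, ?_⟩
  refine ⟨hG.rk_bot.symm, fun _ => rfl, fun w h => absurd h not_lt_bot, fun w h => absurd h not_lt_bot,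
    fun w h => absurd h not_lt_bot, fun w h => absurd h not_lt_bot,
    fun w h => absurd h not_lt_bot, fun w h => absurd h not_lt_bot,
    fun w h => absurd h not_lt_bot, fun w h => absurd h not_lt_bot, fun u => ?_,
    fun t ht => ?_, fun k u _ _ _ => ⟨0, Submodule.zero_mem _, fun w => isEmptyElim w⟩,
    fun h => absurd rfl h⟩
  · exact (Finset.sum_of_isEmpty _).symm
  · rw [hG.rk_bot, sg_zero]
    exact baseOp_HR ht

/-- The inductive properties hold at `w`. -/
def Good (rk : Q → ℤ) (c : Q → ℝ) (f : Q → Datum Q) (w : Q) : Prop :=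
  Inv rk c w (fun v _ => f v) (f w)

omit [OrderBot Q] [Fintype Q] in
lemma Datum.D_of_not {a b : Datum Q} {v w : Q} (h : ¬ v ⋖ w) (u) : a.D b v w u = 0 := by
  rw [Datum.D, if_neg h, LinearMap.zero_apply]

omit [OrderBot Q] [Fintype Q] in
lemma Datum.U_of_not {a b : Datum Q} {v w : Q} (h : ¬ v ⋖ w) (u) : a.U b v w u = 0 := by
  rw [Datum.U, if_neg h, LinearMap.zero_apply]

namespace Good

variable {f : Q → Datum Q} {w : Q} (h : Good rk c f w)
include h

lemma D_mem (v : Q) {k : ℤ} {u} (hu : u ∈ (f w).P.F k) : (f v).D (f w) v w u ∈ (f v).P.F k := by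
  by_cases hv : v ⋖ w
  · exact Inv.D_mem h v hv.lt k u hu
  · rw [Datum.D_of_not hv]; exact Submodule.zero_mem _

lemma U_mem (v : Q) {k : ℤ} {u} (hu : u ∈ (f v).P.F k) :
    (f v).U (f w) v w u ∈ (f w).P.F (k + 1) := by
  by_cases hv : v ⋖ w
  · exact Inv.U_mem h v hv.lt k u hu
  · rw [Datum.U_of_not hv]; exact Submodule.zero_mem _

lemma adj (v : Q) (u x) :
    (f w).P.B ((f v).U (f w) v w u) x = (f v).P.B u ((f v).D (f w) v w x) := by
  by_cases hv : v ⋖ w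
  · exact Inv.adj h v hv.lt u x
  · rw [Datum.U_of_not hv, Datum.D_of_not hv, map_zero, map_zero, LinearMap.zero_apply]

lemma D_C (v : Q) (u) : (f v).D (f w) v w ((f w).P.C u) =
    (f v).P.C ((f v).D (f w) v w u) + (c w - c v) • (f v).D (f w) v w u := by
  by_cases hv : v ⋖ w
  · exact Inv.D_C h v hv.lt u
  · rw [Datum.D_of_not hv, Datum.D_of_not hv, map_zero, smul_zero, add_zero]

lemma U_C (v : Q) (u) : (f v).U (f w) v w ((f v).P.C u + (c w - c v) • u) =
    (f w).P.C ((f v).U (f w) v w u) := by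
  by_cases hv : v ⋖ w
  · exact Inv.U_C h v hv.lt u
  · rw [Datum.U_of_not hv, Datum.U_of_not hv, map_zero]

lemma D_U_self (v : Q) (hv : v ⋖ w) (u) :
    (f v).D (f w) v w ((f v).U (f w) v w u) = (c w - c v) • u :=
  Inv.D_U_self h v hv.lt hv u

lemma DD (v : Q) (u) (p : Q → Prop) [Fintype {x // p x}] (hp : ∀ x, v ⋖ x → x ⋖ w → p x) :
    ∑ x : {x : Q // p x}, (f v).D (f x) v x ((f x).D (f w) x w u) = 0 := by
  classical
  rw [sum_subtype_congr (q := fun x => x < w)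
    (fun x => (f v).D (f x) v x ((f x).D (f w) x w u))]
  · by_cases hv : v < w
    · exact Inv.DD h v hv u
    · refine Finset.sum_eq_zero fun x _ => Datum.D_of_not (fun hx => hv (hx.lt.trans x.2)) _
  · intro x hx
    have h1 : v ⋖ x := by
      by_contra h1
      exact hx (Datum.D_of_not h1 _)
    have h2 : x ⋖ w := by
      by_contra h2
      exact hx (by rw [Datum.D_of_not h2, map_zero])
    exact iff_of_true (hp x h1 h2) h2.lt

lemma C_eq (u) (p : Q → Prop) [Fintype {x // p x}] (hp : ∀ x, x ⋖ w → p x) :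
    ∑ x : {x : Q // p x}, (f x).U (f w) x w ((f x).D (f w) x w u) = (f w).P.C u := by
  classical
  rw [sum_subtype_congr (q := fun x => x < w)
    (fun x => (f x).U (f w) x w ((f x).D (f w) x w u))]
  · exact (Inv.C_eq h u).symm
  · intro x hx
    have h1 : x ⋖ w := by
      by_contra h1
      exact hx (Datum.U_of_not h1 _)
    exact iff_of_true (hp x h1) h1.lt

lemma D_U {v v' : Q} (hv : v ⋖ w) (hv' : v' ⋖ w) (hne : v ≠ v') (u) (p : Q → Prop) [Fintype {x // p x}]
    (hp : ∀ x, x ⋖ v → x ⋖ v' → p x) :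
    (f v').D (f w) v' w ((f v).U (f w) v w u) +
      ∑ x : {x : Q // p x}, (f x).U (f v') x v' ((f x).D (f v) x v u) = 0 := by
  classical
  rw [sum_subtype_congr (q := fun x => x < w)
    (fun x => (f x).U (f v') x v' ((f x).D (f v) x v u))]
  · exact Inv.D_U h v hv.lt v' hv'.lt hv hv' hne u
  · intro x hx
    have h1 : x ⋖ v' := by
      by_contra h1
      exact hx (Datum.U_of_not h1 _)
    have h2 : x ⋖ v := by
      by_contra h2
      exact hx (by rw [Datum.D_of_not h2, map_zero])
    exact iff_of_true (hp x h2 h1) (h1.lt.trans hv'.lt)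

end Good

end LeftKLS

namespace LeftKLS

variable {Q : Type*} [PartialOrder Q] [OrderBot Q] [Fintype Q] {rk : Q → ℤ} {c : Q → ℝ}

/-- The product of the spaces attached to the elements of rank `rk z - i` below `z`. -/
abbrev LevSpace (rk : Q → ℤ) (f : Q → Datum Q) (z : Q) (i : ℤ) : Type _ :=
  ∀ w : Lev rk z i, Fin (f w).n → ℝ

open Classical in
/-- The downward map between levels. -/
noncomputable def levD (rk : Q → ℤ) (f : Q → Datum Q) (z : Q) (i j : ℤ) :
    LevSpace rk f z i →ₗ[ℝ] LevSpace rk f z j :=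
  LinearMap.pi fun v => ∑ w : Lev rk z i, (f v).D (f w) v w ∘ₗ LinearMap.proj w

open Classical in
/-- The upward map between levels. -/
noncomputable def levU (rk : Q → ℤ) (f : Q → Datum Q) (z : Q) (j i : ℤ) :
    LevSpace rk f z j →ₗ[ℝ] LevSpace rk f z i :=
  LinearMap.pi fun w => ∑ v : Lev rk z j, (f v).U (f w) v w ∘ₗ LinearMap.proj v

open Classical in
/-- The filtered space attached to a level. -/
noncomputable def levOp (rk : Q → ℤ) (c : Q → ℝ) (f : Q → Datum Q) (z : Q) (i : ℤ)
    (hn : ∀ w : Lev rk z i, (f w).P.n = rk z - i) : Op (LevSpace rk f z i) :=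
  Op.pi (fun w : Lev rk z i => (f w).P) (fun w => c z - c w) (rk z - i) hn

variable {f : Q → Datum Q} {z : Q} {i j : ℤ}

open Classical in
lemma levD_apply (u : LevSpace rk f z i) (v : Lev rk z j) :
    levD rk f z i j u v = ∑ w : Lev rk z i, (f v).D (f w) v w (u w) := by
  simp [levD]

open Classical in
lemma levU_apply (u : LevSpace rk f z j) (w : Lev rk z i) :
    levU rk f z j i u w = ∑ v : Lev rk z j, (f v).U (f w) v w (u v) := by
  simp [levU]

lemma Lev.lt (hi : 1 ≤ i) (w : Lev rk z i) : w.1 < z :=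
  lt_of_le_of_ne w.2.1 fun h => by
    have := w.2.2
    rw [h] at this
    omega

variable (hG : Geo rk c) (hf : ∀ w < z, Good rk c f w)

section

include hf

lemma Lev.deg (hi : 1 ≤ i) (w : Lev rk z i) : (f w).P.n = rk z - i := by
  have h1 := (hf w (w.lt hi)).deg
  have h2 := w.2.2
  omega

open Classical in
lemma lev_olink (hi : 1 ≤ i) :
    OLink (levOp rk c f z i (Lev.deg hf hi)) (levOp rk c f z (i + 1) (Lev.deg hf (by omega)))
      (levD rk f z i (i + 1)) (levU rk f z (i + 1) i) where
  deg := by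
    change rk z - i = rk z - (i + 1) + 1
    ring
  D_mem k u hu := by
    rw [levOp, Op.mem_pi] at hu ⊢
    intro v
    rw [levD_apply]
    exact Submodule.sum_mem _ fun (w : Lev rk z i) _ => (hf w (w.lt hi)).D_mem v (hu w)
  d_mem k u hu := by
    rw [levOp, Op.mem_pi] at hu ⊢
    intro w
    rw [levU_apply]
    exact Submodule.sum_mem _ fun v _ => (hf w (w.lt hi)).U_mem v (hu v)
  adj u x := by
    rw [levOp, levOp, Op.pi_B, Op.pi_B]
    simp only [levU_apply, levD_apply, map_sum, LinearMap.sum_apply]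
    rw [Finset.sum_comm]
    exact Finset.sum_congr rfl fun v _ => Finset.sum_congr rfl fun w _ =>
      (hf w (w.lt hi)).adj v _ _
  D_C u := by
    funext v
    rw [levOp, levOp, Op.pi_C, levD_apply, levD_apply, map_sum, Finset.smul_sum,
      ← Finset.sum_add_distrib]
    refine Finset.sum_congr rfl fun w _ => ?_
    rw [Op.pi_C, map_add, map_smul, (hf w (w.lt hi)).D_C, add_assoc, ← add_smul]
    congr 2
    ring
  d_C u := by
    funext w
    rw [levOp, levOp, Op.pi_C, levU_apply, levU_apply, map_sum, Finset.smul_sum,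
      ← Finset.sum_add_distrib]
    refine Finset.sum_congr rfl fun v _ => ?_
    rw [Op.pi_C, ← (hf w (w.lt hi)).U_C, ← map_smul, ← map_add, add_assoc, ← add_smul]
    congr 3
    ring

end

include hG hf

omit hf in
open Classical in
lemma levD_levD (hf : ∀ w : Lev rk z i, Good rk c f w) (u : LevSpace rk f z i) :
    levD rk f z (i + 1) (i + 1 + 1) (levD rk f z i (i + 1) u) = 0 := by
  funext v
  simp only [levD_apply, map_sum]
  rw [Finset.sum_comm]
  refine Finset.sum_eq_zero fun (w : Lev rk z i) _ => (hf w).DD v (u w)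
    (fun x => x ≤ z ∧ rk x + (i + 1) = rk z) fun x _ hx => ⟨hx.le.trans w.2.1, ?_⟩
  have h1 := hG.rk_covBy _ _ hx
  have h2 := w.2.2
  omega

open Classical in
omit hf in
lemma sum_cover (v : Lev rk z (i + 1)) :
    ∑ w : Lev rk z i, (if v.1 ⋖ w.1 then c w - c v else 0) = c z - c v := by
  rw [← hG.c_sum v z v.2.1 (Finset.univ.filter fun u => v.1 ⋖ u ∧ u ≤ z) (by simp),
    Finset.sum_filter, ← Finset.sum_subtype (Finset.univ.filter fun u => u ≤ z ∧ rk u + i = rk z)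
    (by simp) (fun w => if v.1 ⋖ w then c w - c v else 0), Finset.sum_filter]
  refine Finset.sum_congr rfl fun w _ => ?_
  by_cases h : v.1 ⋖ w
  · have h1 := hG.rk_covBy _ _ h
    have h2 := v.2.2
    have h3 : rk w + i = rk z := by omega
    simp [h, h3]
  · simp [h]

open Classical in
lemma lev_rel_diag (hi : 1 ≤ i) (v : Lev rk z (i + 1)) (u) :
    ∑ w : Lev rk z i, (f v).D (f w) v w ((f v).U (f w) v w u) +
      ∑ y : Lev rk z (i + 1 + 1), (f y).U (f v) y v ((f y).D (f v) y v u) =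
    (f v).P.C u + (c z - c v) • u := by
  rw [(hf v (v.lt (by omega))).C_eq u (fun y => y ≤ z ∧ rk y + (i + 1 + 1) = rk z), add_comm _ ((f v).P.C u),
    ← sum_cover hG v, Finset.sum_smul]
  · congr 1
    refine Finset.sum_congr rfl fun w _ => ?_
    by_cases h : v.1 ⋖ w
    · rw [if_pos h, (hf w (w.lt hi)).D_U_self v h]
    · rw [if_neg h, Datum.D_of_not h, zero_smul]
  · intro y hy
    have h1 := hG.rk_covBy _ _ hy
    have h2 := v.2.2
    exact ⟨hy.le.trans v.2.1, by omega⟩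

open Classical in
lemma lev_rel_off (hi : 1 ≤ i) (v v' : Lev rk z (i + 1)) (hne : v ≠ v') (u) :
    ∑ w : Lev rk z i, (f v').D (f w) v' w ((f v).U (f w) v w u) +
      ∑ y : Lev rk z (i + 1 + 1), (f y).U (f v') y v' ((f y).D (f v) y v u) = 0 := by
  have hne' : v.1 ≠ v'.1 := fun h => hne (Subtype.ext h)
  have hlev : ∀ w, w ≤ z → v.1 ⋖ w → w ≤ z ∧ rk w + i = rk z := fun w hw h => by
    have h1 := hG.rk_covBy _ _ h
    have h2 := v.2.2
    exact ⟨hw, by omega⟩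
  by_cases hex : ∃ w : Lev rk z i, v.1 ⋖ w ∧ v'.1 ⋖ w
  · obtain ⟨w, hw, hw'⟩ := hex
    rw [Finset.sum_eq_single w, (hf w (w.lt hi)).D_U hw hw' hne' u
      (fun y => y ≤ z ∧ rk y + (i + 1 + 1) = rk z)]
    · intro y hy _
      have h1 := hG.rk_covBy _ _ hy
      have h2 := v.2.2
      exact ⟨hy.le.trans v.2.1, by omega⟩
    · intro x _ hx
      by_cases h : v.1 ⋖ x.1
      · by_cases h' : v'.1 ⋖ x.1
        · exact absurd (Subtype.ext (hG.unique _ _ _ _ hne' h h' hw hw')) hx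
        · exact Datum.D_of_not h' _
      · rw [Datum.U_of_not h, map_zero]
    · exact fun h => absurd (Finset.mem_univ _) h
  · rw [Finset.sum_eq_zero, Finset.sum_eq_zero, add_zero]
    · intro y _
      by_cases h : y.1 ⋖ v
      · by_cases h' : y.1 ⋖ v'
        · obtain ⟨x, hx, hvx, hvx'⟩ := hG.diamond _ _ _ z h h' hne' v.2.1 v'.2.1
          exact absurd ⟨⟨x, hlev x hx hvx⟩, hvx, hvx'⟩ hex
        · exact Datum.U_of_not h' _
      · rw [Datum.D_of_not h, map_zero]
    · intro x _
      by_cases h : v.1 ⋖ x.1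
      · by_cases h' : v'.1 ⋖ x.1
        · exact absurd ⟨x, h, h'⟩ hex
        · exact Datum.D_of_not h' _
      · rw [Datum.U_of_not h, map_zero]

lemma lev_rel (hi : 1 ≤ i) (u : LevSpace rk f z (i + 1)) :
    levD rk f z i (i + 1) (levU rk f z (i + 1) i u) +
      levU rk f z (i + 1 + 1) (i + 1) (levD rk f z (i + 1) (i + 1 + 1) u) =
    (levOp rk c f z (i + 1) (Lev.deg hf (by omega))).C u := by
  classical
  funext v'
  rw [levOp, Op.pi_C, Pi.add_apply]
  simp only [levD_apply, levU_apply, map_sum]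
  rw [Finset.sum_comm, Finset.sum_comm (s := (Finset.univ : Finset (Lev rk z (i + 1 + 1)))),
    ← Finset.sum_add_distrib, Finset.sum_eq_single v']
  · exact lev_rel_diag hG hf hi v' (u v')
  · exact fun v _ hv => lev_rel_off hG hf hi v v' hv (u v)
  · exact fun h => absurd (Finset.mem_univ _) h

lemma lev_HR (hi : 1 ≤ i) {t : ℝ} (ht : 0 ≤ t) :
    (levOp rk c f z i (Lev.deg hf hi)).HR (sg (rk z - i)) t := by
  classical
  refine Op.pi_HR (fun hs => by simpa [hs] using sg_mul_self (rk z - i)) fun w => ?_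
  have h1 := (hf w (w.lt hi)).HR (t + (c z - c w)) (by
    have := hG.c_lt _ _ (w.lt hi)
    linarith)
  have h2 : rk w.1 = rk z - i := by
    have := w.2.2
    omega
  rwa [h2] at h1

/-- Four consecutive levels. -/
theorem lev_seq4 (hi : 1 ≤ i) :
    Seq4 (levOp rk c f z i (Lev.deg hf hi)) (levOp rk c f z (i + 1) (Lev.deg hf (by omega)))
      (levOp rk c f z (i + 1 + 1) (Lev.deg hf (by omega)))
      (levOp rk c f z (i + 1 + 1 + 1) (Lev.deg hf (by omega)))
      (levD rk f z i (i + 1)) (levU rk f z (i + 1) i)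
      (levD rk f z (i + 1) (i + 1 + 1)) (levU rk f z (i + 1 + 1) (i + 1))
      (levD rk f z (i + 1 + 1) (i + 1 + 1 + 1)) (levU rk f z (i + 1 + 1 + 1) (i + 1 + 1))
      (sg (rk z - i)) := by
  have e1 : -sg (rk z - i) = sg (rk z - (i + 1)) := by
    rw [← sg_sub_one]; congr 1; ring
  have e2 : sg (rk z - i) = sg (rk z - (i + 1 + 1)) := by
    rw [← neg_neg (sg (rk z - i)), e1, ← sg_sub_one]; congr 1; ring
  have e3 : -sg (rk z - i) = sg (rk z - (i + 1 + 1 + 1)) := by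
    rw [e2, ← sg_sub_one]; congr 1; ring
  refine ⟨lev_olink hf hi, lev_olink hf (by omega), lev_olink hf (by omega),
    levD_levD hG fun w => hf w (w.lt hi), levD_levD hG fun w => hf w (w.lt (by omega)), sg_mul_self _, fun t ht => lev_HR hG hf hi ht,
    fun t ht => ?_, fun t ht => ?_, fun t ht => ?_, lev_rel hG hf hi, lev_rel hG hf (by omega)⟩
  · rw [e1]; exact lev_HR hG hf (by omega) ht
  · rw [e2]; exact lev_HR hG hf (by omega) ht
  · rw [e3]; exact lev_HR hG hf (by omega) ht

end LeftKLS

namespace LeftKLS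

variable {Q : Type*} [PartialOrder Q] [OrderBot Q] [Fintype Q] {rk : Q → ℤ} {c : Q → ℝ}
  {f : Q → Datum Q} {z : Q}

open Classical in
/-- The datum obtained from maps to and from the first level. -/
noncomputable def extDatum (rk : Q → ℤ) (f : Q → Datum Q) (z : Q) {N : ℕ} (P : Op (Fin N → ℝ))
    (D₀ : (Fin N → ℝ) →ₗ[ℝ] LevSpace rk f z 1) (d₀ : LevSpace rk f z 1 →ₗ[ℝ] (Fin N → ℝ)) :
    Datum Q where
  n := N
  P := P
  up v m := if h : (v ≤ z ∧ rk v + 1 = rk z) ∧ (f v).n = m then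
    d₀ ∘ₗ LinearMap.single ℝ (fun w : Lev rk z 1 => Fin (f w).n → ℝ) ⟨v, h.1⟩ ∘ₗ
      LinearMap.funLeft ℝ ℝ (Fin.cast h.2) else 0
  dn v m := if h : (v ≤ z ∧ rk v + 1 = rk z) ∧ (f v).n = m then
    LinearMap.funLeft ℝ ℝ (Fin.cast h.2.symm) ∘ₗ
      LinearMap.proj (φ := fun w : Lev rk z 1 => Fin (f w).n → ℝ) ⟨v, h.1⟩ ∘ₗ D₀ else 0

section

variable {N : ℕ} {P : Op (Fin N → ℝ)} {D₀ : (Fin N → ℝ) →ₗ[ℝ] LevSpace rk f z 1}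
  {d₀ : LevSpace rk f z 1 →ₗ[ℝ] (Fin N → ℝ)}

open Classical in
lemma extDatum_U (v : Q) (hv : v ⋖ z) (h : v ≤ z ∧ rk v + 1 = rk z) (u : Fin (f v).n → ℝ) :
    (f v).U (extDatum rk f z P D₀ d₀) v z u =
      d₀ (Pi.single (M := fun w : Lev rk z 1 => Fin (f w).n → ℝ) ⟨v, h⟩ u) := by
  rw [Datum.U, if_pos hv]
  simp only [extDatum]
  rw [dif_pos ⟨h, trivial⟩]
  rfl

lemma extDatum_D (v : Q) (hv : v ⋖ z) (h : v ≤ z ∧ rk v + 1 = rk z)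
    (x : Fin (extDatum rk f z P D₀ d₀).n → ℝ) :
    (f v).D (extDatum rk f z P D₀ d₀) v z x = D₀ x ⟨v, h⟩ := by
  rw [Datum.D, if_pos hv]
  simp only [extDatum]
  rw [dif_pos ⟨h, rfl⟩]
  rfl

end

open Classical in
lemma levD_single {i j : ℤ} (w : Lev rk z i) (u : Fin (f w).n → ℝ) (v : Lev rk z j) :
    levD rk f z i j (Pi.single w u) v = (f v).D (f w) v w u := by
  rw [levD_apply, Finset.sum_eq_single w]
  · rw [Pi.single_eq_same]
  · exact fun b _ hb => by rw [Pi.single_eq_of_ne hb, map_zero]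
  · exact fun h => absurd (Finset.mem_univ _) h

open Classical in
lemma levOp_C_single {i : ℤ} (hn : ∀ w : Lev rk z i, (f w).P.n = rk z - i) (w : Lev rk z i)
    (u : Fin (f w).n → ℝ) :
    (levOp rk c f z i hn).C (Pi.single w u) = Pi.single w ((f w).P.C u + (c z - c w) • u) := by
  funext v
  rw [levOp, Op.pi_C]
  by_cases h : v = w
  · subst h
    rw [Pi.single_eq_same, Pi.single_eq_same]
  · rw [Pi.single_eq_of_ne h, Pi.single_eq_of_ne h, map_zero, smul_zero, add_zero]

open Classical in
lemma levOp_B_single {i : ℤ} (hn : ∀ w : Lev rk z i, (f w).P.n = rk z - i) (w : Lev rk z i)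
    (u : Fin (f w).n → ℝ) (v) :
    (levOp rk c f z i hn).B (Pi.single w u) v = (f w).P.B u (v w) := by
  rw [levOp, Op.pi_B, Finset.sum_eq_single w]
  · rw [Pi.single_eq_same]
  · exact fun b _ hb => by rw [Pi.single_eq_of_ne hb, map_zero, LinearMap.zero_apply]
  · exact fun h => absurd (Finset.mem_univ _) h

open Classical in
lemma levOp_mem_single {i : ℤ} (hn : ∀ w : Lev rk z i, (f w).P.n = rk z - i) (w : Lev rk z i)
    {u : Fin (f w).n → ℝ} {k : ℤ} (hu : u ∈ (f w).P.F k) :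
    (Pi.single w u : LevSpace rk f z i) ∈ (levOp rk c f z i hn).F k := by
  rw [levOp, Op.mem_pi]
  intro v
  by_cases h : v = w
  · subst h
    rwa [Pi.single_eq_same]
  · rw [Pi.single_eq_of_ne h]
    exact Submodule.zero_mem _

theorem exists_inv (hG : Geo rk c) (hf : ∀ w < z, Good rk c f w) :
    ∃ a, Inv rk c z (fun w _ => f w) a := by
  classical
  by_cases hz : z = ⊥
  · subst hz
    exact exists_inv_bot hG _
  have hz1 : 0 ≤ rk z - 1 := by
    have h1 := hG.rk_lt (bot_lt_iff_ne_bot.2 hz)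
    have h2 := hG.rk_bot
    omega
  obtain ⟨N, P, D₀, d₀, hl, hrel, hDD, hC, hHR, hex, hinj⟩ :=
    (lev_seq4 hG hf (i := 1) le_rfl).exists_ext hz1
  have hlev : ∀ w, w ⋖ z → w ≤ z ∧ rk w + 1 = rk z := fun w hw =>
    ⟨hw.le, (hG.rk_covBy _ _ hw).symm⟩
  have hcov : ∀ w : Lev rk z 1, w.1 ⋖ z := fun w => hG.covBy_of_rk w.2.1 w.2.2
  have hdeg : P.n = rk z := by
    have h1 : P.n = rk z - 1 + 1 := hl.deg
    omega
  have hpair : ∀ w w' : Lev rk z 1, ∀ u, D₀ (d₀ (Pi.single w u)) w' +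
      ∑ y : Lev rk z (1 + 1), (f y).U (f w') y w' ((f y).D (f w) y w u) =
      (Pi.single w ((f w).P.C u + (c z - c w) • u) : LevSpace rk f z 1) w' := fun w w' u => by
    have := congrFun (hrel (Pi.single w u)) w'
    rw [levOp_C_single, Pi.add_apply, levU_apply] at this
    simpa only [levD_single] using this
  refine ⟨extDatum rk f z P D₀ d₀, hdeg, fun h => absurd h hz, ?_, ?_, ?_, ?_, ?_, ?_, ?_, ?_, ?_, ?_, ?_, ?_⟩
  · intro w h k u hu
    by_cases hw : w ⋖ z
    · rw [extDatum_D w hw (hlev w hw)]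
      have := hl.D_mem k u hu
      rw [levOp, Op.mem_pi] at this
      exact this ⟨w, hlev w hw⟩
    · rw [Datum.D_of_not hw]; exact Submodule.zero_mem _
  · intro w h k u hu
    by_cases hw : w ⋖ z
    · rw [extDatum_U w hw (hlev w hw)]
      exact hl.d_mem k _ (levOp_mem_single _ ⟨w, hlev w hw⟩ hu)
    · rw [Datum.U_of_not hw]; exact Submodule.zero_mem _
  · intro w h u v
    by_cases hw : w ⋖ z
    · rw [extDatum_U w hw (hlev w hw), extDatum_D w hw (hlev w hw)]
      exact (hl.adj _ _).trans (levOp_B_single _ _ _ _)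
    · rw [Datum.U_of_not hw, Datum.D_of_not hw, map_zero, map_zero, LinearMap.zero_apply]
  · intro w h u
    by_cases hw : w ⋖ z
    · rw [extDatum_D w hw (hlev w hw), extDatum_D w hw (hlev w hw)]
      exact congrFun (hl.D_C u) ⟨w, hlev w hw⟩
    · rw [Datum.D_of_not hw, Datum.D_of_not hw, map_zero, smul_zero, add_zero]
  · intro w h u
    by_cases hw : w ⋖ z
    · rw [extDatum_U w hw (hlev w hw), extDatum_U w hw (hlev w hw)]
      have := hl.d_C (Pi.single ⟨w, hlev w hw⟩ u)
      rw [levOp_C_single] at this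
      exact this
    · rw [Datum.U_of_not hw, Datum.U_of_not hw, map_zero]
  · intro w h hw u
    rw [extDatum_D w hw (hlev w hw), extDatum_U w hw (hlev w hw)]
    have := hpair ⟨w, hlev w hw⟩ ⟨w, hlev w hw⟩ u
    rw [Pi.single_eq_same, (hf w h).C_eq u (fun y => y ≤ z ∧ rk y + (1 + 1) = rk z), add_comm] at this
    · exact add_left_cancel this
    · intro y hy
      have h1 := hG.rk_covBy _ _ hy
      have h2 := hG.rk_covBy _ _ hw
      exact ⟨hy.le.trans h.le, by omega⟩
  · intro w h w' h' hw hw' hne u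
    rw [extDatum_D w' hw' (hlev w' hw'), extDatum_U w hw (hlev w hw)]
    have := hpair ⟨w, hlev w hw⟩ ⟨w', hlev w' hw'⟩ u
    rw [Pi.single_eq_of_ne (fun e => hne (Subtype.ext_iff.1 e).symm)] at this
    rw [← this]
    congr 1
    refine sum_subtype_congr (fun y => (f y).U (f w') y w' ((f y).D (f w) y w u)) fun y hy => ?_
    have h1 : y ⋖ w' := by
      by_contra h1
      exact hy (Datum.U_of_not h1 _)
    have h2 := hG.rk_covBy _ _ h1
    have h3 := hG.rk_covBy _ _ hw'
    exact iff_of_true (h1.lt.trans h') ⟨h1.le.trans h'.le, by omega⟩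
  · intro v h u
    by_cases hv : v ≤ z ∧ rk v + (1 + 1) = rk z
    · have := congrFun (hDD u) ⟨v, hv⟩
      rw [levD_apply] at this
      refine Eq.trans (Eq.trans (sum_subtype_congr (q := fun w => w ≤ z ∧ rk w + 1 = rk z)
        (fun w => (f v).D (f w) v w ((f w).D _ w z u)) fun w hw => ?_)
        (Finset.sum_congr rfl fun w _ => by rw [extDatum_D w.1 (hcov w) w.2])) this
      have h1 : w ⋖ z := by
        by_contra h1
        exact hw (by rw [Datum.D_of_not h1, map_zero])
      exact iff_of_true h1.lt (hlev w h1)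
    · refine Finset.sum_eq_zero fun w _ => ?_
      by_cases h1 : w.1 ⋖ z
      · refine Datum.D_of_not (fun h2 => hv ⟨h.le, ?_⟩) _
        have h3 := hG.rk_covBy _ _ h1
        have h4 := hG.rk_covBy _ _ h2
        omega
      · rw [Datum.D_of_not h1, map_zero]
  · intro u
    have e : D₀ u = ∑ w : Lev rk z 1, Pi.single w (D₀ u w) := (Finset.univ_sum_single _).symm
    refine (hC u).trans ?_
    rw [e, map_sum]
    refine Eq.trans (Finset.sum_congr rfl fun w _ => ?_)
      (sum_subtype_congr (p := fun w => w ≤ z ∧ rk w + 1 = rk z)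
        (fun w => (f w).U (extDatum rk f z P D₀ d₀) w z
          ((f w).D (extDatum rk f z P D₀ d₀) w z u)) fun w hw => ?_)
    · rw [extDatum_D w.1 (hcov w) w.2, extDatum_U w.1 (hcov w) w.2]
    have h1 : w ⋖ z := by
      by_contra h1
      exact hw (Datum.U_of_not h1 _)
    exact iff_of_true (hlev w h1) h1.lt
  · intro t ht
    have := hHR t ht
    rwa [← sg_add_one, sub_add_cancel] at this
  · intro k u hu hu0 hDu
    have hmem : (fun w : Lev rk z 1 => u ⟨w, w.lt le_rfl⟩) ∈
        (levOp rk c f z 1 (Lev.deg hf le_rfl)).F k := by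
      rw [levOp, Op.mem_pi]
      exact fun w => hu ⟨w.1, w.lt le_rfl⟩
    obtain ⟨x, hx, hDx⟩ := hex k _ hmem (by
      funext v
      rw [levD_apply]
      have hv : v.1 < z := v.lt (by omega)
      refine Eq.trans ?_ (hDu v hv)
      let g : Q → Fin (f v).n → ℝ := fun w => if h : w < z then (f v).D (f w) v w (u ⟨w, h⟩) else 0
      have e1 : ∀ w (h : w < z), (f v).D (f w) v w (u ⟨w, h⟩) = g w := fun w h => by
        simp only [g, dif_pos h]
      rw [Finset.sum_congr rfl fun w _ => e1 w.1 (w.lt le_rfl),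
        Finset.sum_congr rfl fun (w : {w // w < z}) _ => e1 w.1 w.2]
      refine sum_subtype_congr g fun w hw => ?_
      have h0 : w < z := by
        by_contra h0
        exact hw (dif_neg h0)
      have h1 : w ⋖ z := by
        by_contra h1
        exact hw (by rw [← e1 w h0, hu0 ⟨w, h0⟩ h1, map_zero])
      exact iff_of_true (hlev w h1) h0)
    refine ⟨x, hx, fun w => ?_⟩
    by_cases hw : w.1 ⋖ z
    · exact (extDatum_D w.1 hw (hlev w hw) x).trans (congrFun hDx ⟨w.1, hlev w hw⟩)
    · rw [hu0 w hw]
      exact Datum.D_of_not hw _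
  · intro _ k hk x hx hx0
    refine hinj k (by rw [hdeg]; exact hk) x hx (funext fun w => ?_)
    rw [← extDatum_D w.1 (hcov w) w.2]
    exact hx0 w (w.lt le_rfl)

theorem exists_good (hG : Geo rk c) : ∃ f : Q → Datum Q, ∀ z, Good rk c f z := by
  have : Nonempty (Datum Q) := ⟨⟨1, baseOp, fun _ _ => 0, fun _ _ => 0⟩⟩
  exact exists_rec (fun z f a => Inv rk c z f a) fun f z hf => exists_inv hG hf

end LeftKLS

namespace LeftKLS

open Module

lemma Flt.finrank_add {X : Type*} [AddCommGroup X] [Module ℝ X] [FiniteDimensional ℝ X]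
    (P : Flt X) (hneg : ∀ k < 0, P.F k = ⊥) (k : ℤ) :
    finrank ℝ (P.F k) + finrank ℝ (P.F (P.n - 1 - k)) = finrank ℝ X := by
  have hr : LinearMap.BilinForm.IsRefl P.B := fun u v h => by rw [P.symm, h]
  have e : P.F (P.n - 1 - k) = LinearMap.BilinForm.orthogonal P.B (P.F k) := by
    ext v
    rw [P.perp, LinearMap.BilinForm.mem_orthogonal_iff]
  have hb : LinearMap.BilinForm.orthogonal P.B ⊤ = ⊥ := by
    refine (Submodule.eq_bot_iff _).2 fun v hv => P.nondeg hneg v fun u => ?_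
    rw [LinearMap.BilinForm.mem_orthogonal_iff] at hv
    exact (P.symm _ _).trans (hv u trivial)
  have := LinearMap.BilinForm.finrank_add_finrank_orthogonal (B := P.B) hr (P.F k)
  rw [hb, inf_bot_eq, finrank_bot, add_zero] at this
  rw [e, this]

/-- A product of submodules is the product of the modules. -/
def piSubmoduleEquiv {ι : Type*} {X : ι → Type*} [∀ i, AddCommGroup (X i)]
    [∀ i, Module ℝ (X i)] (p : ∀ i, Submodule ℝ (X i)) :
    Submodule.pi Set.univ p ≃ₗ[ℝ] ∀ i, p i where
  toFun u i := ⟨u.1 i, u.2 i trivial⟩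
  invFun v := ⟨fun i => v i, fun i _ => (v i).2⟩
  map_add' _ _ := rfl
  map_smul' _ _ := rfl
  left_inv _ := rfl
  right_inv _ := rfl

variable {Q : Type*} [PartialOrder Q] [OrderBot Q] [Fintype Q] {rk : Q → ℤ} {c : Q → ℝ}
  {f : Q → Datum Q} {z : Q}

/-- The filtration on a level. -/
def levF (rk : Q → ℤ) (f : Q → Datum Q) (z : Q) (i K : ℤ) : Submodule ℝ (LevSpace rk f z i) :=
  Submodule.pi Set.univ fun w : Lev rk z i => (f w).P.F K

lemma mem_levF {i K : ℤ} {u : LevSpace rk f z i} :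
    u ∈ levF rk f z i K ↔ ∀ w : Lev rk z i, u w ∈ (f w).P.F K := by
  simp [levF]

/-- The dimension of a filtered piece. -/
noncomputable def dimF (f : Q → Datum Q) (w : Q) (K : ℤ) : ℤ := finrank ℝ ((f w).P.F K)

open Classical in
lemma finrank_levF (i K : ℤ) :
    (finrank ℝ (levF rk f z i K) : ℤ) = ∑ w : Lev rk z i, dimF f w K := by
  rw [levF, (piSubmoduleEquiv fun w : Lev rk z i => (f w).P.F K).finrank_eq, finrank_pi_fintype]
  push_cast
  rfl

/-- The restriction of the downward map to filtered pieces. -/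
noncomputable def levDF (rk : Q → ℤ) (f : Q → Datum Q) (z : Q) (i K : ℤ) :
    levF rk f z i K →ₗ[ℝ] LevSpace rk f z (i + 1) :=
  levD rk f z i (i + 1) ∘ₗ (levF rk f z i K).subtype

variable (hG : Geo rk c) (hf : ∀ w, Good rk c f w)
include hG hf

lemma range_levDF {i : ℤ} (hi : 0 ≤ i) (K : ℤ) : (LinearMap.ker (levDF rk f z (i + 1) K)).map
    (levF rk f z (i + 1) K).subtype = LinearMap.range (levDF rk f z i K) := by
  classical
  ext u
  simp only [Submodule.mem_map, LinearMap.mem_ker, LinearMap.mem_range]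
  constructor
  · rintro ⟨⟨u, hu⟩, hu0, rfl⟩
    rcases hi.eq_or_lt with rfl | hi
    · rw [mem_levF] at hu
      let v : ∀ w : {w : Q // w < z}, Fin (f w.1).n → ℝ := fun w =>
        if h : w.1 ≤ z ∧ rk w.1 + (0 + 1) = rk z then u ⟨w.1, h⟩ else 0
      have hv : ∀ w : Lev rk z (0 + 1), v ⟨w.1, w.lt (by omega)⟩ = u w := fun w => dif_pos w.2
      have hv' : ∀ w, ¬ w.1 ⋖ z → v w = 0 := fun w hw =>
        dif_neg fun h => hw (hG.covBy_of_rk h.1 (by simpa using h.2))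
      obtain ⟨x, hx, hxv⟩ := (hf z).ex K v (fun w => by
          by_cases h : w.1 ≤ z ∧ rk w.1 + (0 + 1) = rk z
          · rw [hv ⟨w.1, h⟩]; exact hu ⟨w.1, h⟩
          · rw [show v w = 0 from dif_neg h]; exact Submodule.zero_mem _) hv' (fun y hy => by
          by_cases h : y ≤ z ∧ rk y + (0 + 1 + 1) = rk z
          · have h1 := congrFun hu0 ⟨y, h⟩
            simp only [levDF, LinearMap.comp_apply, Submodule.subtype_apply] at h1
            rw [levD_apply] at h1
            refine Eq.trans ?_ h1
            let g : Q → Fin (f y).n → ℝ := fun w =>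
              if h : w < z then (f y).D (f w) y w (v ⟨w, h⟩) else 0
            have e1 : ∀ w (h : w < z), (f y).D (f w) y w (v ⟨w, h⟩) = g w := fun w h => by
              simp only [g, dif_pos h]
            rw [Finset.sum_congr rfl fun (w : {w // w < z}) _ => e1 w.1 w.2]
            refine Eq.trans (sum_subtype_congr (q := fun w => w ≤ z ∧ rk w + (0 + 1) = rk z) g
              fun w hw => ?_) (Finset.sum_congr rfl fun w _ => ?_)
            · have h0 : w < z := by
                by_contra h0
                exact hw (dif_neg h0)
              have h1 : w ⋖ z := by
                by_contra h1
                exact hw (by rw [← e1 w h0, hv' ⟨w, h0⟩ h1, map_zero])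
              have h2 := hG.rk_covBy _ _ h1
              exact iff_of_true h0 ⟨h0.le, by omega⟩
            · rw [← hv w, e1]
          · refine Finset.sum_eq_zero fun w _ => ?_
            by_cases h1 : w.1 ⋖ z
            · refine Datum.D_of_not (fun h2 => h ⟨hy.le, ?_⟩) _
              have h3 := hG.rk_covBy _ _ h1
              have h4 := hG.rk_covBy _ _ h2
              omega
            · rw [hv' w h1, map_zero])
      have hz : z ≤ z ∧ rk z + 0 = rk z := ⟨le_rfl, add_zero _⟩
      refine ⟨⟨Pi.single ⟨z, hz⟩ x, mem_levF.2 fun w => ?_⟩, funext fun w => ?_⟩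
      · have h1 : w = ⟨z, hz⟩ := by
          rcases w.2.1.eq_or_lt with h | h
          · exact Subtype.ext h
          · have h2 := hG.rk_lt h
            have h3 := w.2.2
            omega
        subst h1
        rw [Pi.single_eq_same]
        exact hx
      · exact (levD_single _ _ _).trans ((hxv ⟨w.1, w.lt (by omega)⟩).trans (hv w))
    · obtain ⟨y, hy, e⟩ := (lev_seq4 (z := z) hG (fun w _ => hf w) hi).exact (K := K) hu hu0
      exact ⟨⟨y, hy⟩, e.symm⟩
  · rintro ⟨⟨u, hu⟩, rfl⟩
    rw [mem_levF] at hu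
    refine ⟨⟨levD rk f z i (i + 1) u, mem_levF.2 fun v => ?_⟩, ?_, rfl⟩
    · rw [levD_apply]
      exact Submodule.sum_mem _ fun w _ => (hf w).D_mem v (hu w)
    · exact levD_levD hG (fun w => hf w) u

end LeftKLS

namespace LeftKLS

open Module

variable {Q : Type*} [PartialOrder Q] [OrderBot Q] [Fintype Q] {rk : Q → ℤ} {c : Q → ℝ}
  {f : Q → Datum Q} {z : Q}

lemma levDF_rank (i K : ℤ) : finrank ℝ (LinearMap.range (levDF rk f z i K)) +
    finrank ℝ (LinearMap.ker (levDF rk f z i K)) = finrank ℝ (levF rk f z i K) :=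
  LinearMap.finrank_range_add_finrank_ker _

variable (hG : Geo rk c) (hf : ∀ w, Good rk c f w)
include hG hf

lemma levDF_ker {i : ℤ} (hi : 0 ≤ i) (K : ℤ) :
    finrank ℝ (LinearMap.ker (levDF rk f z (i + 1) K)) =
      finrank ℝ (LinearMap.range (levDF rk f z i K)) := by
  rw [← range_levDF hG hf hi, LinearEquiv.finrank_eq
    (Submodule.equivMapOfInjective _ (Submodule.injective_subtype _) _)]

lemma sum_levF (m : ℕ) (K : ℤ) :
    ∑ i ∈ Finset.range (m + 1), (-1 : ℤ) ^ i * finrank ℝ (levF rk f z i K) =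
      finrank ℝ (LinearMap.ker (levDF rk f z 0 K)) +
        (-1) ^ m * finrank ℝ (LinearMap.range (levDF rk f z m K)) := by
  induction m with
  | zero =>
    rw [Finset.sum_range_one, pow_zero, one_mul, one_mul, Nat.cast_zero, ← levDF_rank]
    push_cast
    ring
  | succ m ih =>
    rw [Finset.sum_range_succ, ih, ← levDF_rank]
    push_cast
    rw [levDF_ker hG hf (Int.natCast_nonneg m)]
    ring

omit hf in
lemma lev_isEmpty {i : ℤ} (hi : rk z < i) : IsEmpty (Lev rk z i) := ⟨fun w => by
  have h1 := hG.rk_mono (bot_le (a := w.1))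
  have h2 := w.2.2
  have h3 := hG.rk_bot
  omega⟩

open Classical in
/-- The alternating sum of dimensions. -/
noncomputable def kap (rk : Q → ℤ) (f : Q → Datum Q) (z : Q) (K : ℤ) : ℤ :=
  ∑ w with w ≤ z, (-1) ^ (rk z - rk w).toNat * dimF f w K

lemma kap_eq (K : ℤ) : kap rk f z K = finrank ℝ (LinearMap.ker (levDF rk f z 0 K)) := by
  classical
  have h0 : 0 ≤ rk z := by
    rw [← hG.rk_bot]
    exact hG.rk_mono bot_le
  have hE : IsEmpty (Lev rk z (((rk z).toNat : ℤ) + 1)) := lev_isEmpty hG (by omega)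
  have h1 : finrank ℝ (LinearMap.range (levDF rk f z (rk z).toNat K)) = 0 := by
    have : Subsingleton (LevSpace rk f z (((rk z).toNat : ℤ) + 1)) := inferInstance
    exact finrank_zero_of_subsingleton
  have h2 := sum_levF (z := z) hG hf (rk z).toNat K
  rw [h1, Nat.cast_zero, mul_zero, add_zero] at h2
  rw [← h2, kap, ← Finset.sum_fiberwise_of_maps_to (s := Finset.univ.filter (· ≤ z))
    (t := Finset.range ((rk z).toNat + 1)) (g := fun w => (rk z - rk w).toNat)]
  · refine Finset.sum_congr rfl fun i _ => ?_
    rw [finrank_levF, Finset.mul_sum, Finset.filter_filter,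
      ← Finset.sum_subtype (Finset.univ.filter fun u => u ≤ z ∧ rk u + i = rk z)
      (by simp) (fun w => (-1 : ℤ) ^ i * dimF f w K)]
    have e : (Finset.univ.filter fun w => w ≤ z ∧ (rk z - rk w).toNat = i) =
        Finset.univ.filter fun u => u ≤ z ∧ rk u + i = rk z := by
      ext w
      simp only [Finset.mem_filter, Finset.mem_univ, true_and]
      refine and_congr_right fun hw => ?_
      have := hG.rk_mono hw
      omega
    rw [e]
    refine Finset.sum_congr rfl fun w hw => ?_
    have h3 : (rk z - rk w).toNat = i := by
      have := (Finset.mem_filter.1 hw).2.2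
      omega
    rw [h3]
  · intro w hw
    have h3 := hG.rk_mono (bot_le (a := w))
    have h4 := hG.rk_bot
    rw [Finset.mem_range]
    omega

lemma kap_mono (K : ℤ) : kap rk f z K ≤ kap rk f z (K + 1) := by
  rw [kap_eq hG hf, kap_eq hG hf]
  have hle : levF rk f z 0 K ≤ levF rk f z 0 (K + 1) := fun u hu => by
    rw [mem_levF] at hu ⊢
    exact fun w => (f w).P.mono (by omega) (hu w)
  have h : ∀ u : LinearMap.ker (levDF rk f z 0 K),
      Submodule.inclusion hle u.1 ∈ LinearMap.ker (levDF rk f z 0 (K + 1)) := fun u => u.2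
  refine Int.ofNat_le.2 (LinearMap.finrank_le_finrank_of_injective
    (f := ((Submodule.inclusion hle) ∘ₗ (Submodule.subtype _)).codRestrict _ h) ?_)
  intro u v huv
  have := congrArg (fun x => x.1.1) huv
  exact Subtype.ext (Subtype.ext this)

lemma kap_zero (hz : z ≠ ⊥) {K : ℤ} (hK : 2 * K ≤ rk z) : kap rk f z K = 0 := by
  classical
  rw [kap_eq hG hf]
  have : LinearMap.ker (levDF rk f z 0 K) = ⊥ := by
    rw [Submodule.eq_bot_iff]
    rintro ⟨u, hu⟩ hu0
    rw [mem_levF] at hu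
    have hw0 : ∀ w : Lev rk z 0, w.1 = z := fun w => by
      rcases w.2.1.eq_or_lt with h | h
      · exact h
      · have h2 := hG.rk_lt h
        have h3 := w.2.2
        omega
    have hz0 : z ≤ z ∧ rk z + 0 = rk z := ⟨le_rfl, add_zero _⟩
    refine Subtype.ext (funext fun w => ?_)
    obtain rfl : w = ⟨z, hz0⟩ := Subtype.ext (hw0 w)
    refine (hf z).inj hz K hK (u ⟨z, hz0⟩) (hu ⟨z, hz0⟩) fun v hv => ?_
    by_cases hc : v ⋖ z
    · have h1 := hG.rk_covBy _ _ hc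
      have h2 := congrFun (LinearMap.mem_ker.1 hu0) ⟨v, hv.le, by omega⟩
      simp only [levDF, LinearMap.comp_apply, Submodule.subtype_apply] at h2
      rw [levD_apply, Finset.sum_eq_single ⟨z, hz0⟩] at h2
      · exact h2
      · exact fun b _ hb => absurd (Subtype.ext (hw0 b)) hb
      · exact fun h => absurd (Finset.mem_univ _) h
    · exact Datum.D_of_not hc _
  rw [this, finrank_bot, Nat.cast_zero]

omit hG

lemma dimF_neg (w : Q) {K : ℤ} (hK : K < 0) : dimF f w K = 0 := by
  rw [dimF, (f w).P.neg K hK, finrank_bot, Nat.cast_zero]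

lemma dimF_add (w : Q) (K : ℤ) : dimF f w K + dimF f w (rk w - 1 - K) = (f w).n := by
  have := (f w).P.finrank_add (f w).P.neg K
  rw [(hf w).deg, finrank_fin_fun] at this
  rw [dimF, dimF]
  exact_mod_cast this

lemma dimF_bot {K : ℤ} (hG : Geo rk c) (hK : 0 ≤ K) : dimF f ⊥ K = 1 := by
  have h1 := dimF_add hf ⊥ K
  rw [dimF_neg hf ⊥ (K := rk ⊥ - 1 - K) (by rw [hG.rk_bot]; omega), add_zero, (hf ⊥).dim_bot rfl] at h1
  exact_mod_cast h1

end LeftKLS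

namespace LeftKLS

section

variable {L : Type*} [Lattice L] [BoundedOrder L] [Fintype L]

lemma rank_strictMono {rk : L → ℕ} (hcov : ∀ x y : L, x ⋖ y → rk y = rk x + 1) {v w : L}
    (h : v < w) : rk v < rk w := by
  induction w using WellFoundedLT.induction with
  | _ w ih =>
    obtain ⟨u, hu, huw⟩ := exists_le_covBy_of_lt h
    have := hcov u w huw
    rcases hu.eq_or_lt with rfl | hu
    · omega
    · have := ih u huw.lt hu
      omega

omit [BoundedOrder L] [Fintype L] in
lemma covBy_eq {v w y : L} (h : v ⋖ w) (h1 : v < y) (h2 : y ≤ w) : y = w :=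
  h2.eq_of_not_lt (h.2 h1)

open Classical in
/-- The atoms below an element. -/
noncomputable def atomsLE (w : L) : Finset L := Finset.univ.filter fun a => IsAtom a ∧ a ≤ w

omit [BoundedOrder L] [Fintype L] in
lemma covBy_Ici {x : L} {v w : Set.Ici x} : v ⋖ w ↔ v.1 ⋖ w.1 := by
  constructor
  · exact fun h => ⟨h.lt, fun u h1 h2 => h.2 (c := ⟨u, v.2.trans h1.le⟩) h1 h2⟩
  · exact fun h => ⟨h.lt, fun u h1 h2 => h.2 (c := u.1) h1 h2⟩

lemma mem_atomsLE {a w : L} : a ∈ atomsLE w ↔ IsAtom a ∧ a ≤ w := by simp [atomsLE]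

lemma atomsLE_mono {v w : L} (h : v ≤ w) : atomsLE v ⊆ atomsLE w := fun a ha => by
  rw [mem_atomsLE] at ha ⊢
  exact ⟨ha.1, ha.2.trans h⟩

lemma atomsLE_ssubset (hA : ∀ x : L, ∃ s : Finset L, (∀ a ∈ s, IsAtom a) ∧ x = s.sup id) {v w : L}
    (h : v < w) : atomsLE v ⊂ atomsLE w := by
  refine (atomsLE_mono h.le).ssubset_of_ne fun e => h.not_ge ?_
  obtain ⟨s, hs, hw⟩ := hA w
  rw [hw]
  refine Finset.sup_le fun a ha => ?_
  have : a ∈ atomsLE w := mem_atomsLE.2 ⟨hs a ha, by rw [hw]; exact Finset.le_sup (f := id) ha⟩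
  rw [← e] at this
  exact (mem_atomsLE.1 this).2

variable (hU : ∀ a b : L, a ⊓ b ⋖ b → a ⋖ a ⊔ b)
include hU

lemma covBy_sup_atom {a w : L} (ha : IsAtom a) (h : ¬ a ≤ w) : w ⋖ w ⊔ a := by
  refine hU w a ?_
  have : w ⊓ a = ⊥ := ha.lt_iff.1 (inf_le_right.lt_of_ne fun e => h (inf_eq_right.1 e))
  rw [this]
  exact ha.bot_covBy

lemma covBy_sup {v w w' : L} (h : v ⋖ w) (h' : v ⋖ w') (hne : w ≠ w') : w ⋖ w ⊔ w' := by
  refine hU w w' ?_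
  have h1 : v ≤ w ⊓ w' := le_inf h.le h'.le
  have : v = w ⊓ w' := by
    rcases h1.eq_or_lt with e | e
    · exact e
    · have h2 := covBy_eq h e inf_le_left
      have h3 := covBy_eq h' e inf_le_right
      exact absurd (h2.symm.trans h3) hne
  rwa [← this]

open Classical in
lemma sum_atoms (w z : L) (hwz : w ≤ z) (s : Finset L) (hs : ∀ u, u ∈ s ↔ w ⋖ u ∧ u ≤ z) :
    ∑ u ∈ s, (((atomsLE u).card : ℝ) - (atomsLE w).card) = (atomsLE z).card - (atomsLE w).card := by
  have key : ∀ u, w ≤ u → ((atomsLE u).card : ℝ) - (atomsLE w).card = (atomsLE u \ atomsLE w).card :=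
    fun u hu => by rw [Finset.cast_card_sdiff (atomsLE_mono hu)]
  rw [key z hwz, Finset.sum_congr rfl fun u hu => key u ((hs u).1 hu).1.le,
    Finset.card_eq_sum_card_fiberwise (f := fun a => w ⊔ a) (t := s)]
  · push_cast
    refine Finset.sum_congr rfl fun u hu => ?_
    have hu := (hs u).1 hu
    congr 2
    ext a
    simp only [Finset.mem_sdiff, mem_atomsLE, Finset.mem_filter, not_and]
    constructor
    · rintro ⟨⟨h1, h2⟩, h3⟩
      refine ⟨⟨⟨h1, h2.trans hu.2⟩, h3⟩, ?_⟩
      exact covBy_eq hu.1 (covBy_sup_atom hU h1 (h3 h1)).lt (sup_le hu.1.le h2)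
    · rintro ⟨⟨⟨h1, h2⟩, h3⟩, rfl⟩
      exact ⟨⟨h1, le_sup_right⟩, h3⟩
  · intro a ha
    simp only [Finset.coe_sdiff, Set.mem_sdiff, Finset.mem_coe, mem_atomsLE, not_and] at ha
    exact (hs _).2 ⟨covBy_sup_atom hU ha.1.1 (ha.2 ha.1.1), sup_le hwz ha.1.2⟩

theorem geo_Ici (hA : ∀ x : L, ∃ s : Finset L, (∀ a ∈ s, IsAtom a) ∧ x = s.sup id)
    {rk : L → ℕ} (hcov : ∀ x y : L, x ⋖ y → rk y = rk x + 1) (x : L) :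
    Geo (Q := Set.Ici x) (fun w => (rk w : ℤ) - rk x) (fun w => ((atomsLE w.1).card : ℝ)) where
  rk_bot := by simp
  rk_covBy v w h := by
    have := hcov _ _ (covBy_Ici.1 h)
    push_cast [this]
    ring
  c_lt v w h := Nat.cast_lt.2 (Finset.card_lt_card (atomsLE_ssubset hA h))
  c_sum w z hwz s hs := by
    classical
    rw [← sum_atoms hU w.1 z.1 hwz (s.map (Function.Embedding.subtype _)), Finset.sum_map]
    · rfl
    · intro u
      simp only [Finset.mem_map, Function.Embedding.coe_subtype, hs, covBy_Ici]
      constructor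
      · rintro ⟨u, h, rfl⟩
        exact h
      · exact fun h => ⟨⟨u, w.2.trans h.1.le⟩, h, rfl⟩
  diamond v w w' z h h' hne hw hw' := by
    rw [covBy_Ici] at h h'
    have hne' : w.1 ≠ w'.1 := fun e => hne (Subtype.ext e)
    refine ⟨⟨w.1 ⊔ w'.1, w.2.trans le_sup_left⟩, sup_le hw hw', covBy_Ici.2 ?_, covBy_Ici.2 ?_⟩
    · exact covBy_sup hU h h' hne'
    · have := covBy_sup hU h' h hne'.symm
      rwa [sup_comm] at this
  unique w w' u u' hne h1 h2 h3 h4 := by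
    rw [covBy_Ici] at h1 h2 h3 h4
    have hlt : w.1 < w.1 ⊔ w'.1 := by
      refine left_lt_sup.2 fun h => ?_
      rcases h.eq_or_lt with e | e
      · exact hne (Subtype.ext e).symm
      · exact h2.2 e h1.lt
    refine Subtype.ext ?_
    rw [← covBy_eq h1 hlt (sup_le h1.le h2.le), ← covBy_eq h3 hlt (sup_le h3.le h4.le)]

end

end LeftKLS

namespace LeftKLS

open Polynomial

section

variable {L : Type*} [PartialOrder L] [Fintype L] [LocallyFiniteOrder L] {rk : L → ℕ}
  {μ : L → L → ℤ} {R : L → L → ℤ[X]} {x : L}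

/-- The convolution of `R` with `μ`, weighted by rank. -/
noncomputable def muConv (rk : L → ℕ) (μ : L → L → ℤ) (R : L → L → ℤ[X]) (x z : L) : ℤ[X] :=
  ∑ y ∈ Finset.Icc x z, R x y * (C (μ y z) * X ^ (rk z - rk y))

lemma sum_Icc_comm {M : Type*} [AddCommMonoid M] (x z : L) (g : L → L → M) :
    ∑ w ∈ Finset.Icc x z, ∑ y ∈ Finset.Icc x w, g y w =
      ∑ y ∈ Finset.Icc x z, ∑ w ∈ Finset.Icc y z, g y w := by
  refine Finset.sum_comm' fun w y => ?_
  simp only [Finset.mem_Icc]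
  constructor
  · rintro ⟨⟨h1, h2⟩, h3, h4⟩
    exact ⟨⟨h4, h2⟩, h3, h4.trans h2⟩
  · rintro ⟨⟨h1, h2⟩, h3, h4⟩
    exact ⟨⟨h3.trans h1, h2⟩, h3, h1⟩

lemma reflect_eq_sum_muConv (h1 : ∀ y : L, μ y y = 1) (h2 : R x x = 1)
    (h3 : ∀ z, x < z → reflect (rk z - rk x) (R x z) = ∑ y ∈ Finset.Icc x z,
      R x y * ∑ w ∈ Finset.Icc y z, C (μ y w) * X ^ (rk w - rk y)) {z : L} (hz : x ≤ z) :
    reflect (rk z - rk x) (R x z) = ∑ w ∈ Finset.Icc x z, muConv rk μ R x w := by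
  rcases hz.eq_or_lt with rfl | hz
  · simp [muConv, h1, h2]
  · simp only [h3 z hz, muConv, sum_Icc_comm, Finset.mul_sum]

lemma eq_sum_muConv (hrk : Monotone rk) (h1 : ∀ y : L, μ y y = 1)
    (h2 : ∀ y z : L, y < z → ∑ w ∈ Finset.Icc y z, μ y w = 0) {z : L} (hz : x ≤ z) :
    R x z = ∑ w ∈ Finset.Icc x z, X ^ (rk z - rk w) * muConv rk μ R x w := by
  simp only [muConv, Finset.mul_sum, sum_Icc_comm]
  have : ∀ y ∈ Finset.Icc x z, (∑ w ∈ Finset.Icc y z,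
      X ^ (rk z - rk w) * (R x y * (C (μ y w) * X ^ (rk w - rk y)))) =
      R x y * X ^ (rk z - rk y) * C (∑ w ∈ Finset.Icc y z, μ y w) := fun y _ => by
    rw [map_sum, Finset.mul_sum]
    refine Finset.sum_congr rfl fun w hw => ?_
    have hw := Finset.mem_Icc.1 hw
    have e : rk z - rk y = (rk z - rk w) + (rk w - rk y) := by
      have := hrk hw.1
      have := hrk hw.2
      omega
    rw [e, pow_add]
    ring
  rw [Finset.sum_congr rfl this, Finset.sum_eq_single_of_mem z (Finset.right_mem_Icc.2 hz)]
  · simp [h1]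
  · intro y hy hne
    rw [h2 y z ((Finset.mem_Icc.1 hy).2.lt_of_ne hne)]
    simp

lemma natDegree_muConv_le (hrk : Monotone rk)
    (hd : ∀ z, x ≤ z → (R x z).natDegree ≤ rk z - rk x) (z : L) :
    (muConv rk μ R x z).natDegree ≤ rk z - rk x := by
  refine natDegree_sum_le_of_forall_le _ _ fun y hy => ?_
  have hy := Finset.mem_Icc.1 hy
  have e : rk z - rk x = (rk y - rk x) + (rk z - rk y) := by
    have := hrk hy.1
    have := hrk hy.2
    omega
  rw [e]
  exact natDegree_mul_le_of_le (hd y hy.1) (natDegree_C_mul_X_pow_le _ _)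

lemma reflect_sum' {ι : Type*} (N : ℕ) (s : Finset ι) (g : ι → ℤ[X]) :
    reflect N (∑ i ∈ s, g i) = ∑ i ∈ s, reflect N (g i) := by
  ext n
  simp [coeff_reflect]

lemma reflect_muConv (hrk : Monotone rk) (h1 : ∀ y : L, μ y y = 1)
    (h2 : ∀ y z : L, y < z → ∑ w ∈ Finset.Icc y z, μ y w = 0) (h3 : R x x = 1)
    (h4 : ∀ z, x < z → reflect (rk z - rk x) (R x z) = ∑ y ∈ Finset.Icc x z,
      R x y * ∑ w ∈ Finset.Icc y z, C (μ y w) * X ^ (rk w - rk y))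
    (hd : ∀ z, x ≤ z → (R x z).natDegree ≤ rk z - rk x) {z : L} (hz : x ≤ z) :
    reflect (rk z - rk x) (muConv rk μ R x z) = muConv rk μ R x z := by
  induction z using WellFoundedLT.induction with
  | _ z ih =>
    have e := reflect_eq_sum_muConv h1 h3 h4 hz
    rw [eq_sum_muConv (R := R) hrk h1 h2 hz, reflect_sum'] at e
    have : ∀ w ∈ Finset.Icc x z, reflect (rk z - rk x) (X ^ (rk z - rk w) * muConv rk μ R x w) =
        reflect (rk w - rk x) (muConv rk μ R x w) := fun w hw => by
      have hw := Finset.mem_Icc.1 hw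
      have e : rk z - rk x = (rk z - rk w) + (rk w - rk x) := by
        have := hrk hw.1
        have := hrk hw.2
        omega
      have e' : reflect (rk z - rk w) (X ^ (rk z - rk w) : ℤ[X]) = 1 := by
        simp [reflect_monomial]
      rw [e, reflect_mul _ _ (natDegree_X_pow_le _) (natDegree_muConv_le hrk hd w), e', one_mul]
    rw [Finset.sum_congr rfl this] at e
    classical
    have hm := Finset.right_mem_Icc.2 hz
    rw [← Finset.add_sum_erase _ _ hm, ← Finset.add_sum_erase _ _ hm] at e
    rw [Finset.sum_congr rfl fun w hw => ?_] at e
    · exact add_right_cancel e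
    · have hw' := Finset.mem_Icc.1 (Finset.mem_of_mem_erase hw)
      exact ih w (hw'.2.lt_of_ne (Finset.ne_of_mem_erase hw)) hw'.1

end

section

variable {Q : Type*} [PartialOrder Q] [OrderBot Q] [Fintype Q]

open Classical in
lemma eq_of_palindromic {ρ : Q → ℕ} {s a : Q → ℕ → ℤ}
    (h0 : ∀ K, s ⊥ K = a ⊥ K)
    (hs : ∀ z K, K ≤ ρ z → s z (ρ z - K) = s z K) (ha : ∀ z K, K ≤ ρ z → a z (ρ z - K) = a z K)
    (hs' : ∀ z K, ρ z < K → s z K = 0) (ha' : ∀ z K, ρ z < K → a z K = 0)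
    (hss : ∀ z K, z ≠ ⊥ → 2 * K ≤ ρ z → ∑ w with w ≤ z, s w K = 0)
    (haa : ∀ z K, z ≠ ⊥ → 2 * K ≤ ρ z → ∑ w with w ≤ z, a w K = 0) (z : Q) (K : ℕ) :
    s z K = a z K := by
  induction z using WellFoundedLT.induction generalizing K with
  | _ z ih =>
    by_cases hz : z = ⊥
    · rw [hz, h0]
    have low : ∀ K, 2 * K ≤ ρ z → s z K = a z K := fun K hK => by
      have e := (hss z K hz hK).trans (haa z K hz hK).symm
      have hm : z ∈ Finset.univ.filter (· ≤ z) := by simp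
      rw [← Finset.add_sum_erase _ _ hm, ← Finset.add_sum_erase _ _ hm,
        Finset.sum_congr rfl fun w hw => ?_] at e
      · exact add_right_cancel e
      · refine ih w (lt_of_le_of_ne ?_ (Finset.ne_of_mem_erase hw)) K
        simpa using Finset.mem_of_mem_erase hw
    by_cases h1 : 2 * K ≤ ρ z
    · exact low K h1
    by_cases h2 : K ≤ ρ z
    · rw [← hs z K h2, ← ha z K h2]
      exact low _ (by omega)
    · rw [hs' z K (by omega), ha' z K (by omega)]

variable {rk : Q → ℤ} {c : Q → ℝ} {f : Q → Datum Q}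

/-- The dimension of a graded piece, with sign. -/
noncomputable def grSign (rk : Q → ℤ) (f : Q → Datum Q) (w : Q) (K : ℕ) : ℤ :=
  (-1) ^ (rk w).toNat * (dimF f w K - dimF f w (K - 1))

variable (hG : Geo rk c) (hf : ∀ w, Good rk c f w)
include hG hf

lemma rk_nonneg (w : Q) : 0 ≤ rk w := by
  have := hG.rk_mono (bot_le (a := w))
  rwa [hG.rk_bot] at this

lemma grSign_bot (K : ℕ) : grSign rk f ⊥ K = if K = 0 then 1 else 0 := by
  rw [grSign, hG.rk_bot, dimF_bot hf hG (by omega)]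
  split_ifs with h
  · rw [dimF_neg hf _ (by omega)]
    simp
  · rw [dimF_bot hf hG (by omega)]
    simp

lemma grSign_reflect (w : Q) (K : ℕ) (hK : K ≤ (rk w).toNat) :
    grSign rk f w ((rk w).toNat - K) = grSign rk f w K := by
  have h0 := rk_nonneg hG hf w
  have e : (((rk w).toNat - K : ℕ) : ℤ) = rk w - K := by omega
  rw [grSign, grSign, e]
  have h1 := dimF_add hf w K
  have h2 := dimF_add hf w (K - 1)
  rw [show rk w - 1 - (K : ℤ) = rk w - K - 1 by ring] at h1
  rw [show rk w - 1 - ((K : ℤ) - 1) = rk w - K by ring] at h2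
  congr 1
  linarith

lemma grSign_eq_zero (w : Q) (K : ℕ) (hK : (rk w).toNat < K) : grSign rk f w K = 0 := by
  have h0 := rk_nonneg hG hf w
  have h1 := dimF_add hf w K
  have h2 := dimF_add hf w (K - 1)
  rw [dimF_neg hf w (K := rk w - 1 - K) (by omega)] at h1
  rw [dimF_neg hf w (K := rk w - 1 - (K - 1)) (by omega)] at h2
  rw [grSign, show dimF f w K - dimF f w (K - 1) = 0 by linarith, mul_zero]

open Classical in
lemma sum_grSign (z : Q) (K : ℕ) : ∑ w with w ≤ z, grSign rk f w K =
    (-1) ^ (rk z).toNat * (kap rk f z K - kap rk f z (K - 1)) := by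
  rw [kap, kap, ← Finset.sum_sub_distrib, Finset.mul_sum]
  refine Finset.sum_congr rfl fun w hw => ?_
  have hw : w ≤ z := by simpa using hw
  have h1 := hG.rk_mono hw
  have h0 := rk_nonneg hG hf w
  rw [grSign, ← mul_sub, ← mul_assoc, ← pow_add]
  congr 1
  rw [show (rk z).toNat + (rk z - rk w).toNat = (rk w).toNat + 2 * (rk z - rk w).toNat by omega,
    pow_add, pow_mul]
  simp

open Classical in
lemma sum_grSign_eq_zero (z : Q) (K : ℕ) (hz : z ≠ ⊥) (hK : 2 * K ≤ (rk z).toNat) :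
    ∑ w with w ≤ z, grSign rk f w K = 0 := by
  have h0 := rk_nonneg hG hf z
  rw [sum_grSign hG hf, kap_zero hG hf hz (by omega), kap_zero hG hf hz (by omega)]
  simp

open Classical in
lemma sum_grSign_nonneg (z : Q) (K : ℕ) :
    0 ≤ (-1) ^ (rk z).toNat * ∑ w with w ≤ z, grSign rk f w K := by
  rw [sum_grSign hG hf, ← mul_assoc, ← pow_add, ← two_mul, pow_mul]
  have := kap_mono hG hf (z := z) (K - 1)
  simp at this ⊢
  exact this

end

end LeftKLS

namespace LeftKLS

open Polynomial

open Classical in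
lemma sum_Icc_eq_sum_Ici {L M : Type*} [PartialOrder L] [Fintype L] [LocallyFiniteOrder L]
    [AddCommMonoid M] {x : L} (z : Set.Ici x) (g : L → M) :
    ∑ w ∈ Finset.Icc x z.1, g w = ∑ w : Set.Ici x with w ≤ z, g w := by
  have : Finset.Icc x z.1 =
      (Finset.univ.filter fun w : Set.Ici x => w ≤ z).map (Function.Embedding.subtype _) := by
    ext w
    simp only [Finset.mem_Icc, Finset.mem_map, Finset.mem_filter, Finset.mem_univ, true_and,
      Function.Embedding.coe_subtype]
    constructor
    · exact fun h => ⟨⟨w, h.1⟩, h.2, rfl⟩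
    · rintro ⟨w, h, rfl⟩
      exact ⟨w.2, h⟩
  rw [this, Finset.sum_map]
  rfl

end LeftKLS

open LeftKLS Polynomial in
theorem inverse_left_KLS_polynomials_of_geometric_lattice_sign_nonneg
    {L : Type*} [Lattice L] [BoundedOrder L] [Fintype L] [LocallyFiniteOrder L]
    (hAtomistic : ∀ x : L, ∃ s : Finset L, (∀ a ∈ s, IsAtom a) ∧ x = s.sup id)
    (hUpperSemimodular : ∀ a b : L, a ⊓ b ⋖ b → a ⋖ a ⊔ b)
    (rk : L → ℕ) (hrk_bot : rk ⊥ = 0)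
    (hrk_cov : ∀ x y : L, x ⋖ y → rk y = rk x + 1)
    (μ : L → L → ℤ)
    (hμ_refl : ∀ x : L, μ x x = 1)
    (hμ_sum : ∀ x y : L, x < y → ∑ w ∈ Finset.Icc x y, μ x w = 0)
    (R' : L → L → Polynomial ℤ)
    (hR'_refl : ∀ x : L, R' x x = 1)
    (hR'_deg : ∀ x y : L, x < y →
      2 * (R' x y).degree < ((rk y - rk x : ℕ) : WithBot ℕ))
    (hR'_rec : ∀ x z : L, x < z →
      Polynomial.reflect (rk z - rk x) (R' x z)
        = ∑ y ∈ Finset.Icc x z,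
            R' x y *
              (∑ w ∈ Finset.Icc y z, Polynomial.C (μ y w) * Polynomial.X ^ (rk w - rk y))) :
    ∀ x y : L, x ≤ y → ∀ n : ℕ, 0 ≤ (-1 : ℤ) ^ (rk y - rk x) * (R' x y).coeff n := by
  classical
  intro x y hxy n
  have hrk : Monotone rk := (show StrictMono rk from fun _ _ => rank_strictMono hrk_cov).monotone
  have hlow : ∀ z, x < z → ∀ k, rk z - rk x ≤ 2 * k → (R' x z).coeff k = 0 := fun z hz k hk => by
    by_contra h
    have h1 := hR'_deg x z hz
    have hne : R' x z ≠ 0 := fun e => h (by rw [e, coeff_zero])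
    rw [degree_eq_natDegree hne] at h1
    have h2 := le_natDegree_of_ne_zero h
    have h1 : 2 * (R' x z).natDegree < rk z - rk x := by exact_mod_cast h1
    omega
  have hd : ∀ z, x ≤ z → (R' x z).natDegree ≤ rk z - rk x := fun z hz => by
    rcases hz.eq_or_lt with rfl | hz
    · simp [hR'_refl]
    · refine natDegree_le_iff_coeff_eq_zero.2 fun k hk => hlow z hz k (by omega)
  by_cases hn : rk y - rk x < n
  · rw [natDegree_le_iff_coeff_eq_zero.1 (hd y hxy) n hn, mul_zero]
  have hG := geo_Ici hUpperSemimodular hAtomistic hrk_cov x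
  obtain ⟨f, hf⟩ := exists_good hG
  have hρ : ∀ w : Set.Ici x, ((rk w : ℤ) - rk x).toNat = rk w - rk x := fun w => by omega
  have hsum : ∀ (z : Set.Ici x) (K : ℕ), K ≤ rk z - rk x →
      ∑ w : Set.Ici x with w ≤ z, (muConv rk μ R' x w).coeff K =
        (R' x z).coeff (rk z - rk x - K) := fun z K hK => by
    have := congrArg (coeff · K) (reflect_eq_sum_muConv hμ_refl (hR'_refl x) (hR'_rec x) z.2)
    simp only [coeff_reflect, revAt_le hK, finsetSum_coeff] at this
    rw [this, sum_Icc_eq_sum_Ici z fun w => (muConv rk μ R' x w).coeff K]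
    congr!
  have key : ∀ (w : Set.Ici x) (K : ℕ), (muConv rk μ R' x w).coeff K =
      grSign (fun w : Set.Ici x => (rk w : ℤ) - rk x) f w K := by
    refine eq_of_palindromic (ρ := fun w : Set.Ici x => rk w - rk x)
      (s := fun w K => (muConv rk μ R' x w.1).coeff K) (fun K => ?_) (fun z K hK => ?_)
      (fun z K hK => ?_) (fun z K hK => ?_) (fun z K hK => ?_) (fun z K hz hK => ?_)
      (fun z K hz hK => ?_)
    · rw [grSign_bot hG hf]
      simp [muConv, hμ_refl, hR'_refl, coeff_one]
    · have := congrArg (coeff · K)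
        (reflect_muConv hrk hμ_refl hμ_sum (hR'_refl x) (hR'_rec x) hd z.2)
      simpa only [coeff_reflect, revAt_le hK] using this
    · have := grSign_reflect hG hf z K (by rwa [hρ])
      rwa [hρ] at this
    · exact natDegree_le_iff_coeff_eq_zero.1 (natDegree_muConv_le hrk hd z.1) K hK
    · exact grSign_eq_zero hG hf z K (by rwa [hρ])
    · rw [hsum z K (by omega)]
      refine hlow z (bot_lt_iff_ne_bot.2 hz) _ (by omega)
    · exact sum_grSign_eq_zero hG hf z K hz (by rwa [hρ])
  have := sum_grSign_nonneg hG hf ⟨y, hxy⟩ (rk y - rk x - n)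
  rw [hρ, ← Finset.sum_congr rfl fun w _ => key w _, hsum _ _ (by simp)] at this
  rwa [show rk y - rk x - (rk y - rk x - n) = n by omega] at this
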